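/- arXiv:math/0504230 — 3 statements merged into one kernel-verified Lean document; each statement's English description precedes it below -/
import Mathlib

section
/- Let P ⊆ ℝ^d be a rational d-polytope with denominator p and let u ∈ ℝ^d be a fixed vector. For integers t ≥ 1 let D_{P,u}(t) = #{m ∈ ℤ^d : there is ε₀ > 0 such that m + ε·u ∈ tP for all ε ∈ (0, ε₀]}, and let D_{−P°,u}(t) = #{m ∈ ℤ^d : there is ε₀ > 0 such that m + ε·u ∈ −tP° for all ε ∈ (0, ε₀]}, where −P° = {−x : x ∈ P°} and P° is the interior of P. Then there exist polynomials q_0, …, q_{p−1} ∈ ℚ[T] such that for every integer t ≥ 1 one has D_{P,u}(t) = q_{t mod p}(t) and q_{(−t) mod p}(−t) = (−1)^d · D_{−P°,u}(t). -/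
open Set Polynomial Pointwise

noncomputable section

/-- The residue of an integer `t` modulo a positive integer `p`, as an element of `Fin p`. -/
def resMod (p : ℕ) (hp : 0 < p) (t : ℤ) : Fin p :=
  ⟨(t % (p : ℤ)).toNat, by
    have h1 : 0 ≤ t % (p : ℤ) := Int.emod_nonneg t (by exact_mod_cast hp.ne')
    have h2 : t % (p : ℤ) < (p : ℤ) := Int.emod_lt_of_pos t (by exact_mod_cast hp)
    omega⟩

/-- The set of lattice points `m ∈ ℤ^d` such that `m + ε•u ∈ A` for all sufficiently
small `ε > 0`. -/
def DSet (d : ℕ) (u : Fin d → ℝ) (A : Set (Fin d → ℝ)) : Set (Fin d → ℤ) :=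
  {m | ∃ ε₀ > (0 : ℝ), ∀ ε : ℝ, 0 < ε → ε ≤ ε₀ → (fun i => (m i : ℝ)) + ε • u ∈ A}

open Filter Topology Module

/-- The functionals `f i`, `i ∈ B`, form the basis dual to the basis `a i`, `i ∈ B`, of `W`. -/
structure IsDualFrame {ι W : Type*} [DecidableEq ι] [AddCommGroup W] [Module ℝ W]
    (a : ι → W) (B : Finset ι) (f : ι → W →ₗ[ℝ] ℝ) : Prop where
  apply_eq : ∀ i ∈ B, ∀ j ∈ B, f i (a j) = if i = j then 1 else 0
  sum_eq : ∀ x, ∑ i ∈ B, f i x • a i = x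

namespace IsDualFrame

variable {ι W : Type*} [DecidableEq ι] [AddCommGroup W] [Module ℝ W]
  {a : ι → W} {B : Finset ι} {f : ι → W →ₗ[ℝ] ℝ}

lemma apply_sum (h : IsDualFrame a B f) (c : ι → ℝ) {i : ι} (hi : i ∈ B) :
    f i (∑ j ∈ B, c j • a j) = c i := by
  rw [map_sum, Finset.sum_eq_single_of_mem i hi]
  · simp [h.apply_eq i hi i hi]
  · intro j hj hji
    simp [h.apply_eq i hi j hj, hji.symm]

lemma card_eq_finrank (h : IsDualFrame a B f) : B.card = finrank ℝ W := by
  let e : W ≃ₗ[ℝ] (B → ℝ) :=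
    { toFun := fun x i => f i x
      map_add' := fun x y => by ext; simp
      map_smul' := fun r x => by ext; simp
      invFun := fun c => ∑ i : B, c i • a i
      left_inv := fun x => by
        exact (Finset.sum_coe_sort B fun i => f i x • a i).trans (h.sum_eq x)
      right_inv := fun c => by
        ext i
        have key := h.apply_sum (fun j => if hj : j ∈ B then c ⟨j, hj⟩ else 0) i.2
        rw [← Finset.sum_coe_sort B] at key
        simpa using key }
  rw [e.finrank_eq]
  simp

end IsDualFrame

section Triangulation

variable {ι W : Type*}

lemma exists_isDualFrame [Fintype ι] [DecidableEq ι] [AddCommGroup W] [Module ℝ W] (a : ι → W)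
    {s t : Set ι} (hst : s ⊆ t)
    (hs : LinearIndepOn ℝ a s) (ht : ⊤ ≤ Submodule.span ℝ (a '' t)) :
    ∃ B f, IsDualFrame a B f ∧ s ⊆ B ∧ (B : Set ι) ⊆ t := by
  classical
  set b := hs.extend hst
  have hb : LinearIndepOn ℝ a b := hs.linearIndepOn_extend hst
  have hspan : ⊤ ≤ Submodule.span ℝ (Set.range fun i : b => a i) := by
    rw [← Set.image_eq_range, hs.span_image_extend_eq_span_image hst]
    exact ht
  let bs : Basis b ℝ W := Basis.mk hb hspan
  have hbs : ∀ i : b, bs i = a i := fun i => Basis.mk_apply hb hspan i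
  refine ⟨b.toFinset, fun i => if h : i ∈ b then bs.coord ⟨i, h⟩ else 0, ⟨?_, ?_⟩, ?_, ?_⟩
  · intro i hi j hj
    rw [Set.mem_toFinset] at hi hj
    rw [dif_pos hi, ← hbs ⟨j, hj⟩]
    simp [Finsupp.single_apply, eq_comm]
  · intro x
    rw [← Finset.sum_coe_sort]
    conv_rhs => rw [← bs.sum_repr x]
    refine Fintype.sum_equiv (Equiv.subtypeEquivRight fun i => by simp) _ _ ?_
    rintro ⟨i, hi⟩
    rw [Set.mem_toFinset] at hi
    simp only [dif_pos hi, hbs]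
    rfl
  · simpa using hs.subset_extend hst
  · simpa using hs.extend_subset hst

lemma exists_mem_forall_ne_zero [NormedAddCommGroup W] [NormedSpace ℝ W] [FiniteDimensional ℝ W]
    {κ : Type*} [Finite κ] (g : κ → W →ₗ[ℝ] ℝ) (hg : ∀ k, g k ≠ 0) {U : Set W} (hU : IsOpen U)
    (hne : U.Nonempty) : ∃ x ∈ U, ∀ k, g k x ≠ 0 := by
  have : CompleteSpace W := FiniteDimensional.complete ℝ W
  have hd : Dense (⋂ k, {x | g k x ≠ 0}) := by
    refine dense_iInter_of_isOpen (fun k => ?_) fun k => ?_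
    · exact isOpen_ne_fun (g k).continuous_of_finiteDimensional continuous_const
    · by_contra hnd
      have : ((LinearMap.ker (g k) : Set W)ᶜ) = {x | g k x ≠ 0} := by ext; simp
      rw [← this, ← interior_eq_empty_iff_dense_compl, ← ne_eq, ← Set.nonempty_iff_ne_empty] at hnd
      exact hg k (LinearMap.ker_eq_top.1 (Submodule.eq_top_of_nonempty_interior' _ hnd))
  obtain ⟨x, hxU, hx⟩ := hd.inter_open_nonempty U hU hne
  exact ⟨x, hxU, by simpa using hx⟩

/-- The cone of nonnegative combinations of the vectors `a i`. -/
def coneOf [Fintype ι] [AddCommGroup W] [Module ℝ W] (a : ι → W) : Set W :=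
  {x | ∃ l : ι → ℝ, (∀ i, 0 ≤ l i) ∧ ∑ i, l i • a i = x}

lemma add_mem_coneOf [Fintype ι] [AddCommGroup W] [Module ℝ W] {a : ι → W} {x y : W}
    (hx : x ∈ coneOf a)
    (hy : y ∈ coneOf a) : x + y ∈ coneOf a := by
  obtain ⟨l, hl, rfl⟩ := hx
  obtain ⟨m, hm, rfl⟩ := hy
  exact ⟨l + m, fun i => add_nonneg (hl i) (hm i), by simp [add_smul, Finset.sum_add_distrib]⟩

lemma smul_mem_coneOf [Fintype ι] [AddCommGroup W] [Module ℝ W] {a : ι → W} {x : W} {r : ℝ}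
    (hr : 0 ≤ r)
    (hx : x ∈ coneOf a) : r • x ∈ coneOf a := by
  obtain ⟨l, hl, rfl⟩ := hx
  exact ⟨fun i => r * l i, fun i => mul_nonneg hr (hl i), by simp [mul_smul, Finset.smul_sum]⟩

lemma IsDualFrame.mem_coneOf [Fintype ι] [DecidableEq ι] [AddCommGroup W] [Module ℝ W] {a : ι → W}
    {B : Finset ι}
    {f : ι → W →ₗ[ℝ] ℝ} (h : IsDualFrame a B f) {x : W} (hx : ∀ i ∈ B, 0 ≤ f i x) :
    x ∈ coneOf a := by
  refine ⟨fun i => if i ∈ B then f i x else 0, fun i => ?_, ?_⟩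
  · dsimp only
    split_ifs with hi
    exacts [hx i hi, le_rfl]
  · simpa [ite_smul] using h.sum_eq x

lemma exists_minimal_coefficients [Fintype ι] [NormedAddCommGroup W] [NormedSpace ℝ W] {a : ι → W}
    (h : W →ₗ[ℝ] ℝ) (ha : ∀ i, 0 < h (a i)) (w : ι → ℝ) {x : W} (hx : x ∈ coneOf a) :
    ∃ l : ι → ℝ, (∀ i, 0 ≤ l i) ∧ ∑ i, l i • a i = x ∧
      ∀ m : ι → ℝ, (∀ i, 0 ≤ m i) → ∑ i, m i • a i = x → ∑ i, w i * l i ≤ ∑ i, w i * m i := by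
  let S : Set (ι → ℝ) := {l | (∀ i, 0 ≤ l i) ∧ ∑ i, l i • a i = x}
  have hS : IsCompact S := by
    refine IsCompact.of_isClosed_subset
      (isCompact_Icc (a := (0 : ι → ℝ)) (b := fun i => h x / h (a i))) ?_ ?_
    · have h1 : IsClosed {l : ι → ℝ | ∀ i, 0 ≤ l i} := by
        simp only [Set.ofPred_forall]
        exact isClosed_iInter fun i => isClosed_le continuous_const (continuous_apply i)
      have h2 : IsClosed {l : ι → ℝ | ∑ i, l i • a i = x} :=
        isClosed_eq (by fun_prop) continuous_const
      exact h1.inter h2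
    · rintro l ⟨hl, rfl⟩
      refine ⟨hl, fun i => ?_⟩
      rw [le_div_iff₀ (ha i), map_sum]
      simp only [map_smul, smul_eq_mul]
      exact Finset.single_le_sum (f := fun j => l j * h (a j))
        (fun j _ => mul_nonneg (hl j) (ha j).le) (Finset.mem_univ i)
  obtain ⟨l, hl, hmin⟩ := hS.exists_isMinOn (f := fun l => ∑ i, w i * l i) hx
    (by fun_prop)
  exact ⟨l, hl.1, hl.2, fun m hm hmx => hmin (show m ∈ S from ⟨hm, hmx⟩)⟩

/-- The cost of `a v` relative to the basis `B`, for the weights `w`. -/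
def reducedCost [AddCommGroup W] [Module ℝ W] (a : ι → W) (B : Finset ι) (f : ι → W →ₗ[ℝ] ℝ)
    (w : ι → ℝ) (v : ι) : ℝ :=
  w v - ∑ i ∈ B, w i * f i (a v)

lemma reducedCost_eq_zero [DecidableEq ι] [AddCommGroup W] [Module ℝ W] {a : ι → W} {B : Finset ι}
    {f : ι → W →ₗ[ℝ] ℝ} (h : IsDualFrame a B f) (w : ι → ℝ) {v : ι} (hv : v ∈ B) :
    reducedCost a B f w v = 0 := by
  rw [reducedCost, Finset.sum_eq_single_of_mem v hv]
  · simp [h.apply_eq v hv v hv]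
  · intro i hi hiv
    simp [h.apply_eq i hi v hv, hiv]

lemma exists_generic_weights [Fintype ι] [DecidableEq ι] [AddCommGroup W] [Module ℝ W] (a : ι → W)
    (F : Finset ι → ι → W →ₗ[ℝ] ℝ) :
    ∃ w : ι → ℝ, ∀ B : Finset ι, ∀ v ∉ B, reducedCost a B (F B) w v ≠ 0 := by
  let g : {k : Finset ι × ι // k.2 ∉ k.1} → (ι → ℝ) →ₗ[ℝ] ℝ := fun k =>
    LinearMap.proj k.1.2 - ∑ i ∈ k.1.1, F k.1.1 i (a k.1.2) • LinearMap.proj i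
  have hg : ∀ k w, g k w = reducedCost a k.1.1 (F k.1.1) w k.1.2 := fun k w => by
    simp [g, reducedCost, mul_comm]
  have hg0 : ∀ k, g k ≠ 0 := fun k hk => by
    have := congrArg (fun φ => φ (Pi.single k.1.2 1)) hk
    simp only [hg, reducedCost, LinearMap.zero_apply, Pi.single_eq_same] at this
    rw [Finset.sum_eq_zero] at this
    · norm_num at this
    · intro i hi
      rw [Pi.single_eq_of_ne (fun h : i = k.1.2 => k.2 (h ▸ hi)), zero_mul]
  obtain ⟨w, -, hw⟩ := exists_mem_forall_ne_zero g hg0 isOpen_univ Set.univ_nonempty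
  exact ⟨w, fun B v hv => by rw [← hg ⟨(B, v), hv⟩]; exact hw _⟩

lemma sum_sub_frame_eq [Fintype ι] [DecidableEq ι] [AddCommGroup W] [Module ℝ W] {a : ι → W}
    {B : Finset ι}
    {f : ι → W →ₗ[ℝ] ℝ} (h : IsDualFrame a B f) (l : ι → ℝ) (v : ι) (r : ℝ) :
    ∑ i, (l i + r * ((if i = v then 1 else 0) - if i ∈ B then f i (a v) else 0)) • a i
      = ∑ i, l i • a i := by
  have key : ∑ i, ((if i = v then (1 : ℝ) else 0) - if i ∈ B then f i (a v) else 0) • a i = 0 := by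
    simp [sub_smul, Finset.sum_sub_distrib, ite_smul, h.sum_eq]
  simp_rw [add_smul, mul_smul, Finset.sum_add_distrib, ← Finset.smul_sum, key, smul_zero, add_zero]

lemma sum_mul_sub_frame_eq [Fintype ι] [DecidableEq ι] [AddCommGroup W] [Module ℝ W] {a : ι → W}
    {B : Finset ι}
    {f : ι → W →ₗ[ℝ] ℝ} (w l : ι → ℝ) (v : ι) (r : ℝ) :
    ∑ i, w i * (l i + r * ((if i = v then 1 else 0) - if i ∈ B then f i (a v) else 0))
      = ∑ i, w i * l i + r * reducedCost a B f w v := by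
  simp only [mul_add, Finset.sum_add_distrib, reducedCost]
  congr 1
  simp_rw [mul_left_comm _ r, ← Finset.mul_sum, mul_sub, Finset.sum_sub_distrib]
  simp [mul_sub]

/-- The supports of optimal solutions of a generic linear program give a triangulation. -/
theorem exists_triangulation [Fintype ι] [DecidableEq ι] [NormedAddCommGroup W] [NormedSpace ℝ W]
    (a : ι → W) (h : W →ₗ[ℝ] ℝ) (ha : ∀ i, 0 < h (a i))
    (hspan : ⊤ ≤ Submodule.span ℝ (Set.range a)) :
    ∃ (R T : Finset (Finset ι)) (F : Finset ι → ι → W →ₗ[ℝ] ℝ), T ⊆ R ∧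
      (∀ B ∈ R, IsDualFrame a B (F B)) ∧
      (∀ x ∈ coneOf a, (∀ B ∈ R, ∀ i ∈ B, F B i x ≠ 0) → ∃ B ∈ T, ∀ i ∈ B, 0 < F B i x) ∧
      (∀ B ∈ T, ∀ B' ∈ T, ∀ x, (∀ i ∈ B, 0 < F B i x) → (∀ i ∈ B', 0 < F B' i x) → B = B') := by
  classical
  let R : Finset (Finset ι) := Finset.univ.filter fun B => ∃ f, IsDualFrame a B f
  let F : Finset ι → ι → W →ₗ[ℝ] ℝ := fun B =>
    if hB : ∃ f, IsDualFrame a B f then hB.choose else 0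
  have hF : ∀ B, (∃ f, IsDualFrame a B f) → IsDualFrame a B (F B) := fun B hB => by
    simp only [F, dif_pos hB]
    exact hB.choose_spec
  obtain ⟨w, hw⟩ := exists_generic_weights a F
  refine ⟨R, R.filter fun B => ∀ v ∉ B, 0 < reducedCost a B (F B) w v, F, Finset.filter_subset _ _,
    fun B hB => hF B (by simpa [R] using hB), ?_, ?_⟩
  · intro x hx hgen
    obtain ⟨l, hl, hlx, hmin⟩ := exists_minimal_coefficients h ha w hx
    -- A frame contained in the support of the optimal solution.
    obtain ⟨B, hBframe, hBsupp⟩ : ∃ B : Finset ι, IsDualFrame a B (F B) ∧ ∀ i ∈ B, 0 < l i := by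
      let S : Set ι := {i | 0 < l i}
      have h0 : LinearIndepOn ℝ a (∅ : Set ι) := linearIndepOn_empty ℝ a
      let b := h0.extend (Set.empty_subset S)
      obtain ⟨B, f, hf, hbB, -⟩ := exists_isDualFrame a (Set.subset_univ b)
        (h0.linearIndepOn_extend _) (by simpa using hspan)
      have hB := hF B ⟨f, hf⟩
      refine ⟨B, hB, fun i hi => ?_⟩
      by_contra hil
      have hib : i ∉ b := fun hib => hil (h0.extend_subset (Set.empty_subset S) hib)
      refine hgen B (by simpa [R] using ⟨f, hf⟩) i hi ?_
      have hxs : x ∈ Submodule.span ℝ (a '' b) := by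
        rw [h0.span_image_extend_eq_span_image, ← hlx]
        refine Submodule.sum_mem _ fun j _ => ?_
        rcases (hl j).eq_or_lt with hj | hj
        · simp [← hj]
        · exact Submodule.smul_mem _ _ (Submodule.subset_span ⟨j, hj, rfl⟩)
      have hker : Submodule.span ℝ (a '' b) ≤ LinearMap.ker (F B i) := by
        rw [Submodule.span_le]
        rintro _ ⟨j, hj, rfl⟩
        have hij : i ≠ j := fun hij => hib (hij ▸ hj)
        simp [hB.apply_eq i hi j (hbB hj), hij]
      simpa using hker hxs
    -- Moving along an edge cannot improve the optimum.
    have hmove : ∀ v ∉ B, ∀ s : ℝ, (∀ᶠ r in 𝓝[>] (0 : ℝ), 0 ≤ l v + r * s) →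
        0 ≤ s * reducedCost a B (F B) w v := by
      intro v hv s hs
      have hev : ∀ᶠ r in 𝓝[>] (0 : ℝ), ∀ i, 0 ≤ l i + (r * s) *
          ((if i = v then 1 else 0) - if i ∈ B then F B i (a v) else 0) := by
        rw [eventually_all]
        intro i
        by_cases hi : i ∈ B
        · have hc : Tendsto (fun r : ℝ => l i + (r * s) *
              ((if i = v then 1 else 0) - if i ∈ B then F B i (a v) else 0))
              (𝓝[>] 0) (𝓝 (l i)) := by
            refine tendsto_nhdsWithin_of_tendsto_nhds ?_
            have : Continuous (fun r : ℝ => l i + (r * s) *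
              ((if i = v then 1 else 0) - if i ∈ B then F B i (a v) else 0)) := by fun_prop
            simpa using this.tendsto 0
          exact (hc.eventually (lt_mem_nhds (hBsupp i hi))).mono fun r hr => hr.le
        · by_cases hiv : i = v
          · subst hiv
            simpa [hi] using hs
          · simp [hi, hiv, hl i]
      obtain ⟨r, hr, hr0⟩ := (hev.and self_mem_nhdsWithin).exists
      have := hmin _ hr (by rw [sum_sub_frame_eq hBframe, hlx])
      rw [sum_mul_sub_frame_eq, mul_assoc] at this
      have hr0 : 0 < r := hr0
      by_contra hneg
      nlinarith [mul_pos hr0 (neg_pos.2 (not_le.1 hneg))]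
    have hpos : ∀ v ∉ B, 0 < reducedCost a B (F B) w v := fun v hv => by
      refine lt_of_le_of_ne ?_ (hw B v hv).symm
      have := hmove v hv 1 (by
        filter_upwards [self_mem_nhdsWithin] with r hr
        have : 0 < r := hr
        linarith [hl v])
      linarith
    have hzero : ∀ v ∉ B, l v = 0 := fun v hv => by
      by_contra hlv
      have hlv : 0 < l v := lt_of_le_of_ne (hl v) (Ne.symm hlv)
      have := hmove v hv (-1) (by
        filter_upwards [Ioo_mem_nhdsGT hlv] with r hr
        linarith [hr.2])
      linarith [hpos v hv]
    refine ⟨B, by simpa [R] using ⟨⟨F B, hBframe⟩, hpos⟩, fun i hi => ?_⟩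
    have hxB : x = ∑ i ∈ B, l i • a i := by
      rw [← hlx]
      exact (Finset.sum_subset (Finset.subset_univ B) fun j _ hj => by simp [hzero j hj]).symm
    rw [hxB, hBframe.apply_sum l hi]
    exact hBsupp i hi
  · -- Both frames support optimal solutions of the same linear program.
    have hsub : ∀ B ∈ R, ∀ B' ∈ R, (∀ v ∉ B, 0 < reducedCost a B (F B) w v) →
        ∀ x, (∀ i ∈ B', 0 < F B' i x) →
        ∑ i ∈ B, w i * F B i x ≤ ∑ i ∈ B', w i * F B' i x ∧
        (∑ i ∈ B, w i * F B i x = ∑ i ∈ B', w i * F B' i x → B' ⊆ B) := by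
      intro B hB B' hB' hc x hx
      have hB : IsDualFrame a B (F B) := hF B (by simpa [R] using hB)
      have hB' : IsDualFrame a B' (F B') := hF B' (by simpa [R] using hB')
      have hdiff : ∑ i ∈ B', w i * F B' i x - ∑ i ∈ B, w i * F B i x
          = ∑ v ∈ B', F B' v x * reducedCost a B (F B) w v := by
        simp only [reducedCost, mul_sub, Finset.sum_sub_distrib]
        congr 1
        · exact Finset.sum_congr rfl fun i _ => mul_comm _ _
        · simp_rw [Finset.mul_sum]
          rw [Finset.sum_comm]
          refine Finset.sum_congr rfl fun i _ => ?_
          conv_lhs => rw [← hB'.sum_eq x]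
          simp only [map_sum, map_smul, smul_eq_mul, Finset.mul_sum]
          exact Finset.sum_congr rfl fun j _ => by ring
      have hnn : ∀ v ∈ B', 0 ≤ F B' v x * reducedCost a B (F B) w v := fun v hv => by
        refine mul_nonneg (hx v hv).le ?_
        by_cases hvB : v ∈ B
        · exact (reducedCost_eq_zero hB w hvB).ge
        · exact (hc v hvB).le
      refine ⟨by linarith [Finset.sum_nonneg hnn], fun heq v hv => ?_⟩
      rw [heq, sub_self] at hdiff
      have hz := (Finset.sum_eq_zero_iff_of_nonneg hnn).1 hdiff.symm v hv
      by_contra hvB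
      exact (mul_pos (hx v hv) (hc v hvB)).ne' hz
    intro B hB B' hB' x hx hx'
    rw [Finset.mem_filter] at hB hB'
    obtain ⟨h1, h2⟩ := hsub B hB.1 B' hB'.1 hB.2 x hx'
    obtain ⟨h3, h4⟩ := hsub B' hB'.1 B hB.1 hB'.2 x hx
    exact Finset.Subset.antisymm (h4 (le_antisymm h3 h1)) (h2 (le_antisymm h1 h3))

end Triangulation

section Germ

/-- `x + ε • u + δ • c` is positive for all infinitesimals `0 < δ ≪ ε ≪ 1`, if `c ≠ 0`. -/
def GermPos (x u c : ℝ) : Prop :=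
  0 < x ∨ x = 0 ∧ (0 < u ∨ u = 0 ∧ 0 < c)

/-- The filter of pairs of infinitesimals `0 < δ ≪ ε ≪ 1`. -/
def germFilter : Filter (ℝ × ℝ) :=
  (𝓝[>] (0 : ℝ)).curry (𝓝[>] (0 : ℝ))

instance germFilter_neBot : germFilter.NeBot := by
  refine ⟨fun h => ?_⟩
  have hF : ∀ᶠ e in germFilter, False := by simp [h]
  rw [germFilter, eventually_curry_iff] at hF
  simp only [Filter.eventually_false_iff_eq_bot] at hF
  have hbot : (𝓝[>] (0 : ℝ)) ≠ ⊥ := NeBot.ne inferInstance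
  simp [hbot] at hF

lemma eventually_germFilter {q : ℝ × ℝ → Prop} :
    (∀ᶠ e in germFilter, q e) ↔ ∀ᶠ ε in 𝓝[>] (0 : ℝ), ∀ᶠ δ in 𝓝[>] (0 : ℝ), q (ε, δ) :=
  eventually_curry_iff

lemma eventually_pos_add_mul {x : ℝ} (c : ℝ) (hx : 0 < x) :
    ∀ᶠ δ in 𝓝[>] (0 : ℝ), 0 < x + δ * c := by
  have h : Continuous fun δ : ℝ => x + δ * c := by fun_prop
  exact ((h.tendsto 0).mono_left nhdsWithin_le_nhds).eventually (lt_mem_nhds (by simpa using hx))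

lemma GermPos.eventually {x u c : ℝ} (h : GermPos x u c) :
    ∀ᶠ e in germFilter, 0 < x + e.1 * u + e.2 * c := by
  rw [eventually_germFilter]
  rcases h with hx | ⟨rfl, hu | ⟨rfl, hc⟩⟩
  · filter_upwards [eventually_pos_add_mul u hx] with ε hε
    exact eventually_pos_add_mul c hε
  · filter_upwards [self_mem_nhdsWithin] with ε hε
    exact eventually_pos_add_mul c (by simpa using mul_pos hε hu)
  · refine Eventually.of_forall fun ε => ?_
    filter_upwards [self_mem_nhdsWithin] with δ hδ
    simpa using mul_pos hδ hc

lemma GermPos.neg_of_not {x u c : ℝ} (hc : c ≠ 0) (h : ¬ GermPos x u c) :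
    GermPos (-x) (-u) (-c) := by
  simp only [GermPos, not_or, not_and, not_lt, neg_pos, neg_eq_zero] at h ⊢
  rcases h.1.lt_or_eq with hx | hx
  · exact Or.inl hx
  · refine Or.inr ⟨hx, ?_⟩
    obtain ⟨hu, h2⟩ := h.2 hx
    rcases hu.lt_or_eq with hu | hu
    · exact Or.inl hu
    · exact Or.inr ⟨hu, lt_of_le_of_ne (h2 hu) hc⟩

lemma GermPos.eventually_neg {x u c : ℝ} (hc : c ≠ 0) (h : ¬ GermPos x u c) :
    ∀ᶠ e in germFilter, x + e.1 * u + e.2 * c < 0 := by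
  filter_upwards [(GermPos.neg_of_not hc h).eventually] with e he
  linarith

/-- The integer part of `x`, rounding integers down by one if `s` fails. -/
def roundBy (s : Prop) (x : ℝ) : ℤ :=
  open Classical in if s then ⌊x⌋ else ⌈x⌉ - 1

lemma germPos_iff_roundBy {x u c : ℝ} : GermPos x u c ↔ 0 ≤ roundBy (GermPos 0 u c) x := by
  unfold roundBy
  split_ifs with h
  · rw [Int.floor_nonneg]
    simp only [GermPos, lt_irrefl, true_and, false_or] at h
    simp [GermPos, h, le_iff_lt_or_eq, eq_comm]
  · have : 0 ≤ ⌈x⌉ - 1 ↔ 0 < x := by rw [← Int.ceil_pos]; omega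
    rw [this]
    simp only [GermPos, lt_irrefl, true_and, false_or] at h
    simp [GermPos, h]

lemma germPos_zero_neg {u c : ℝ} (hc : c ≠ 0) : GermPos 0 (-u) (-c) ↔ ¬ GermPos 0 u c := by
  refine ⟨fun h h' => ?_, fun h => by simpa using GermPos.neg_of_not hc h⟩
  simp only [GermPos, lt_irrefl, true_and, false_or, neg_pos, neg_eq_zero] at h h'
  rcases h with h | ⟨h, h2⟩ <;> rcases h' with h' | ⟨h', h2'⟩ <;> linarith

lemma eventually_mem_iff_exists_germPos {ι W : Type*} [DecidableEq ι] [AddCommGroup W] [Module ℝ W]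
    {K : Set W} {R T : Finset (Finset ι)} {F : Finset ι → ι → W →ₗ[ℝ] ℝ} (hTR : T ⊆ R)
    (hex : ∀ x ∈ K, (∀ B ∈ R, ∀ i ∈ B, F B i x ≠ 0) → ∃ B ∈ T, ∀ i ∈ B, 0 < F B i x)
    (hmem : ∀ B ∈ T, ∀ x, (∀ i ∈ B, 0 ≤ F B i x) → x ∈ K)
    {c : W} (hc : ∀ B ∈ R, ∀ i ∈ B, F B i c ≠ 0) (x u : W) :
    (∀ᶠ e in germFilter, x + e.1 • u + e.2 • c ∈ K) ↔
      ∃ B ∈ T, ∀ i ∈ B, GermPos (F B i x) (F B i u) (F B i c) := by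
  have hlin : ∀ B i (e : ℝ × ℝ), F B i (x + e.1 • u + e.2 • c)
      = F B i x + e.1 * F B i u + e.2 * F B i c := fun B i e => by simp
  constructor
  · intro h
    by_contra! hno
    have hneg : ∀ᶠ e in germFilter, ∀ B ∈ T, ∃ i ∈ B, F B i (x + e.1 • u + e.2 • c) < 0 := by
      rw [Finset.eventually_all]
      intro B hB
      obtain ⟨i, hi, hng⟩ := hno B hB
      filter_upwards [GermPos.eventually_neg (hc B (hTR hB) i hi) hng] with e he
      exact ⟨i, hi, by rwa [hlin]⟩
    have hgen : ∀ᶠ e in germFilter, ∀ B ∈ R, ∀ i ∈ B, F B i (x + e.1 • u + e.2 • c) ≠ 0 := by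
      rw [Finset.eventually_all]
      intro B hB
      rw [Finset.eventually_all]
      intro i hi
      by_cases hg : GermPos (F B i x) (F B i u) (F B i c)
      · filter_upwards [hg.eventually] with e he
        rw [hlin]
        exact he.ne'
      · filter_upwards [GermPos.eventually_neg (hc B hB i hi) hg] with e he
        rw [hlin]
        exact he.ne
    obtain ⟨e, ⟨he, hn⟩, hg⟩ := ((h.and hneg).and hgen).exists
    obtain ⟨B, hB, hpos⟩ := hex _ he hg
    obtain ⟨i, hi, hlt⟩ := hn B hB
    exact lt_asymm hlt (hpos i hi)
  · rintro ⟨B, hB, hpos⟩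
    have : ∀ᶠ e in germFilter, ∀ i ∈ B, 0 < F B i (x + e.1 • u + e.2 • c) := by
      rw [Finset.eventually_all]
      intro i hi
      simpa only [hlin] using (hpos i hi).eventually
    filter_upwards [this] with e he
    exact hmem B hB _ fun i hi => (he i hi).le

lemma germPos_frame_unique {ι W : Type*} [DecidableEq ι] [AddCommGroup W] [Module ℝ W]
    {T : Finset (Finset ι)} {F : Finset ι → ι → W →ₗ[ℝ] ℝ}
    (huniq : ∀ B ∈ T, ∀ B' ∈ T, ∀ x, (∀ i ∈ B, 0 < F B i x) → (∀ i ∈ B', 0 < F B' i x) → B = B')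
    {x u c : W} {B B' : Finset ι} (hB : B ∈ T) (hB' : B' ∈ T)
    (h : ∀ i ∈ B, GermPos (F B i x) (F B i u) (F B i c))
    (h' : ∀ i ∈ B', GermPos (F B' i x) (F B' i u) (F B' i c)) : B = B' := by
  have key : ∀ B, (∀ i ∈ B, GermPos (F B i x) (F B i u) (F B i c)) →
      ∀ᶠ e in germFilter, ∀ i ∈ B, 0 < F B i (x + e.1 • u + e.2 • c) := fun B h => by
    rw [Finset.eventually_all]
    intro i hi
    simpa using (h i hi).eventually
  obtain ⟨e, he, he'⟩ := ((key B h).and (key B' h')).exists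
  exact huniq B hB B' hB' _ he he'

end Germ

section Counting

lemma roundBy_add_intCast (s : Prop) (x : ℝ) (n : ℤ) : roundBy s (x + n) = roundBy s x + n := by
  unfold roundBy
  split_ifs
  · simp
  · rw [Int.ceil_add_intCast]
    ring

lemma roundBy_not_one_sub {s : Prop} {x : ℝ} (h : roundBy s x = 0) : roundBy (¬ s) (1 - x) = 0 := by
  unfold roundBy at *
  by_cases hs : s
  · simp only [hs, if_true, not_true, if_false, Int.floor_eq_zero_iff, Set.mem_Ico] at h ⊢
    rw [sub_eq_zero, Int.ceil_eq_iff]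
    constructor <;> push_cast <;> linarith [h.1, h.2]
  · simp only [hs, if_false, not_false_eq_true, if_true, sub_eq_zero, Int.ceil_eq_iff,
      Int.floor_eq_zero_iff, Set.mem_Ico] at h ⊢
    push_cast at h
    constructor <;> linarith [h.1, h.2]

lemma mem_Icc_of_roundBy_eq_zero {s : Prop} {x : ℝ} (h : roundBy s x = 0) :
    x ∈ Set.Icc (0 : ℝ) 1 := by
  unfold roundBy at h
  split_ifs at h
  · rw [Int.floor_eq_zero_iff] at h
    exact ⟨h.1, h.2.le⟩
  · rw [sub_eq_zero, Int.ceil_eq_iff] at h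
    push_cast at h
    exact ⟨by linarith [h.1], h.2⟩

/-- The number of weak compositions of `k` into `d + 1` parts, as a polynomial in `k`. -/
def compositionCount (d : ℕ) (k : ℚ) : ℚ :=
  (∏ j ∈ Finset.range d, (k + (j + 1))) / d.factorial

lemma compositionCount_natCast (d n : ℕ) : compositionCount d n = (n + d).choose d := by
  rw [compositionCount, Nat.add_choose, Nat.cast_div (Nat.factorial_mul_factorial_dvd_factorial_add n d)
    (by positivity)]
  have : ((n + d).factorial : ℚ) = n.factorial * ∏ j ∈ Finset.range d, ((n : ℚ) + (j + 1)) := by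
    rw [← Nat.factorial_mul_ascFactorial, Nat.ascFactorial_eq_prod_range]
    push_cast
    congr 1
    exact Finset.prod_congr rfl fun j _ => by ring
  rw [this]
  push_cast
  have h1 : (n.factorial : ℚ) ≠ 0 := by positivity
  field_simp

lemma compositionCount_eq_zero {d : ℕ} {k : ℤ} (h1 : -(d : ℤ) ≤ k) (h2 : k < 0) :
    compositionCount d k = 0 := by
  rw [compositionCount, Finset.prod_eq_zero (i := (-k - 1).toNat), zero_div]
  · rw [Finset.mem_range]
    omega
  · have : (((-k - 1).toNat : ℤ) : ℚ) = -k - 1 := by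
      rw [Int.toNat_of_nonneg (by omega)]
      push_cast
      ring
    rw [Int.cast_natCast] at this
    rw [this]
    ring

lemma compositionCount_neg (d : ℕ) (k : ℚ) :
    compositionCount d (-k) = (-1) ^ d * compositionCount d (k - (d + 1)) := by
  have : ∏ j ∈ Finset.range d, (-k + (j + 1))
      = (-1) ^ d * ∏ j ∈ Finset.range d, (k - (d + 1) + (j + 1)) := by
    rw [← Finset.prod_range_reflect fun j : ℕ => (k - (d + 1) + (j + 1) : ℚ)]
    conv_rhs => rw [← Finset.card_range d, ← Finset.prod_const, Finset.card_range d,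
      ← Finset.prod_mul_distrib]
    refine Finset.prod_congr rfl fun j hj => ?_
    rw [Finset.mem_range] at hj
    have : ((d - 1 - j : ℕ) : ℚ) = d - 1 - j := by
      rw [Nat.sub_sub, Nat.cast_sub (by omega)]
      push_cast
      ring
    rw [this]
    ring
  rw [compositionCount, compositionCount, this, mul_div_assoc]

/-- The polynomial `T ↦ compositionCount d ((T - y) / p)`. -/
def compositionPoly (d p : ℕ) (y : ℤ) : ℚ[X] :=
  (∏ j ∈ Finset.range d, (C (1 / (p : ℚ)) * (X - C (y : ℚ)) + C ((j : ℚ) + 1))) *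
    C (1 / (d.factorial : ℚ))

lemma eval_compositionPoly (d p : ℕ) (y : ℤ) (t : ℚ) :
    (compositionPoly d p y).eval t = compositionCount d ((t - y) / p) := by
  simp only [compositionPoly, compositionCount, eval_mul, eval_prod, eval_add, eval_sub, eval_C,
    eval_X]
  rw [mul_one_div]
  congr 1
  exact Finset.prod_congr rfl fun j _ => by ring

lemma resMod_eq_iff {p : ℕ} (hp : 0 < p) (a b : ℤ) :
    resMod p hp a = resMod p hp b ↔ (p : ℤ) ∣ b - a := by
  rw [← Int.modEq_iff_dvd, Int.ModEq, resMod, resMod, Fin.mk.injEq]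
  have h1 := Int.emod_nonneg a (show (p : ℤ) ≠ 0 by omega)
  have h2 := Int.emod_nonneg b (show (p : ℤ) ≠ 0 by omega)
  omega

/-- The inclusion of the lattice `ℤ^d × ℤ` into `ℝ^d × ℝ`. -/
def latticeHom (d : ℕ) : (Fin d → ℤ) × ℤ →+ (Fin d → ℝ) × ℝ where
  toFun z := (fun i => (z.1 i : ℝ), (z.2 : ℝ))
  map_zero' := by ext <;> simp
  map_add' x y := by ext <;> simp

lemma latticeHom_apply (d : ℕ) (z : (Fin d → ℤ) × ℤ) :
    latticeHom d z = (fun i => (z.1 i : ℝ), (z.2 : ℝ)) := rfl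

variable {d : ℕ} {ι : Type*} [DecidableEq ι]

/-- The lattice points of the half-open parallelepiped spanned by a frame. -/
def boxPoints (B : Finset ι) (f : ι → ((Fin d → ℝ) × ℝ) →ₗ[ℝ] ℝ) (s : ι → Prop) :
    Set ((Fin d → ℤ) × ℤ) :=
  {z | ∀ i ∈ B, roundBy (s i) (f i (latticeHom d z)) = 0}

/-- The lattice points of the half-open simplicial cone spanned by a frame, at height `t`. -/
def coneSlice (B : Finset ι) (f : ι → ((Fin d → ℝ) × ℝ) →ₗ[ℝ] ℝ) (s : ι → Prop) (t : ℤ) :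
    Set (Fin d → ℤ) :=
  {m | ∀ i ∈ B, 0 ≤ roundBy (s i) (f i (latticeHom d (m, t)))}

variable {α : ι → (Fin d → ℤ) × ℤ} {B : Finset ι} {f : ι → ((Fin d → ℝ) × ℝ) →ₗ[ℝ] ℝ}

lemma boxPoints_finite (hf : IsDualFrame (fun i => latticeHom d (α i)) B f) (s : ι → Prop) :
    (boxPoints B f s).Finite := by
  classical
  let M : (Fin d → ℤ) × ℤ := ∑ i ∈ B, (fun k => |(α i).1 k|, |(α i).2|)
  refine (Set.finite_Icc (-M) M).subset fun z hz => ?_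
  have key : ∀ (g : ((Fin d → ℝ) × ℝ) →ₗ[ℝ] ℝ),
      |g (latticeHom d z)| ≤ ∑ i ∈ B, |g (latticeHom d (α i))| := fun g => by
    conv_lhs => rw [← hf.sum_eq (latticeHom d z)]
    rw [map_sum]
    refine (Finset.abs_sum_le_sum_abs _ _).trans (Finset.sum_le_sum fun i hi => ?_)
    have h := mem_Icc_of_roundBy_eq_zero (hz i hi)
    rw [map_smul, smul_eq_mul, abs_mul, abs_of_nonneg h.1]
    exact mul_le_of_le_one_left (abs_nonneg _) h.2
  have h1 : ∀ k, |z.1 k| ≤ M.1 k := fun k => by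
    have := key (LinearMap.proj k ∘ₗ LinearMap.fst ℝ _ _)
    simp only [LinearMap.comp_apply, LinearMap.fst_apply, LinearMap.proj_apply,
      latticeHom_apply] at this
    simp only [M, Prod.fst_sum, Finset.sum_apply]
    exact_mod_cast this
  have h2 : |z.2| ≤ M.2 := by
    have := key (LinearMap.snd ℝ _ _)
    simp only [LinearMap.snd_apply, latticeHom_apply] at this
    simp only [M, Prod.snd_sum]
    exact_mod_cast this
  exact ⟨⟨fun k => (abs_le.1 (h1 k)).1, (abs_le.1 h2).1⟩,
    ⟨fun k => (abs_le.1 (h1 k)).2, (abs_le.1 h2).2⟩⟩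

lemma apply_latticeHom_sum (hf : IsDualFrame (fun i => latticeHom d (α i)) B f) (n : ι → ℤ)
    {i : ι} (hi : i ∈ B) : f i (latticeHom d (∑ j ∈ B, n j • α j)) = n i := by
  rw [← hf.apply_sum (fun j => (n j : ℝ)) hi, map_sum]
  simp_rw [map_zsmul, Int.cast_smul_eq_zsmul]

lemma snd_eq_of_mem_boxPoints {p : ℕ} (hα : ∀ i, (α i).2 = p)
    (hf : IsDualFrame (fun i => latticeHom d (α i)) B f) {s : ι → Prop} {z : (Fin d → ℤ) × ℤ}
    (hz : z ∈ boxPoints B f s) : z.2 ≤ p * (d + 1) := by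
  have hcard : B.card = d + 1 := by rw [hf.card_eq_finrank]; simp
  have h := congrArg Prod.snd (hf.sum_eq (latticeHom d z))
  simp only [Prod.snd_sum, Prod.smul_snd, latticeHom_apply, hα, Int.cast_natCast,
    smul_eq_mul] at h
  have hle : (z.2 : ℝ) ≤ p * (d + 1) := by
    rw [← h]
    calc _ ≤ ∑ i ∈ B, (p : ℝ) := Finset.sum_le_sum fun i hi =>
          mul_le_of_le_one_left (Nat.cast_nonneg p) (mem_Icc_of_roundBy_eq_zero (hz i hi)).2
      _ = _ := by rw [Finset.sum_const, hcard, nsmul_eq_mul]; push_cast; ring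
  exact_mod_cast hle

lemma sub_mem_boxPoints (hf : IsDualFrame (fun i => latticeHom d (α i)) B f) {s : ι → Prop}
    {z : (Fin d → ℤ) × ℤ} (hz : z ∈ boxPoints B f s) :
    ∑ i ∈ B, α i - z ∈ boxPoints B f fun i => ¬ s i := by
  intro i hi
  have := apply_latticeHom_sum hf (fun _ => 1) hi
  simp only [one_smul, Int.cast_one] at this
  rw [map_sub, map_sub, this]
  exact roundBy_not_one_sub (hz i hi)

/-- The multiplicities of the generators in the lattice points at height `t` that reduce to a
given point of the box, at height `y`. -/
def multiplicities (p : ℕ) (B : Finset ι) (t y : ℤ) : Finset (ι →₀ ℕ) :=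
  if (p : ℤ) ∣ t - y ∧ y ≤ t then B.finsuppAntidiag ((t - y) / p).toNat else ∅

lemma mem_multiplicities {p : ℕ} (hp : 0 < p) {t y : ℤ} {n : ι →₀ ℕ} :
    n ∈ multiplicities p B t y ↔ y + p * ∑ i ∈ B, (n i : ℤ) = t ∧ n.support ⊆ B := by
  have hp' : (0 : ℤ) < p := by exact_mod_cast hp
  have hs : 0 ≤ ∑ i ∈ B, (n i : ℤ) := Finset.sum_nonneg fun i _ => Int.natCast_nonneg _
  unfold multiplicities
  split_ifs with h
  · obtain ⟨⟨k, hk⟩, hy⟩ := h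
    have hk0 : 0 ≤ k := by
      by_contra hneg
      nlinarith
    rw [Finset.mem_finsuppAntidiag, hk, Int.mul_ediv_cancel_left _ hp'.ne']
    refine and_congr_left fun _ => ?_
    rw [show t = y + p * k by linarith, add_right_inj, mul_right_inj' hp'.ne']
    rw [← Nat.cast_sum, ← Int.toNat_of_nonneg hk0, Nat.cast_inj, Int.toNat_of_nonneg hk0]
  · simp only [Finset.notMem_empty, false_iff, not_and]
    intro heq
    refine absurd ?_ h
    exact ⟨⟨∑ i ∈ B, (n i : ℤ), by linarith⟩, by nlinarith⟩

lemma card_multiplicities {p : ℕ} (hp : 0 < p) (hB : B.card = d + 1) {t y : ℤ} (ht : 1 ≤ t)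
    (hy : y ≤ p * (d + 1)) :
    ((multiplicities p B t y).card : ℚ)
      = if (p : ℤ) ∣ t - y then compositionCount d ((t - y) / p) else 0 := by
  have hp' : (0 : ℤ) < p := by exact_mod_cast hp
  have hpq : (p : ℚ) ≠ 0 := by positivity
  unfold multiplicities
  by_cases hdvd : (p : ℤ) ∣ t - y
  · obtain ⟨k, hk⟩ := hdvd
    have hkq : ((t : ℚ) - y) / p = (k : ℤ) := by
      rw [div_eq_iff hpq]
      have : ((t - y : ℤ) : ℚ) = ((p * k : ℤ) : ℚ) := by rw [hk]
      push_cast at this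
      linarith
    rw [hkq, hk, Int.mul_ediv_cancel_left _ hp'.ne']
    simp only [dvd_mul_right, true_and, if_true]
    split_ifs with hyt
    · have hk0 : 0 ≤ k := by
        by_contra hneg
        nlinarith
      lift k to ℕ using hk0
      rw [Finset.card_finsuppAntidiag_nat_eq_choose, hB, Int.cast_natCast, compositionCount_natCast,
        Int.toNat_natCast, show d + 1 + k - 1 = k + d by omega, Nat.choose_symm_add]
    · rw [Finset.card_empty, compositionCount_eq_zero, Nat.cast_zero]
      · by_contra hneg
        nlinarith
      · by_contra hneg
        nlinarith
  · simp [hdvd]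

lemma coneSlice_eq_image {p : ℕ} (hp : 0 < p) (hα : ∀ i, (α i).2 = p)
    (hf : IsDualFrame (fun i => latticeHom d (α i)) B f) (s : ι → Prop) (t : ℤ) :
    coneSlice B f s t = (fun yn : ((Fin d → ℤ) × ℤ) × (ι →₀ ℕ) =>
        (yn.1 + ∑ i ∈ B, (yn.2 i : ℤ) • α i).1) ''
      {yn | yn.1 ∈ boxPoints B f s ∧ yn.2 ∈ multiplicities p B t yn.1.2} := by
  ext m
  simp only [coneSlice, Set.mem_ofPred_eq, Set.mem_image, Prod.exists, mem_multiplicities hp]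
  constructor
  · intro hm
    let n : ι → ℤ := fun i => roundBy (s i) (f i (latticeHom d (m, t)))
    let N : ι →₀ ℕ := Finsupp.onFinset B (fun i => if i ∈ B then (n i).toNat else 0)
      fun i hi => by by_contra h; simp [h] at hi
    have hN : ∀ i ∈ B, (N i : ℤ) = n i := fun i hi => by
      simp [N, hi, n, hm i hi]
    have hsum : ∑ i ∈ B, (N i : ℤ) • α i = ∑ i ∈ B, n i • α i :=
      Finset.sum_congr rfl fun i hi => by rw [hN i hi]
    let y : (Fin d → ℤ) × ℤ := (m, t) - ∑ i ∈ B, n i • α i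
    refine ⟨y.1, y.2, N, ⟨fun i hi => ?_, ?_, Finsupp.support_onFinset_subset⟩, ?_⟩
    · rw [Prod.mk.eta, map_sub, map_sub, apply_latticeHom_sum hf n hi, sub_eq_add_neg,
        ← Int.cast_neg, roundBy_add_intCast]
      simp [n]
    · rw [Finset.sum_congr rfl hN]
      simp [y, Prod.snd_sum, hα, Finset.mul_sum, mul_comm]
    · rw [hsum]
      simp [y]
  · rintro ⟨y1, y2, n, ⟨hy, hn, -⟩, rfl⟩ i hi
    have : ((((y1, y2) + ∑ i ∈ B, (n i : ℤ) • α i).1, t) : (Fin d → ℤ) × ℤ)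
        = (y1, y2) + ∑ i ∈ B, (n i : ℤ) • α i := by
      refine Prod.ext rfl ?_
      rw [← hn]
      simp [Prod.snd_sum, hα, Finset.mul_sum, mul_comm]
    rw [this, map_add, map_add, apply_latticeHom_sum hf (fun i => (n i : ℤ)) hi,
      roundBy_add_intCast, hy i hi]
    simp

lemma injOn_box_add {p : ℕ} (hp : 0 < p) (hα : ∀ i, (α i).2 = p)
    (hf : IsDualFrame (fun i => latticeHom d (α i)) B f) (s : ι → Prop) (t : ℤ) :
    Set.InjOn (fun yn : ((Fin d → ℤ) × ℤ) × (ι →₀ ℕ) => (yn.1 + ∑ i ∈ B, (yn.2 i : ℤ) • α i).1)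
      {yn | yn.1 ∈ boxPoints B f s ∧ yn.2 ∈ multiplicities p B t yn.1.2} := by
  rintro ⟨y, n⟩ ⟨hy, hn⟩ ⟨y', n'⟩ ⟨hy', hn'⟩ heq
  simp only [mem_multiplicities hp] at hn hn' heq
  have hsnd : ∀ (y : (Fin d → ℤ) × ℤ) (n : ι →₀ ℕ), (y + ∑ i ∈ B, (n i : ℤ) • α i).2
      = y.2 + p * ∑ i ∈ B, (n i : ℤ) := fun y n => by
    simp [Prod.snd_sum, hα, Finset.mul_sum, mul_comm]
  have hz : y + ∑ i ∈ B, (n i : ℤ) • α i = y' + ∑ i ∈ B, (n' i : ℤ) • α i :=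
    Prod.ext heq (by rw [hsnd, hsnd, hn.1, hn'.1])
  have hnn : n = n' := by
    ext i
    by_cases hi : i ∈ B
    · have := congrArg (fun z => roundBy (s i) (f i (latticeHom d z))) hz
      rw [map_add, map_add, map_add, map_add, apply_latticeHom_sum hf (fun i => (n i : ℤ)) hi,
        apply_latticeHom_sum hf (fun i => (n' i : ℤ)) hi,
        roundBy_add_intCast, roundBy_add_intCast, hy i hi, hy' i hi] at this
      omega
    · rw [Finsupp.notMem_support_iff.1 fun h => hi (hn.2 h),
        Finsupp.notMem_support_iff.1 fun h => hi (hn'.2 h)]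
  subst hnn
  rw [add_left_inj] at hz
  rw [hz]

lemma ncard_coneSlice {p : ℕ} (hp : 0 < p) (hα : ∀ i, (α i).2 = p)
    (hf : IsDualFrame (fun i => latticeHom d (α i)) B f) (s : ι → Prop) {t : ℤ} (ht : 1 ≤ t) :
    (coneSlice B f s t).Finite ∧ ((coneSlice B f s t).ncard : ℚ)
      = ∑ y ∈ (boxPoints_finite hf s).toFinset,
          if (p : ℤ) ∣ t - y.2 then compositionCount d ((t - y.2) / p) else 0 := by
  classical
  let Y := (boxPoints_finite hf s).toFinset
  let S := Y.sigma fun y => multiplicities p B t y.2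
  have hS : {yn : ((Fin d → ℤ) × ℤ) × (ι →₀ ℕ) |
      yn.1 ∈ boxPoints B f s ∧ yn.2 ∈ multiplicities p B t yn.1.2}
      = (S.map (Equiv.sigmaEquivProd _ _).toEmbedding : Set _) := by
    ext ⟨y, n⟩
    simp [S, Y]
  have hcard : B.card = d + 1 := by rw [hf.card_eq_finrank]; simp
  rw [coneSlice_eq_image hp hα hf]
  refine ⟨Set.Finite.image _ (by rw [hS]; exact Finset.finite_toSet _), ?_⟩
  rw [(injOn_box_add hp hα hf s t).ncard_image, hS, Set.ncard_coe_finset,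
    Finset.card_map, Finset.card_sigma, Nat.cast_sum]
  refine Finset.sum_congr rfl fun y hy => ?_
  exact card_multiplicities hp hcard ht
    (snd_eq_of_mem_boxPoints hα hf ((boxPoints_finite hf s).mem_toFinset.1 hy))

/-- Reciprocity for the lattice point count of a half-open simplicial cone. -/
theorem exists_coneSlice_polynomial {p : ℕ} (hp : 0 < p) (hα : ∀ i, (α i).2 = p)
    (hf : IsDualFrame (fun i => latticeHom d (α i)) B f) (s : ι → Prop) :
    ∃ q : Fin p → ℚ[X], ∀ t : ℕ, 1 ≤ t →
      ((coneSlice B f s t).ncard : ℚ) = (q (resMod p hp t)).eval (t : ℚ) ∧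
      (q (resMod p hp (-(t : ℤ)))).eval (-(t : ℚ))
        = (-1) ^ d * ((coneSlice B f (fun i => ¬ s i) t).ncard : ℚ) := by
  classical
  have hpq : (p : ℚ) ≠ 0 := by positivity
  have hcard : B.card = d + 1 := by rw [hf.card_eq_finrank]; simp
  refine ⟨fun r => ∑ y ∈ (boxPoints_finite hf s).toFinset,
    if resMod p hp y.2 = r then compositionPoly d p y.2 else 0, fun t ht => ⟨?_, ?_⟩⟩
  · rw [(ncard_coneSlice hp hα hf s (by exact_mod_cast ht)).2, eval_finsetSum]
    refine Finset.sum_congr rfl fun y _ => ?_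
    simp only [resMod_eq_iff, apply_ite (eval (t : ℚ)), eval_compositionPoly, eval_zero,
      Int.cast_natCast]
  · rw [(ncard_coneSlice hp hα hf (fun i => ¬ s i) (by exact_mod_cast ht)).2, eval_finsetSum,
      Finset.mul_sum]
    refine Finset.sum_nbij' (fun y => ∑ i ∈ B, α i - y) (fun y => ∑ i ∈ B, α i - y) ?_ ?_ ?_ ?_ ?_
    · intro y hy
      rw [Set.Finite.mem_toFinset] at hy ⊢
      exact sub_mem_boxPoints hf hy
    · intro y hy
      rw [Set.Finite.mem_toFinset] at hy ⊢
      simpa using sub_mem_boxPoints hf hy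
    · simp
    · simp
    · intro y _
      have hsnd : (∑ i ∈ B, α i - y).2 = p * (d + 1) - y.2 := by
        simp [Prod.snd_sum, hα, hcard, mul_comm]
      have hdvd : (p : ℤ) ∣ -(t : ℤ) - y.2 ↔ (p : ℤ) ∣ t - (p * (d + 1) - y.2) := by
        rw [← dvd_neg, show -(-(t : ℤ) - y.2) = (t - (p * (d + 1) - y.2)) + p * (d + 1) by ring]
        exact dvd_add_left (dvd_mul_right _ _)
      simp only [resMod_eq_iff, hdvd, hsnd, apply_ite (eval (-(t : ℚ))), eval_compositionPoly,
        eval_zero, mul_ite, mul_zero]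
      congr 1
      rw [show (-(t : ℚ) - y.2) / p = -((t + y.2) / p) by ring, compositionCount_neg]
      congr 2
      push_cast
      field_simp
      ring

end Counting

section Homogenization

lemma mem_coneOf_homogenization {E : Type*} [AddCommGroup E] [Module ℝ E] (V : Finset E) {p : ℝ}
    (hp : 0 < p) {y : E} {s : ℝ} (hs : 0 < s) :
    (y, s) ∈ coneOf (fun v : V => (p • (v : E), p)) ↔ y ∈ s • convexHull ℝ (V : Set E) := by
  classical
  rw [Set.mem_smul_set_iff_inv_smul_mem₀ hs.ne', Finset.mem_convexHull']
  constructor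
  · rintro ⟨l, hl, hsum⟩
    have h1 := congrArg Prod.fst hsum
    have h2 := congrArg Prod.snd hsum
    simp only [Prod.fst_sum, Prod.snd_sum, Prod.smul_fst, Prod.smul_snd, smul_eq_mul] at h1 h2
    refine ⟨fun x => if h : x ∈ V then s⁻¹ * (l ⟨x, h⟩ * p) else 0, fun x hx => ?_, ?_, ?_⟩
    · dsimp only
      rw [dif_pos hx]
      have := hl ⟨x, hx⟩
      positivity
    · rw [← Finset.sum_coe_sort]
      simp only [Finset.coe_mem, dif_pos, Subtype.coe_eta]
      rw [← Finset.mul_sum, h2, inv_mul_cancel₀ hs.ne']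
    · rw [← Finset.sum_coe_sort, ← h1, Finset.smul_sum]
      exact Finset.sum_congr rfl fun v _ => by simp [mul_smul]
  · rintro ⟨w, hw, hw1, hwy⟩
    refine ⟨fun v => s * w v / p, fun v => ?_, Prod.ext ?_ ?_⟩
    · have := hw v v.2
      positivity
    · have hy : y = s • ∑ x ∈ V, w x • x := by rw [hwy, smul_inv_smul₀ hs.ne']
      rw [Prod.fst_sum, hy]
      dsimp only
      rw [Finset.smul_sum, ← Finset.sum_coe_sort V (fun x => s • w x • x)]
      refine Finset.sum_congr rfl fun v _ => ?_
      rw [Prod.smul_fst, smul_smul, smul_smul, div_mul_cancel₀ _ hp.ne']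
    · rw [Prod.snd_sum]
      simp only [Prod.smul_snd, smul_eq_mul, div_mul_cancel₀ _ hp.ne', ← Finset.mul_sum]
      rw [Finset.sum_coe_sort V w, hw1, mul_one]

/-- The open cone over the interior of `P`, placed at height one. -/
def openCone {E : Type*} [NormedAddCommGroup E] [NormedSpace ℝ E] (P : Set E) : Set (E × ℝ) :=
  {x | 0 < x.2 ∧ x.2⁻¹ • x.1 ∈ interior P}

section

variable {E : Type*} [NormedAddCommGroup E] [NormedSpace ℝ E] {P : Set E}

lemma isOpen_openCone (P : Set E) : IsOpen (openCone P) := by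
  have hpos : IsOpen {x : E × ℝ | 0 < x.2} := isOpen_lt continuous_const continuous_snd
  have hc : ContinuousOn (fun x : E × ℝ => x.2⁻¹ • x.1) {x : E × ℝ | 0 < x.2} :=
    (continuousOn_snd.inv₀ fun x hx => ne_of_gt hx).smul continuousOn_fst
  exact hc.isOpen_inter_preimage hpos isOpen_interior

lemma mem_openCone_iff {y : E} {s : ℝ} (hs : 0 < s) :
    (y, s) ∈ openCone P ↔ y ∈ s • interior P := by
  rw [Set.mem_smul_set_iff_inv_smul_mem₀ hs.ne']
  exact and_iff_right hs

variable {K : Set (E × ℝ)}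

lemma openCone_subset (hK : ∀ y s, 0 < s → ((y, s) ∈ K ↔ y ∈ s • P)) : openCone P ⊆ K := by
  rintro ⟨y, s⟩ h
  rw [hK y s h.1]
  exact Set.smul_set_mono interior_subset ((mem_openCone_iff h.1).1 h)

lemma mem_smul_iff_eventually (hK : ∀ y s, 0 < s → ((y, s) ∈ K ↔ y ∈ s • P))
    (hadd : ∀ x ∈ K, ∀ y ∈ K, x + y ∈ K) (hsmul : ∀ r : ℝ, 0 < r → ∀ x ∈ K, r • x ∈ K)
    (hP : IsClosed P) {c : E × ℝ} (hc : c ∈ openCone P) {y : E} {s : ℝ} (hs : 0 < s) :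
    y ∈ s • P ↔ ∀ᶠ δ in 𝓝[>] (0 : ℝ), (y, s) + δ • c ∈ K := by
  constructor
  · intro hy
    filter_upwards [self_mem_nhdsWithin] with δ hδ
    exact hadd _ ((hK y s hs).2 hy) _ (hsmul δ hδ c (openCone_subset hK hc))
  · intro h
    rw [Set.mem_smul_set_iff_inv_smul_mem₀ hs.ne']
    have ht : Tendsto (fun δ : ℝ => (s + δ * c.2)⁻¹ • (y + δ • c.1)) (𝓝[>] 0) (𝓝 (s⁻¹ • y)) := by
      refine tendsto_nhdsWithin_of_tendsto_nhds ?_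
      have h1 : Tendsto (fun δ : ℝ => s + δ * c.2) (𝓝 0) (𝓝 s) := by
        have : Continuous fun δ : ℝ => s + δ * c.2 := by fun_prop
        simpa using this.tendsto 0
      have h2 : Tendsto (fun δ : ℝ => y + δ • c.1) (𝓝 0) (𝓝 y) := by
        have : Continuous fun δ : ℝ => y + δ • c.1 := by fun_prop
        simpa using this.tendsto 0
      exact (h1.inv₀ hs.ne').smul h2
    refine hP.mem_of_tendsto ht ?_
    filter_upwards [h, self_mem_nhdsWithin] with δ hδ hδ0
    have hpos : 0 < s + δ * c.2 := add_pos hs (mul_pos hδ0 hc.1)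
    rw [← Set.mem_smul_set_iff_inv_smul_mem₀ hpos.ne', ← hK _ _ hpos]
    exact hδ

lemma mem_smul_interior_iff_eventually (hK : ∀ y s, 0 < s → ((y, s) ∈ K ↔ y ∈ s • P))
    (hadd : ∀ x ∈ K, ∀ y ∈ K, x + y ∈ K) (hsmul : ∀ r : ℝ, 0 < r → ∀ x ∈ K, r • x ∈ K)
    {c : E × ℝ} (hc : c ∈ openCone P) {y : E} {s : ℝ} (hs : 0 < s) :
    y ∈ s • interior P ↔ ∀ᶠ δ in 𝓝[>] (0 : ℝ), (y, s) + δ • -c ∈ K := by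
  constructor
  · intro hy
    have hcont : Continuous fun δ : ℝ => (y, s) + δ • -c := by fun_prop
    have hnhds : openCone P ∈ 𝓝 ((y, s) + (0 : ℝ) • -c) := by
      rw [zero_smul, add_zero]
      exact (isOpen_openCone P).mem_nhds ((mem_openCone_iff hs).2 hy)
    filter_upwards [(hcont.tendsto 0).mono_left nhdsWithin_le_nhds hnhds] with δ hδ
    exact openCone_subset hK hδ
  · intro h
    obtain ⟨δ, hz, hδ⟩ := (h.and self_mem_nhdsWithin).exists
    have hδ : 0 < δ := hδ
    have hint : (y, s) ∈ interior K := by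
      refine mem_interior.2 ⟨(fun w => δ⁻¹ • (w - ((y, s) + δ • -c))) ⁻¹' openCone P,
        fun w hw => ?_, (isOpen_openCone P).preimage (by fun_prop), ?_⟩
      · have := hadd _ hz _ (hsmul δ hδ _ (openCone_subset hK hw))
        simpa [smul_inv_smul₀ hδ.ne'] using this
      · have : δ⁻¹ • ((y, s) - ((y, s) + δ • -c)) = c := by simp [inv_smul_smul₀ hδ.ne']
        rw [Set.mem_preimage, this]
        exact hc
    rw [← interior_smul₀ hs.ne']
    refine mem_interior.2 ⟨(fun y' => (y', s)) ⁻¹' interior K, fun y' hy' => ?_,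
      isOpen_interior.preimage (by fun_prop), hint⟩
    exact (hK y' s hs).1 (interior_subset hy')

end

lemma mem_DSet_iff {d : ℕ} {u : Fin d → ℝ} {A : Set (Fin d → ℝ)} {m : Fin d → ℤ} :
    m ∈ DSet d u A ↔ ∀ᶠ ε in 𝓝[>] (0 : ℝ), (fun i => (m i : ℝ)) + ε • u ∈ A := by
  rw [Filter.Eventually, mem_nhdsGT_iff_exists_Ioc_subset]
  simp only [DSet, Set.mem_ofPred_eq, Set.subset_def, Set.mem_Ioc, Set.mem_Ioi, and_imp, gt_iff_lt]

lemma ncard_biUnion_finset {β γ : Type*} (T : Finset β) (S : β → Set γ)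
    (hfin : ∀ B ∈ T, (S B).Finite) (hdisj : (T : Set β).PairwiseDisjoint S) :
    (⋃ B ∈ T, S B).ncard = ∑ B ∈ T, (S B).ncard := by
  rw [← finsum_mem_coe_finset]
  exact T.finite_toSet.ncard_biUnion hfin hdisj

end Homogenization

/-- **Reciprocity for the directional counting function.**  For a rational `d`-polytope
`P` with denominator `p` and a fixed vector `u ∈ ℝ^d`, the quasi-polynomial
`D_{P,u}` evaluated at `-t` equals `(-1)^d · D_{-P°,u}(t)`. -/
theorem directional_count_reciprocity
    (d : ℕ) (hd : 1 ≤ d)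
    (V : Finset (Fin d → ℝ)) (P : Set (Fin d → ℝ))
    (u : Fin d → ℝ)
    -- `P` is the convex hull of the finite set `V` of rational points
    (hP : P = convexHull ℝ (V : Set (Fin d → ℝ)))
    (hrat : ∀ v ∈ V, ∀ i, ∃ q : ℚ, v i = (q : ℝ))
    -- `V` is exactly the vertex set of `P`
    (hvert : (V : Set (Fin d → ℝ)) = Set.extremePoints ℝ P)
    -- `P` is full-dimensional
    (hint : (interior P).Nonempty)
    -- `p` is the denominator of `P`
    (p : ℕ) (hp : 0 < p)
    (hpV : ∀ v ∈ V, ∀ i, ∃ n : ℤ, (p : ℝ) * v i = (n : ℝ))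
    (hpmin : ∀ q : ℕ, 0 < q → (∀ v ∈ V, ∀ i, ∃ n : ℤ, (q : ℝ) * v i = (n : ℝ)) → p ≤ q) :
    ∃ q : Fin p → Polynomial ℚ,
      ∀ t : ℕ, 1 ≤ t →
        ((DSet d u ((t : ℝ) • P)).ncard : ℚ) = (q (resMod p hp (t : ℤ))).eval (t : ℚ) ∧
        (q (resMod p hp (-(t : ℤ)))).eval (-(t : ℚ))
          = (-1 : ℚ) ^ d * ((DSet d u (-((t : ℝ) • interior P))).ncard : ℚ) := by
  classical
  choose! n hn using hpV
  let α : V → (Fin d → ℤ) × ℤ := fun v => (n v, p)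
  have hα : ∀ v, (α v).2 = p := fun v => rfl
  let a : V → (Fin d → ℝ) × ℝ := fun v => latticeHom d (α v)
  have hpR : (0 : ℝ) < p := by exact_mod_cast hp
  have ha : a = fun v : V => ((p : ℝ) • (v : Fin d → ℝ), (p : ℝ)) := by
    funext v
    refine Prod.ext (funext fun i => ?_) (by simp [a, α, latticeHom_apply])
    simp [a, α, latticeHom_apply, hn v v.2 i]
  have hK : ∀ y s, 0 < s → ((y, s) ∈ coneOf a ↔ y ∈ s • P) := fun y s hs => by
    rw [ha, hP]
    exact mem_coneOf_homogenization V hpR hs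
  have hadd : ∀ x ∈ coneOf a, ∀ y ∈ coneOf a, x + y ∈ coneOf a := fun x hx y hy =>
    add_mem_coneOf hx hy
  have hsmul : ∀ r : ℝ, 0 < r → ∀ x ∈ coneOf a, r • x ∈ coneOf a := fun r hr x hx =>
    smul_mem_coneOf hr.le hx
  have hclosed : IsClosed P := by
    rw [hP]
    exact (V.finite_toSet.isCompact_convexHull ℝ).isClosed
  have hne : (openCone P).Nonempty := by
    obtain ⟨y, hy⟩ := hint
    exact ⟨(y, 1), one_pos, by simpa using hy⟩
  have hspan : ⊤ ≤ Submodule.span ℝ (Set.range a) := by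
    refine (Submodule.eq_top_of_nonempty_interior' _ (hne.mono ?_)).ge
    refine interior_maximal (fun x hx => ?_) (isOpen_openCone P)
    obtain ⟨l, -, rfl⟩ := openCone_subset hK hx
    exact Submodule.sum_mem _ fun v _ =>
      Submodule.smul_mem _ _ (Submodule.subset_span ⟨v, rfl⟩)
  obtain ⟨R, T, F, hTR, hframe, hex, huniq⟩ :=
    exists_triangulation a (LinearMap.snd ℝ _ _) (fun v => by simp [ha, hpR]) hspan
  obtain ⟨c, hcU, hc⟩ : ∃ c ∈ openCone P, ∀ B ∈ R, ∀ i ∈ B, F B i c ≠ 0 := by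
    obtain ⟨c, hcU, hc⟩ := exists_mem_forall_ne_zero
      (fun k : {k : Finset V × V // k.1 ∈ R ∧ k.2 ∈ k.1} => F k.1.1 k.1.2) (fun k hk => by
        have := (hframe k.1.1 k.2.1).apply_eq k.1.2 k.2.2 k.1.2 k.2.2
        simp [hk] at this) (isOpen_openCone P) hne
    exact ⟨c, hcU, fun B hB i hi => hc ⟨(B, i), hB, hi⟩⟩
  have hgerm := fun {c'} (hc' : ∀ B ∈ R, ∀ i ∈ B, F B i c' ≠ 0) =>
    eventually_mem_iff_exists_germPos hTR hex
      (fun B hB x hx => (hframe B (hTR hB)).mem_coneOf hx) hc'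
  let s : Finset V → V → Prop := fun B i => GermPos 0 (F B i (u, 0)) (F B i c)
  have hslice : ∀ B (t : ℤ) m, m ∈ coneSlice B (F B) (s B) t ↔
      ∀ i ∈ B, GermPos (F B i (latticeHom d (m, t))) (F B i (u, 0)) (F B i c) := fun B t m =>
    forall₂_congr fun i _ => germPos_iff_roundBy.symm
  have hslice' : ∀ B ∈ T, ∀ (t : ℤ) m, m ∈ coneSlice B (F B) (fun i => ¬ s B i) t ↔
      ∀ i ∈ B, GermPos (F B i (latticeHom d (m, t))) (F B i (-(u, 0))) (F B i (-c)) :=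
    fun B hB t m => forall₂_congr fun i hi => by
      rw [germPos_iff_roundBy, map_neg, map_neg, germPos_zero_neg (hc B (hTR hB) i hi)]
  have hD : ∀ t : ℕ, 1 ≤ t →
      DSet d u ((t : ℝ) • P) = ⋃ B ∈ T, coneSlice B (F B) (s B) t := fun t ht => by
    have htR : (0 : ℝ) < t := by exact_mod_cast ht
    ext m
    simp only [Set.mem_iUnion, exists_prop, hslice]
    rw [← hgerm hc, mem_DSet_iff, eventually_germFilter]
    refine eventually_congr (Eventually.of_forall fun ε => ?_)
    rw [mem_smul_iff_eventually hK hadd hsmul hclosed hcU htR]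
    simp [latticeHom_apply]
  have hD' : ∀ t : ℕ, 1 ≤ t → DSet d u (-((t : ℝ) • interior P))
      = Neg.neg '' ⋃ B ∈ T, coneSlice B (F B) (fun i => ¬ s B i) t := fun t ht => by
    have htR : (0 : ℝ) < t := by exact_mod_cast ht
    ext m
    rw [Set.image_neg_eq_neg, Set.mem_neg]
    simp only [Set.mem_iUnion, exists_prop]
    rw [exists_congr fun B => and_congr_right fun hB => hslice' B hB t (-m),
      ← hgerm fun B hB i hi => by simpa using hc B hB i hi, mem_DSet_iff, eventually_germFilter]
    refine eventually_congr (Eventually.of_forall fun ε => ?_)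
    rw [Set.mem_neg, mem_smul_interior_iff_eventually hK hadd hsmul hcU htR]
    have : ((-((fun i => (m i : ℝ)) + ε • u), (t : ℝ)) : (Fin d → ℝ) × ℝ)
        = latticeHom d (-m, (t : ℤ)) + ε • -(u, 0) := by
      refine Prod.ext (funext fun i => ?_) (by simp [latticeHom_apply])
      simp [latticeHom_apply]
      ring
    rw [this]
  have hfr : ∀ B ∈ T, IsDualFrame (fun v => latticeHom d (α v)) B (F B) := fun B hB =>
    hframe B (hTR hB)
  have hq : ∀ B : Finset V, ∃ q : Fin p → ℚ[X], B ∈ T → ∀ t : ℕ, 1 ≤ t →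
      ((coneSlice B (F B) (s B) t).ncard : ℚ) = (q (resMod p hp t)).eval (t : ℚ) ∧
      (q (resMod p hp (-(t : ℤ)))).eval (-(t : ℚ))
        = (-1) ^ d * ((coneSlice B (F B) (fun i => ¬ s B i) t).ncard : ℚ) := fun B => by
    by_cases hB : B ∈ T
    · obtain ⟨q, hq⟩ := exists_coneSlice_polynomial hp hα (hfr B hB) (s B)
      exact ⟨q, fun _ => hq⟩
    · exact ⟨0, fun h => absurd h hB⟩
  choose q hq using hq
  refine ⟨fun r => ∑ B ∈ T, q B r, fun t ht => ⟨?_, ?_⟩⟩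
  · rw [hD t ht, ncard_biUnion_finset, eval_finsetSum, Nat.cast_sum]
    · exact Finset.sum_congr rfl fun B hB => (hq B hB t ht).1
    · exact fun B hB => (ncard_coneSlice hp hα (hfr B hB) (s B) (by exact_mod_cast ht)).1
    · intro B hB B' hB' hne
      refine Set.disjoint_left.2 fun m hm hm' => hne ?_
      exact germPos_frame_unique huniq hB hB' ((hslice _ _ _).1 hm) ((hslice _ _ _).1 hm')
  · rw [hD' t ht, Set.ncard_image_of_injective _ neg_injective, ncard_biUnion_finset,
      eval_finsetSum, Nat.cast_sum, Finset.mul_sum]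
    · exact Finset.sum_congr rfl fun B hB => (hq B hB t ht).2
    · exact fun B hB => (ncard_coneSlice hp hα (hfr B hB) _ (by exact_mod_cast ht)).1
    · intro B hB B' hB' hne
      refine Set.disjoint_left.2 fun m hm hm' => hne ?_
      exact germPos_frame_unique huniq hB hB' ((hslice' B hB _ _).1 hm) ((hslice' B' hB' _ _).1 hm')

end
end

section
/- Let P ⊆ ℝ^d be a rational d-polytope with denominator p, and let v be a valuation on the lattice L generated by elementary cones, i.e., v : Set(ℝ^d) → ℝ satisfies v(∅) = 0 and v(A ∪ B) + v(A ∩ B) = v(A) + v(B) for all A, B ∈ L. For integers t ≥ 1 define V_P(t) = Σ_{m ∈ ℤ^d} v(K_{tP}(m)) (a finite sum, since K_{tP}(m) = ∅ for m outside the compact set tP). Then there exist polynomials q_0, …, q_{p−1} ∈ ℝ[T], each of degree at most d, such that V_P(t) = q_{t mod p}(t) for every integer t ≥ 1; that is, V_P is a quasi-polynomial of degree at most d whose period divides the denominator of P. In particular, if all vertices of P lie in ℤ^d then V_P agrees with a single polynomial on positive integers. -/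
open Set Polynomial Pointwise

noncomputable section

/-- An elementary cone in `ℝ^d`: a finite intersection of halfspaces of the form
`{x : a·x ≤ 0}` or `{x : a·x < 0}`.  (This family includes `ℝ^d` and `∅`.) -/
def ElemCone (d : ℕ) (C : Set (Fin d → ℝ)) : Prop :=
  ∃ (n : ℕ) (a : Fin n → Fin d → ℝ) (s : Fin n → Bool),
    C = ⋂ i, {x : Fin d → ℝ |
      if s i then (∑ k, a i k * x k) < 0 else (∑ k, a i k * x k) ≤ 0}

/-- The lattice of sets generated by elementary cones: all finite unions of
elementary cones. -/
def ConeLattice (d : ℕ) : Set (Set (Fin d → ℝ)) :=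
  {A | ∃ (n : ℕ) (C : Fin n → Set (Fin d → ℝ)), (∀ i, ElemCone d (C i)) ∧ A = ⋃ i, C i}

/-- The tangent cone of `A ⊆ ℝ^d` at the point `m`:
`K_A(m) = {x : m + ε·x ∈ A for all sufficiently small ε > 0}`. -/
def TangentCone (d : ℕ) (A : Set (Fin d → ℝ)) (m : Fin d → ℝ) : Set (Fin d → ℝ) :=
  {x | ∃ ε₀ > (0 : ℝ), ∀ ε : ℝ, 0 < ε → ε ≤ ε₀ → m + ε • x ∈ A}

lemma card_piAntidiag_eq_preHilbertPoly {ι : Type*} [Fintype ι] [DecidableEq ι] {k : ℕ}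
    (hk : Fintype.card ι = k + 1) (j : ℕ) :
    ((Finset.piAntidiag (Finset.univ : Finset ι) j).card : ℝ)
      = (preHilbertPoly ℝ k 0).eval (j : ℝ) := by
  have h : (Finset.piAntidiag (Finset.univ : Finset ι) j).card
      = (Finset.finsuppAntidiag (Finset.univ : Finset ι) j).card := by
    simp [Finset.finsuppAntidiag]
  rw [h, Finset.card_finsuppAntidiag_nat_eq_choose, preHilbertPoly_eq_choose_sub_add _ _ j.zero_le,
    Finset.card_univ, hk, Nat.sub_zero, show k + 1 + j - 1 = j + k by omega,
    Nat.choose_symm_add]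

lemma preHilbertPoly_eval_neg {k n : ℕ} (h : n < k) :
    (preHilbertPoly ℝ k 0).eval (-((n : ℝ) + 1)) = 0 := by
  have := ascPochhammer_eval_neg_coe_nat_of_lt (R := ℝ) h
  simp only [preHilbertPoly, eval_smul, eval_comp]
  simp [this]

lemma resMod_eq_resMod_iff {p : ℕ} (hp : 0 < p) (a b : ℤ) :
    resMod p hp a = resMod p hp b ↔ (p : ℤ) ∣ a - b := by
  have h0 : (p : ℤ) ≠ 0 := by exact_mod_cast hp.ne'
  have ha := Int.emod_nonneg a h0
  have hb := Int.emod_nonneg b h0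
  rw [dvd_sub_comm, ← Int.modEq_iff_dvd, Int.ModEq]
  simp only [resMod, Fin.mk.injEq]
  omega

/-- The number of `n : ι → ℕ` with `p * ∑ n + σ = t` is quasi-polynomial in `t ≥ 1`. -/
lemma exists_finset_sum_eq {ι : Type*} [Fintype ι] {k : ℕ} (hk : Fintype.card ι = k + 1)
    {p : ℕ} (hp : 0 < p) {σ : ℤ} (hσ : σ ≤ p * (k + 1)) {t : ℕ} (ht : 1 ≤ t) :
    ∃ N : Finset (ι → ℕ), (∀ n, n ∈ N ↔ (p : ℤ) * (∑ i, n i : ℕ) + σ = t) ∧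
      (N.card : ℝ) = if resMod p hp t = resMod p hp σ then
        ((preHilbertPoly ℝ k 0).comp (C ((p : ℝ)⁻¹) * (X - C (σ : ℝ)))).eval (t : ℝ) else 0 := by
  classical
  have hp' : (0 : ℤ) < p := by exact_mod_cast hp
  by_cases h : resMod p hp t = resMod p hp σ
  · rw [if_pos h]
    obtain ⟨j, hj⟩ := (resMod_eq_resMod_iff hp _ _).1 h
    have hjt : (p : ℝ)⁻¹ * ((t : ℝ) - σ) = j := by
      have : ((t : ℝ) - σ) = p * j := by exact_mod_cast hj
      rw [this]
      field_simp
    have hev : ((preHilbertPoly ℝ k 0).comp (C ((p : ℝ)⁻¹) * (X - C (σ : ℝ)))).eval (t : ℝ)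
        = (preHilbertPoly ℝ k 0).eval (j : ℝ) := by
      simp [eval_comp, hjt]
    rw [hev]
    rcases le_or_gt 0 j with h0 | h0
    · lift j to ℕ using h0
      refine ⟨Finset.piAntidiag Finset.univ j, fun n => ?_, ?_⟩
      · simp only [Finset.mem_piAntidiag, Finset.mem_univ, implies_true, and_true]
        rw [← eq_sub_iff_add_eq, hj, mul_right_inj' hp'.ne']
        norm_cast
      · exact card_piAntidiag_eq_preHilbertPoly hk j
    · refine ⟨∅, fun n => ?_, ?_⟩
      · simp only [Finset.notMem_empty, false_iff]
        rw [← eq_sub_iff_add_eq, hj, mul_right_inj' hp'.ne']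
        omega
      · have h1 : -((k : ℤ) + 1) < j := by
          by_contra! hc
          nlinarith
        obtain ⟨n, hn⟩ : ∃ n : ℕ, j = -((n : ℤ) + 1) := ⟨(-j - 1).toNat, by omega⟩
        have := preHilbertPoly_eval_neg (k := k) (n := n) (by omega)
        rw [hn]
        push_cast
        rw [this, Finset.card_empty, Nat.cast_zero]
  · rw [if_neg h]
    refine ⟨∅, fun n => ?_, by simp⟩
    simp only [Finset.notMem_empty, false_iff]
    intro hn
    exact h ((resMod_eq_resMod_iff hp _ _).2 ⟨_, by rw [← hn, add_sub_cancel_right]⟩)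

/-- The lattice points in the half-open parallelepiped `(0, p]^ι` are finite in number. -/
lemma finite_box_lattice {d : ℕ} {ι : Type*} [Fintype ι] (w : ι → Fin d → ℝ) (p : ℕ)
    (hinj : ∀ z : ι → ℝ, ∑ i, z i = 0 → (∀ k, ∑ i, z i * w i k = 0) → z = 0) :
    {r : ι → ℝ | (∀ i, 0 < r i ∧ r i ≤ p) ∧ (∃ s : ℤ, ∑ i, r i = s) ∧
      ∀ k, ∃ s : ℤ, ∑ i, r i * w i k = s}.Finite := by
  set M : Fin d → ℤ := fun k => ⌈∑ i, (p : ℝ) * |w i k|⌉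
  refine Set.Finite.of_injOn (t := Set.Icc (0 : ℤ) ((p : ℤ) * Fintype.card ι) ×ˢ Set.Icc (-M) M)
    (f := fun r => (⌊∑ i, r i⌋, fun k => ⌊∑ i, r i * w i k⌋)) ?_ ?_
    ((Set.finite_Icc _ _).prod (Set.finite_Icc _ _))
  · rintro r ⟨hr, ⟨s, hs⟩, hw⟩
    choose m hm using hw
    simp only [hs, hm, Int.floor_intCast, Set.mem_prod, Set.mem_Icc, Pi.le_def]
    have hb : ∀ k, |(m k : ℝ)| ≤ M k := fun k => by
      rw [← hm k]
      refine (Finset.abs_sum_le_sum_abs _ _).trans (le_trans ?_ (Int.le_ceil _))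
      refine Finset.sum_le_sum fun i _ => ?_
      rw [abs_mul, abs_of_pos (hr i).1]
      exact mul_le_mul_of_nonneg_right (hr i).2 (abs_nonneg _)
    refine ⟨⟨?_, ?_⟩, fun k => ?_, fun k => ?_⟩
    · have : (0 : ℝ) ≤ s := hs ▸ Finset.sum_nonneg fun i _ => (hr i).1.le
      exact_mod_cast this
    · have : (s : ℝ) ≤ p * Fintype.card ι := by
        rw [← hs]
        refine (Finset.sum_le_sum fun i _ => (hr i).2).trans ?_
        simp [mul_comm]
      exact_mod_cast this
    · exact_mod_cast (abs_le.1 (hb k)).1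
    · exact_mod_cast (abs_le.1 (hb k)).2
  · rintro r ⟨-, ⟨s, hs⟩, hw⟩ r' ⟨-, ⟨s', hs'⟩, hw'⟩ h
    choose m hm using hw
    choose m' hm' using hw'
    simp only [hs, hm, hs', hm', Int.floor_intCast, Prod.mk.injEq, funext_iff] at h
    have := hinj (r - r') (by simp [hs, hs', h.1]) (fun k => by simp [sub_mul, hm, hm', h.2 k])
    exact sub_eq_zero.1 this

/-- **Ehrhart's theorem for relatively open simplices**: the number of lattice points of the
`t`-th dilate is a quasi-polynomial in `t ≥ 1`. -/
lemma simplex_count_quasipolynomial {d : ℕ} {ι : Type*} [Fintype ι] (w : ι → Fin d → ℝ)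
    {p : ℕ} (hp : 0 < p) (hw : ∀ i k, ∃ n : ℤ, (p : ℝ) * w i k = n)
    (hinj : ∀ z : ι → ℝ, ∑ i, z i = 0 → (∀ k, ∑ i, z i * w i k = 0) → z = 0) :
    ∃ q : Fin p → ℝ[X], (∀ i, (q i).degree ≤ d) ∧ ∀ t : ℕ, 1 ≤ t →
      ∃ F : Finset (Fin d → ℤ),
        (∀ m, m ∈ F ↔ ∃ c : ι → ℝ, (∀ i, 0 < c i) ∧ ∑ i, c i = t ∧
          ∀ k, ∑ i, c i * w i k = m k) ∧
        (F.card : ℝ) = (q (resMod p hp t)).eval (t : ℝ) := by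
  classical
  have hpR : (0 : ℝ) < p := by exact_mod_cast hp
  rcases Nat.eq_zero_or_pos (Fintype.card ι) with h0 | h0
  · have := Fintype.card_eq_zero_iff.1 h0
    refine ⟨0, by simp, fun t ht => ⟨∅, fun m => ?_, by simp⟩⟩
    have : (t : ℝ) ≠ 0 := by positivity
    simp [this.symm]
  obtain ⟨k, hk⟩ : ∃ k, Fintype.card ι = k + 1 := ⟨_, (Nat.succ_pred_eq_of_pos h0).symm⟩
  have hkd : k ≤ d := by
    let L : (ι → ℝ) →ₗ[ℝ] ℝ × (Fin d → ℝ) :=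
      { toFun := fun z => (∑ i, z i, fun k => ∑ i, z i * w i k)
        map_add' := fun x y => by ext <;> simp [Finset.sum_add_distrib, add_mul]
        map_smul' := fun a x => by ext <;> simp [Finset.mul_sum, mul_assoc] }
    have hL : Function.Injective L := by
      rw [injective_iff_map_eq_zero]
      intro z hz
      simp only [L, LinearMap.coe_mk, AddHom.coe_mk, Prod.mk_eq_zero, funext_iff] at hz
      exact hinj z hz.1 hz.2
    have := LinearMap.finrank_le_finrank_of_injective hL
    simp [hk] at this
    omega
  set R := (finite_box_lattice w p hinj).toFinset with hR
  have memR : ∀ r, r ∈ R ↔ (∀ i, 0 < r i ∧ r i ≤ p) ∧ (∃ s : ℤ, ∑ i, r i = s) ∧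
      ∀ k, ∃ s : ℤ, ∑ i, r i * w i k = s := fun r => by simp [hR]
  have hfl : ∀ r ∈ R, ((⌊∑ i, r i⌋ : ℤ) : ℝ) = ∑ i, r i := fun r hr => by
    obtain ⟨s, hs⟩ := ((memR r).1 hr).2.1
    rw [hs, Int.floor_intCast]
  have hσ : ∀ r : R, ⌊∑ i, r.1 i⌋ ≤ (p : ℤ) * (k + 1) := fun r => by
    have : ((⌊∑ i, r.1 i⌋ : ℤ) : ℝ) ≤ p * (k + 1) := by
      rw [hfl _ r.2]
      refine (Finset.sum_le_sum fun i _ => (((memR r.1).1 r.2).1 i).2).trans ?_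
      simp [hk, mul_comm]
    exact_mod_cast this
  let Q : R → ℝ[X] := fun r =>
    (preHilbertPoly ℝ k 0).comp (C ((p : ℝ)⁻¹) * (X - C ((⌊∑ i, r.1 i⌋ : ℤ) : ℝ)))
  refine ⟨fun j => ∑ r, if j = resMod p hp ⌊∑ i, r.1 i⌋ then Q r else 0, fun j => ?_, ?_⟩
  · refine (degree_sum_le _ _).trans (Finset.sup_le fun r _ => ?_)
    split_ifs
    · rw [← natDegree_le_iff_degree_le]
      refine natDegree_comp_le.trans ?_
      rw [natDegree_preHilbertPoly]
      have : (C ((p : ℝ)⁻¹) * (X - C ((⌊∑ i, r.1 i⌋ : ℤ) : ℝ))).natDegree ≤ 1 :=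
        (natDegree_C_mul_le _ _).trans (natDegree_X_sub_C _).le
      nlinarith
    · simp
  intro t ht
  choose N hN hcard using fun r : R => exists_finset_sum_eq hk hp (hσ r) ht
  let c : (Σ _ : R, ι → ℕ) → ι → ℝ := fun x i => x.1.1 i + p * x.2 i
  have hcw : ∀ x k, ∃ s : ℤ, ∑ i, c x i * w i k = s := fun x k => by
    obtain ⟨s, hs⟩ := ((memR x.1.1).1 x.1.2).2.2 k
    choose W hW using fun i => hw i k
    refine ⟨s + ∑ i, x.2 i * W i, ?_⟩
    push_cast
    rw [← hs, ← Finset.sum_add_distrib]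
    refine Finset.sum_congr rfl fun i _ => ?_
    rw [← hW]
    ring
  have hcs : ∀ x ∈ Finset.univ.sigma N, ∑ i, c x i = t := fun x hx => by
    have h1 := (hN _ _).1 (Finset.mem_sigma.1 hx).2
    have h2 : (p : ℝ) * (∑ i, x.2 i : ℕ) + (⌊∑ i, x.1.1 i⌋ : ℤ) = t := by exact_mod_cast h1
    rw [← h2, hfl _ x.1.2]
    simp [c, Finset.sum_add_distrib, Finset.mul_sum, add_comm]
  let f : (Σ _ : R, ι → ℕ) → Fin d → ℤ := fun x k => ⌊∑ i, c x i * w i k⌋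
  have hf : ∀ x k, ∑ i, c x i * w i k = (f x k : ℤ) := fun x k => by
    obtain ⟨s, hs⟩ := hcw x k
    simp only [f, hs, Int.floor_intCast]
  refine ⟨(Finset.univ.sigma N).image f, fun m => ?_, ?_⟩
  · rw [Finset.mem_image]
    constructor
    · rintro ⟨x, hx, rfl⟩
      refine ⟨c x, fun i => ?_, hcs x hx, hf x⟩
      have := (((memR x.1.1).1 x.1.2).1 i).1
      simp only [c]
      positivity
    · rintro ⟨b, hb, hbt, hbm⟩
      let n : ι → ℕ := fun i => ⌈b i / p⌉₊ - 1
      have hn : ∀ i, (n i : ℝ) = ⌈b i / p⌉₊ - 1 := fun i => by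
        have : 1 ≤ ⌈b i / p⌉₊ := Nat.one_le_ceil_iff.2 (div_pos (hb i) hpR)
        simp [n, Nat.cast_sub this]
      have hr1 : ∀ i, 0 < b i - p * n i := fun i => by
        have := Nat.ceil_lt_add_one (div_pos (hb i) hpR).le
        have h2 : (n i : ℝ) < b i / p := by rw [hn]; linarith
        rw [lt_div_iff₀ hpR] at h2
        linarith
      have hr2 : ∀ i, b i - p * n i ≤ p := fun i => by
        have h2 := Nat.le_ceil (b i / p)
        rw [div_le_iff₀ hpR] at h2
        rw [hn]
        linarith
      have hsum : ∑ i, (b i - p * n i) = ((t - p * ∑ i, n i : ℤ) : ℝ) := by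
        push_cast
        rw [Finset.sum_sub_distrib, hbt, Finset.mul_sum]
      have hr : (fun i => b i - p * n i) ∈ R := by
        refine (memR _).2 ⟨fun i => ⟨hr1 i, hr2 i⟩, ⟨_, hsum⟩, fun k => ?_⟩
        choose W hW using fun i => hw i k
        refine ⟨m k - ∑ i, n i * W i, ?_⟩
        push_cast
        rw [← hbm, ← Finset.sum_sub_distrib]
        refine Finset.sum_congr rfl fun i _ => ?_
        rw [← hW]
        ring
      have hcx : c ⟨⟨_, hr⟩, n⟩ = b := by
        ext i
        simp [c]
      refine ⟨⟨⟨_, hr⟩, n⟩, Finset.mem_sigma.2 ⟨Finset.mem_univ _, (hN _ _).2 ?_⟩, ?_⟩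
      · simp only [hsum, Int.floor_intCast]
        push_cast
        ring
      · ext k
        have := hf ⟨⟨_, hr⟩, n⟩ k
        rw [hcx, hbm] at this
        exact_mod_cast this.symm
  · rw [Finset.card_image_of_injOn, Finset.card_sigma]
    · push_cast
      rw [eval_finsetSum]
      refine Finset.sum_congr rfl fun r _ => ?_
      rw [hcard r]
      split_ifs
      · rfl
      · simp
    · rintro ⟨r, n⟩ hx ⟨r', n'⟩ hy hxy
      have hc : c ⟨r, n⟩ = c ⟨r', n'⟩ := by
        refine sub_eq_zero.1 (hinj _ ?_ fun k => ?_)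
        · simp [hcs _ hx, hcs _ hy]
        · simp [sub_mul, hf, hxy]
      have hnn : n = n' := by
        ext i
        have h1 := ((memR r.1).1 r.2).1 i
        have h2 := ((memR r'.1).1 r'.2).1 i
        have h3 : r.1 i + p * n i = r'.1 i + p * n' i := congrFun hc i
        have h4 : (p : ℝ) * n i < p * (n' i + 1) := by linarith
        have h5 : (p : ℝ) * n' i < p * (n i + 1) := by linarith
        rw [mul_lt_mul_iff_right₀ hpR] at h4 h5
        norm_cast at h4 h5
        omega
      subst hnn
      have hrr : r = r' := by
        ext i
        have h3 : r.1 i + p * n i = r'.1 i + p * n i := congrFun hc i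
        linarith
      rw [hrr]

lemma exists_toLex_min {X : Type*} [TopologicalSpace X] {n : ℕ} (f : Fin n → X → ℝ)
    (hf : ∀ i, Continuous (f i)) {S : Set X} (hS : IsCompact S) (hne : S.Nonempty) :
    ∃ x ∈ S, ∀ y ∈ S, toLex (fun i => f i x) ≤ toLex (fun i => f i y) := by
  induction n generalizing S with
  | zero =>
    obtain ⟨x, hx⟩ := hne
    exact ⟨x, hx, fun y _ => le_of_eq (congrArg toLex (Subsingleton.elim _ _))⟩
  | succ n ih =>
    obtain ⟨x₀, hx₀, hmin⟩ := hS.exists_isMinOn hne (hf 0).continuousOn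
    obtain ⟨x, ⟨hx, hxe⟩, hxm⟩ := ih (fun i => f i.succ) (fun i => hf _)
      (hS.inter_right (isClosed_eq (hf 0) (continuous_const (y := f 0 x₀)))) ⟨x₀, hx₀, rfl⟩
    refine ⟨x, hx, fun y hy => ?_⟩
    have hxe : f 0 x = f 0 x₀ := hxe
    rcases (isMinOn_iff.1 hmin y hy).lt_or_eq with h | h
    · exact le_of_lt ⟨0, fun j hj => absurd hj (Fin.not_lt_zero j), by
        simpa only [Pi.toLex_apply, hxe] using h⟩
    · rcases (hxm y ⟨hy, h.symm⟩).lt_or_eq with ⟨i, hi, hlt⟩ | heq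
      · refine le_of_lt ⟨i.succ, fun j hj => ?_, hlt⟩
        cases j using Fin.cases with
        | zero => exact hxe.trans h
        | succ j => exact hi j (Fin.succ_lt_succ_iff.1 hj)
      · refine le_of_eq (congrArg toLex (funext fun j => ?_))
        cases j using Fin.cases with
        | zero => exact hxe.trans h
        | succ j => exact congrFun (toLex.injective heq) j

/-- `B` is the support of the lexicographically least representations: no relation among the
points `w i` which is nonnegative off `B` is lexicographically negative. -/
def LexMinSupport {d n : ℕ} (w : Fin n → Fin d → ℝ) (B : Finset (Fin n)) : Prop :=
  ∀ z : Fin n → ℝ, ∑ i, z i = 0 → (∀ k, ∑ i, z i * w i k = 0) → (∀ i ∉ B, 0 ≤ z i) →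
    0 ≤ toLex z

/-- The `t`-th dilate of the set of convex combinations of the points `w i` with support `B`. -/
def openCell {d n : ℕ} (w : Fin n → Fin d → ℝ) (B : Finset (Fin n)) (t : ℝ) :
    Set (Fin d → ℝ) :=
  {x | ∃ c : Fin n → ℝ, (∀ i ∈ B, 0 < c i) ∧ (∀ i ∉ B, c i = 0) ∧ ∑ i, c i = t ∧
    ∀ k, ∑ i, c i * w i k = x k}

/-- The common tangent cone of the convex hull of the points `w i` along `openCell w B 1`. -/
def cellCone {d n : ℕ} (w : Fin n → Fin d → ℝ) (B : Finset (Fin n)) : Set (Fin d → ℝ) :=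
  {y | ∃ a : Fin n → ℝ, ∑ i, a i = 0 ∧ (∀ i ∉ B, 0 ≤ a i) ∧ ∀ k, ∑ i, a i * w i k = y k}

lemma mem_smul_convexHull_range_iff {d n : ℕ} (w : Fin n → Fin d → ℝ) {t : ℝ} (ht : 0 < t)
    (x : Fin d → ℝ) :
    x ∈ t • convexHull ℝ (range w) ↔
      ∃ c : Fin n → ℝ, (∀ i, 0 ≤ c i) ∧ ∑ i, c i = t ∧ ∀ k, ∑ i, c i * w i k = x k := by
  rw [Set.mem_smul_set]
  constructor
  · rintro ⟨y, hy, rfl⟩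
    rw [convexHull_range_eq_exists_affineCombination] at hy
    obtain ⟨s, c, hc, hc1, rfl⟩ := hy
    rw [s.affineCombination_eq_linear_combination _ _ hc1]
    classical
    refine ⟨fun i => if i ∈ s then t * c i else 0, fun i => ?_, ?_, fun k => ?_⟩
    · dsimp only
      split_ifs with h
      · exact mul_nonneg ht.le (hc i h)
      · rfl
    · simp [← Finset.mul_sum, hc1]
    · simp [Finset.mul_sum, mul_assoc, ite_mul]
  · rintro ⟨c, hc, hct, hcx⟩
    refine ⟨∑ i, (c i / t) • w i, ?_, ?_⟩
    · refine (convex_convexHull ℝ _).sum_mem (fun i _ => div_nonneg (hc i) ht.le) ?_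
        fun i _ => subset_convexHull ℝ _ (mem_range_self i)
      rw [← Finset.sum_div, hct, div_self ht.ne']
    · ext k
      rw [← hcx k]
      simp only [Pi.smul_apply, Finset.sum_apply, smul_eq_mul, Finset.mul_sum]
      refine Finset.sum_congr rfl fun i _ => ?_
      field_simp

lemma exists_forall_nonneg_add_mul {n : ℕ} (c a : Fin n → ℝ) (hc : ∀ i, 0 ≤ c i)
    (ha : ∀ i, c i = 0 → 0 ≤ a i) :
    ∃ ε₀ > (0 : ℝ), ∀ ε : ℝ, 0 < ε → ε ≤ ε₀ → ∀ i, 0 ≤ c i + ε * a i := by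
  have h : ∀ᶠ ε in nhdsWithin (0 : ℝ) (Ioi 0), ∀ i, 0 ≤ c i + ε * a i := by
    refine Filter.eventually_all.2 fun i => ?_
    rcases (hc i).eq_or_lt with h0 | h0
    · filter_upwards [self_mem_nhdsWithin] with ε hε
      exact add_nonneg (hc i) (mul_nonneg (le_of_lt hε) (ha i h0.symm))
    · have : Filter.Tendsto (fun ε : ℝ => c i + ε * a i) (nhdsWithin 0 (Ioi 0))
          (nhds (c i + 0 * a i)) :=
        (Continuous.tendsto (by fun_prop) 0).mono_left nhdsWithin_le_nhds
      filter_upwards [this.eventually_const_lt (u := 0) (by simpa using h0)] with ε hε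
      exact hε.le
  obtain ⟨ε₀, h0, hsub⟩ := mem_nhdsGT_iff_exists_Ioc_subset.1 h
  exact ⟨ε₀, h0, fun ε h1 h2 => hsub ⟨h1, h2⟩⟩

lemma tangentCone_eq_cellCone {d n : ℕ} (w : Fin n → Fin d → ℝ) {B : Finset (Fin n)} {t : ℝ}
    (ht : 0 < t) {x : Fin d → ℝ} (hx : x ∈ openCell w B t) :
    TangentCone d (t • convexHull ℝ (range w)) x = cellCone w B := by
  obtain ⟨c, hcB, hcB', hct, hcx⟩ := hx
  ext y
  constructor
  · rintro ⟨ε, hε, h⟩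
    obtain ⟨c', hc', hct', hcx'⟩ := (mem_smul_convexHull_range_iff w ht _).1 (h ε hε le_rfl)
    refine ⟨fun i => (c' i - c i) / ε, ?_, fun i hi => ?_, fun k => ?_⟩
    · rw [← Finset.sum_div, Finset.sum_sub_distrib, hct, hct', sub_self, zero_div]
    · simp only [hcB' i hi, sub_zero]
      exact div_nonneg (hc' i) hε.le
    · simp only [div_mul_eq_mul_div, ← Finset.sum_div, sub_mul, Finset.sum_sub_distrib, hcx, hcx',
        Pi.add_apply, Pi.smul_apply, smul_eq_mul]
      field_simp
      ring
  · rintro ⟨a, ha0, haB, hay⟩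
    have hc0 : ∀ i, 0 ≤ c i := fun i => by
      by_cases hi : i ∈ B
      · exact (hcB i hi).le
      · exact (hcB' i hi).ge
    obtain ⟨ε₀, hε₀, h⟩ := exists_forall_nonneg_add_mul c a hc0
      fun i hi => haB i fun hB => (hcB i hB).ne' hi
    refine ⟨ε₀, hε₀, fun ε h1 h2 => (mem_smul_convexHull_range_iff w ht _).2
      ⟨_, h ε h1 h2, ?_, fun k => ?_⟩⟩
    · rw [Finset.sum_add_distrib, ← Finset.mul_sum, hct, ha0, mul_zero, add_zero]
    · simp only [add_mul, Finset.sum_add_distrib, mul_assoc, ← Finset.mul_sum, hcx, hay,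
        Pi.add_apply, Pi.smul_apply, smul_eq_mul]

lemma exists_lexMinSupport {d n : ℕ} (w : Fin n → Fin d → ℝ) {t : ℝ} (ht : 0 < t)
    {x : Fin d → ℝ} (hx : x ∈ t • convexHull ℝ (range w)) :
    ∃ B, LexMinSupport w B ∧ x ∈ openCell w B t := by
  set S : Set (Fin n → ℝ) :=
    {c | (∀ i, 0 ≤ c i) ∧ ∑ i, c i = t ∧ ∀ k, ∑ i, c i * w i k = x k} with hS
  have hcl : IsClosed S := by
    simp only [hS, Set.ofPred_and, Set.ofPred_forall]
    refine (isClosed_iInter fun i => isClosed_le (by fun_prop) (by fun_prop)).inter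
      ((isClosed_eq (by fun_prop) (by fun_prop)).inter
        (isClosed_iInter fun k => isClosed_eq (by fun_prop) (by fun_prop)))
  have hcpt : IsCompact S := by
    refine (isCompact_Icc (a := (0 : Fin n → ℝ)) (b := fun _ => t)).of_isClosed_subset hcl ?_
    rintro c ⟨h0, h1, -⟩
    exact ⟨h0, fun i => h1 ▸ Finset.single_le_sum (fun j _ => h0 j) (Finset.mem_univ i)⟩
  obtain ⟨c, ⟨hc0, hct, hcx⟩, hmin⟩ := exists_toLex_min (fun i (c : Fin n → ℝ) => c i)
    (fun i => continuous_apply i) hcpt ((mem_smul_convexHull_range_iff w ht x).1 hx)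
  classical
  refine ⟨Finset.univ.filter fun i => 0 < c i, fun z hz hzw hzB => ?_,
    c, by simp, fun i hi => ?_, hct, hcx⟩
  · by_contra hlt
    obtain ⟨i, hi, hlt⟩ := not_le.1 hlt
    obtain ⟨ε, hε, h⟩ := exists_forall_nonneg_add_mul c z hc0 fun i hi => hzB i (by simp [hi])
    refine not_lt.2 (hmin (fun i => c i + ε * z i) ⟨h ε hε le_rfl, ?_, fun k => ?_⟩)
      ⟨i, fun j hj => ?_, ?_⟩
    · rw [Finset.sum_add_distrib, ← Finset.mul_sum, hct, hz, mul_zero, add_zero]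
    · simp only [add_mul, Finset.sum_add_distrib, mul_assoc, ← Finset.mul_sum, hcx, hzw, mul_zero,
        add_zero]
    · have : z j = 0 := hi j hj
      simp [this]
    · have : z i < 0 := hlt
      have := mul_neg_of_pos_of_neg hε this
      simp only [Pi.toLex_apply]
      linarith
  · simp only [Finset.mem_filter, Finset.mem_univ, true_and, not_lt] at hi
    exact le_antisymm hi (hc0 i)

lemma LexMinSupport.eq_of_mem {d n : ℕ} {w : Fin n → Fin d → ℝ} {B B' : Finset (Fin n)}
    (hB : LexMinSupport w B) (hB' : LexMinSupport w B') {t : ℝ} {x : Fin d → ℝ}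
    (hx : x ∈ openCell w B t) (hx' : x ∈ openCell w B' t) : B = B' := by
  obtain ⟨c, hc, hc0, hct, hcx⟩ := hx
  obtain ⟨c', hc', hc0', hct', hcx'⟩ := hx'
  have hnn : ∀ {c : Fin n → ℝ} {B : Finset (Fin n)}, (∀ i ∈ B, 0 < c i) → (∀ i ∉ B, c i = 0) →
      ∀ i, 0 ≤ c i := fun {c B} h h0 i => by
    by_cases hi : i ∈ B
    · exact (h i hi).le
    · exact (h0 i hi).ge
  have h1 := hB (c' - c) (by simp [hct, hct']) (fun k => by simp [sub_mul, hcx, hcx'])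
    fun i hi => by simpa [hc0 i hi] using hnn hc' hc0' i
  have h2 := hB' (c - c') (by simp [hct, hct']) (fun k => by simp [sub_mul, hcx, hcx'])
    fun i hi => by simpa [hc0' i hi] using hnn hc hc0 i
  rw [toLex_sub, sub_nonneg] at h1 h2
  have hcc : c = c' := toLex.injective (le_antisymm h1 h2)
  subst hcc
  ext i
  refine ⟨fun hi => ?_, fun hi => ?_⟩ <;> by_contra hni
  · exact (hc i hi).ne' (hc0' i hni)
  · exact (hc' i hi).ne' (hc0 i hni)

lemma LexMinSupport.eq_zero {d n : ℕ} {w : Fin n → Fin d → ℝ} {B : Finset (Fin n)}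
    (hB : LexMinSupport w B) {z : Fin n → ℝ} (hz : ∑ i, z i = 0)
    (hzw : ∀ k, ∑ i, z i * w i k = 0) (hzB : ∀ i ∉ B, z i = 0) : z = 0 := by
  have h1 := hB z hz hzw fun i hi => (hzB i hi).ge
  have h2 := hB (-z) (by simp [hz]) (fun k => by simp [hzw]) fun i hi => by simp [hzB i hi]
  rw [toLex_neg, Left.nonneg_neg_iff] at h2
  exact toLex.injective (le_antisymm h2 h1)

lemma openCell_count_quasipolynomial {d n : ℕ} {w : Fin n → Fin d → ℝ} {B : Finset (Fin n)}
    (hB : LexMinSupport w B) {p : ℕ} (hp : 0 < p) (hw : ∀ i k, ∃ n : ℤ, (p : ℝ) * w i k = n) :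
    ∃ q : Fin p → ℝ[X], (∀ i, (q i).degree ≤ d) ∧ ∀ t : ℕ, 1 ≤ t →
      ∃ F : Finset (Fin d → ℤ), (∀ m, m ∈ F ↔ (fun k => (m k : ℝ)) ∈ openCell w B t) ∧
        (F.card : ℝ) = (q (resMod p hp t)).eval (t : ℝ) := by
  classical
  let ext0 : (B → ℝ) → Fin n → ℝ := fun c i => if h : i ∈ B then c ⟨i, h⟩ else 0
  have hext : ∀ (c : B → ℝ) (g : Fin n → ℝ), ∑ i, ext0 c i * g i = ∑ i : B, c i * g i := by
    intro c g
    rw [← Finset.sum_subset B.subset_univ (fun i _ hi => by simp [ext0, hi]),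
      ← Finset.sum_coe_sort]
    exact Finset.sum_congr rfl fun i _ => by simp [ext0]
  have hext1 : ∀ c : B → ℝ, ∑ i, ext0 c i = ∑ i : B, c i := fun c => by
    simpa using hext c fun _ => 1
  obtain ⟨q, hq, h⟩ := simplex_count_quasipolynomial (fun i : B => w i) hp (fun i => hw i)
    fun z hz hzw => by
      have := hB.eq_zero (z := ext0 z) (by rw [hext1, hz]) (fun k => by rw [hext, hzw])
        fun i hi => by simp [ext0, hi]
      ext i
      simpa [ext0] using congrFun this i
  refine ⟨q, hq, fun t ht => ?_⟩
  obtain ⟨F, hF, hcard⟩ := h t ht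
  refine ⟨F, fun m => (hF m).trans ⟨?_, ?_⟩, hcard⟩
  · rintro ⟨c, hc, hct, hcm⟩
    refine ⟨ext0 c, fun i hi => ?_, fun i hi => ?_, ?_, fun k => ?_⟩
    · simpa [ext0, hi] using hc ⟨i, hi⟩
    · simp [ext0, hi]
    · rw [hext1, hct]
    · rw [hext, hcm]
  · rintro ⟨c, hc, hc0, hct, hcm⟩
    have hr : ext0 (fun i => c i) = c := by
      ext i
      by_cases hi : i ∈ B <;> simp [ext0, hi, hc0]
    refine ⟨fun i => c i, fun i => hc i i.2, ?_, fun k => ?_⟩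
    · rw [← hext1, hr, hct]
    · rw [← hext _ fun i => w i k, hr, hcm]

lemma tangentCone_eq_empty {d : ℕ} {A : Set (Fin d → ℝ)} (hA : IsClosed A) {m : Fin d → ℝ}
    (hm : m ∉ A) : TangentCone d A m = ∅ := by
  refine Set.eq_empty_of_forall_notMem fun x hx => hm ?_
  obtain ⟨ε₀, hε₀, h⟩ := hx
  have ht : Filter.Tendsto (fun ε : ℝ => m + ε • x) (nhdsWithin 0 (Ioi 0)) (nhds m) := by
    have : Filter.Tendsto (fun ε : ℝ => m + ε • x) (nhds 0) (nhds (m + (0 : ℝ) • x)) :=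
      Continuous.tendsto (by fun_prop) 0
    rw [zero_smul, add_zero] at this
    exact this.mono_left nhdsWithin_le_nhds
  refine hA.mem_of_tendsto ht ?_
  filter_upwards [Ioc_mem_nhdsGT hε₀] with ε hε
  exact h ε hε.1 hε.2

/-- A function of the tangent cones of the dilates of a rational polytope, vanishing on the empty
set, sums over the lattice to a quasi-polynomial. -/
lemma tangentCone_sum_quasipolynomial {d n : ℕ} (w : Fin n → Fin d → ℝ) {p : ℕ} (hp : 0 < p)
    (hw : ∀ i k, ∃ n : ℤ, (p : ℝ) * w i k = n) (v : Set (Fin d → ℝ) → ℝ) (hv0 : v ∅ = 0) :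
    ∃ q : Fin p → ℝ[X], (∀ i, (q i).degree ≤ d) ∧ ∀ t : ℕ, 1 ≤ t →
      ∑' m : Fin d → ℤ, v (TangentCone d ((t : ℝ) • convexHull ℝ (range w)) fun i => (m i : ℝ))
        = (q (resMod p hp t)).eval (t : ℝ) := by
  classical
  choose q hq h using fun B : {B // LexMinSupport w B} => openCell_count_quasipolynomial B.2 hp hw
  refine ⟨fun i => ∑ B, C (v (cellCone w B.1)) * q B i, fun i => ?_, fun t ht => ?_⟩
  · refine (degree_sum_le _ _).trans (Finset.sup_le fun B _ => ?_)
    rw [← smul_eq_C_mul]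
    exact (degree_smul_le _ _).trans (hq B i)
  have ht0 : (0 : ℝ) < t := by exact_mod_cast ht
  choose F hF hcard using fun B => h B t ht
  have hcl : IsClosed ((t : ℝ) • convexHull ℝ (range w)) :=
    (((Set.finite_range w).isCompact_convexHull ℝ).smul (t : ℝ)).isClosed
  have key : ∀ m : Fin d → ℤ,
      v (TangentCone d ((t : ℝ) • convexHull ℝ (range w)) fun i => (m i : ℝ))
        = ∑ B, if m ∈ F B then v (cellCone w B.1) else 0 := by
    intro m
    by_cases hm : (fun i => (m i : ℝ)) ∈ (t : ℝ) • convexHull ℝ (range w)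
    · obtain ⟨B, hB, hmB⟩ := exists_lexMinSupport w ht0 hm
      rw [tangentCone_eq_cellCone w ht0 hmB, Finset.sum_eq_single ⟨B, hB⟩]
      · rw [if_pos ((hF ⟨B, hB⟩ m).2 hmB)]
      · intro B' _ hne
        refine if_neg fun hm' => hne (Subtype.ext ?_)
        exact B'.2.eq_of_mem hB ((hF B' m).1 hm') hmB
      · simp
    · rw [tangentCone_eq_empty hcl hm, hv0]
      refine (Finset.sum_eq_zero fun B _ => if_neg fun hmB => hm ?_).symm
      obtain ⟨c, hc, hc0, hct, hcm⟩ := (hF B m).1 hmB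
      refine (mem_smul_convexHull_range_iff w ht0 _).2 ⟨c, fun i => ?_, hct, hcm⟩
      by_cases hi : i ∈ B.1
      · exact (hc i hi).le
      · exact (hc0 i hi).ge
  simp_rw [key]
  rw [tsum_eq_sum (s := Finset.univ.biUnion F), Finset.sum_comm, eval_finsetSum]
  · refine Finset.sum_congr rfl fun B _ => ?_
    rw [← Finset.sum_filter, Finset.sum_const, eval_mul, eval_C, ← hcard, nsmul_eq_mul, mul_comm,
      Finset.filter_mem_eq_inter,
      Finset.inter_eq_right.2 (Finset.subset_biUnion_of_mem F (Finset.mem_univ B))]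
  · intro m hm
    refine Finset.sum_eq_zero fun B _ => if_neg fun hmB => hm ?_
    exact Finset.mem_biUnion.2 ⟨B, Finset.mem_univ B, hmB⟩

/-- **Quasi-polynomiality of the valuation counting function.**  For a rational
`d`-polytope `P` with denominator `p` and a valuation `v` on the lattice generated by
elementary cones, the function `V_P(t) = Σ_{m ∈ ℤ^d} v(K_{tP}(m))` is a
quasi-polynomial of degree at most `d` whose period divides `p`; in particular, if all
vertices of `P` are integral then `V_P` agrees with a single polynomial on positive
integers. -/
theorem valuation_count_quasipolynomial
    (d : ℕ) (hd : 1 ≤ d)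
    (V : Finset (Fin d → ℝ)) (P : Set (Fin d → ℝ))
    -- `P` is the convex hull of the finite set `V` of rational points
    (hP : P = convexHull ℝ (V : Set (Fin d → ℝ)))
    (hrat : ∀ v ∈ V, ∀ i, ∃ q : ℚ, v i = (q : ℝ))
    -- `V` is exactly the vertex set of `P`
    (hvert : (V : Set (Fin d → ℝ)) = Set.extremePoints ℝ P)
    -- `P` is full-dimensional
    (hint : (interior P).Nonempty)
    -- `p` is the denominator of `P`
    (p : ℕ) (hp : 0 < p)
    (hpV : ∀ v ∈ V, ∀ i, ∃ n : ℤ, (p : ℝ) * v i = (n : ℝ))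
    (hpmin : ∀ q : ℕ, 0 < q → (∀ v ∈ V, ∀ i, ∃ n : ℤ, (q : ℝ) * v i = (n : ℝ)) → p ≤ q)
    -- `v` is a valuation on the lattice generated by elementary cones
    (v : Set (Fin d → ℝ) → ℝ)
    (hv0 : v ∅ = 0)
    (hval : ∀ A ∈ ConeLattice d, ∀ B ∈ ConeLattice d,
      v (A ∪ B) + v (A ∩ B) = v A + v B) :
    (∃ q : Fin p → Polynomial ℝ,
      (∀ i, (q i).degree ≤ (d : ℕ)) ∧
      ∀ t : ℕ, 1 ≤ t →
        (∑' m : Fin d → ℤ, v (TangentCone d ((t : ℝ) • P) (fun i => (m i : ℝ))))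
          = (q (resMod p hp (t : ℤ))).eval (t : ℝ)) ∧
    ((∀ v ∈ V, ∀ i, ∃ n : ℤ, v i = (n : ℝ)) →
      ∃ q : Polynomial ℝ,
        ∀ t : ℕ, 1 ≤ t →
          (∑' m : Fin d → ℤ, v (TangentCone d ((t : ℝ) • P) (fun i => (m i : ℝ))))
            = q.eval (t : ℝ)) := by
  have hrange : (V : Set (Fin d → ℝ)) = range fun i => (V.equivFin.symm i : Fin d → ℝ) := by
    ext x
    refine ⟨fun hx => ⟨V.equivFin ⟨x, hx⟩, by simp⟩, ?_⟩
    rintro ⟨i, rfl⟩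
    exact (V.equivFin.symm i).2
  obtain ⟨q, hq, h⟩ := tangentCone_sum_quasipolynomial
    (fun i => (V.equivFin.symm i : Fin d → ℝ)) hp
    (fun i => hpV _ (V.equivFin.symm i).2) v hv0
  rw [← hrange, ← hP] at h
  refine ⟨⟨q, hq, h⟩, fun hV => ?_⟩
  obtain rfl : p = 1 := le_antisymm (hpmin 1 one_pos (by simpa using hV)) hp
  refine ⟨q 0, fun t ht => ?_⟩
  rw [h t ht, Subsingleton.elim (resMod 1 hp t) 0]

end
end

section
/- (Valuation reciprocity) Let P ⊆ ℝ^d be a rational d-polytope with denominator p, and let v be a valuation on the lattice L generated by elementary cones. For integers t ≥ 1 define V_P(t) = Σ_{m ∈ ℤ^d} v(K_{tP}(m)) and V_{−P°}(t) = Σ_{m ∈ ℤ^d} v(K_{−tP°}(m)), where P° is the interior of P and −A = {−x : x ∈ A}. Then there exist polynomials q_0, …, q_{p−1} ∈ ℝ[T] such that for every integer t ≥ 1 one has V_P(t) = q_{t mod p}(t) and q_{(−t) mod p}(−t) = (−1)^d · V_{−P°}(t); i.e., the quasi-polynomial V_P evaluated at negative integers −t gives (−1)^d V_{−P°}(t).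 -/
open Set Polynomial Pointwise

noncomputable section

open Finset in
theorem card_piAntidiag_nat {ι : Type*} [DecidableEq ι] (k : ℕ) :
    ∀ (s : Finset ι) (n : ℕ), s.card = k + 1 → (s.piAntidiag n).card = (n + k).choose k := by
  induction k with
  | zero =>
    intro s n hs
    obtain ⟨a, rfl⟩ := Finset.card_eq_one.1 hs
    have : piAntidiag {a} n = {Pi.single a n} := by
      ext f
      simp only [mem_piAntidiag, Finset.sum_singleton, Finset.mem_singleton]
      constructor
      · rintro ⟨rfl, h⟩
        ext i
        by_cases hi : i = a
        · subst hi; simp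
        · rw [Pi.single_eq_of_ne hi]; by_contra h'; exact hi (h i h')
      · rintro rfl
        refine ⟨by simp, fun i hi => ?_⟩
        by_contra h'
        exact hi (Pi.single_eq_of_ne h' _)
    simp [this]
  | succ k ih =>
    intro s n hs
    obtain ⟨a, t, ha, rfl, ht⟩ := Finset.card_eq_succ.1 hs
    rw [← Finset.cons_eq_insert a t ha, piAntidiag_cons, card_disjiUnion]
    simp only [card_map]
    rw [Finset.Nat.sum_antidiagonal_eq_sum_range_succ_mk, ← Finset.sum_range_reflect]
    rw [show n + (k + 1) = n + k + 1 by ring, ← Nat.sum_range_add_choose]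
    refine Finset.sum_congr rfl fun i hi => ?_
    rw [Finset.mem_range] at hi
    rw [ih t _ ht]
    congr 2
    simp only [Nat.succ_eq_add_one] at *
    omega

/-- The polynomial `(X + 1) ⋯ (X + k) / k!`, which interpolates the number of ways to write a
natural number as an ordered sum of `k + 1` natural numbers. -/
def simplexPoly (k : ℕ) : ℝ[X] :=
  C ((k.factorial : ℝ)⁻¹) * ∏ j ∈ Finset.range k, (X + C ((j : ℝ) + 1))

theorem simplexPoly_eval (k : ℕ) (x : ℝ) :
    (simplexPoly k).eval x = (k.factorial : ℝ)⁻¹ * ∏ j ∈ Finset.range k, (x + (j + 1)) := by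
  simp [simplexPoly, eval_prod]

theorem simplexPoly_eval_natCast (k n : ℕ) :
    (simplexPoly k).eval (n : ℝ) = (n + k).choose k := by
  have h := Nat.ascFactorial_eq_prod_range (n + 1) k
  rw [Nat.ascFactorial_eq_factorial_mul_choose] at h
  have h' : (∏ j ∈ Finset.range k, ((n : ℝ) + (j + 1))) = k.factorial * (n + k).choose k := by
    rw [← Nat.cast_mul, h]
    push_cast
    exact Finset.prod_congr rfl fun _ _ => by ring
  rw [simplexPoly_eval, h', inv_mul_cancel_left₀ (by positivity)]

theorem simplexPoly_eval_of_neg (k : ℕ) (N : ℤ) (h₁ : N < 0) (h₂ : -(k : ℤ) ≤ N) :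
    (simplexPoly k).eval (N : ℝ) = 0 := by
  rw [simplexPoly_eval, Finset.prod_eq_zero (i := (-N - 1).toNat), mul_zero]
  · rw [Finset.mem_range]; omega
  · have : ((-N - 1).toNat : ℤ) = -N - 1 := Int.toNat_of_nonneg (by omega)
    have h : (((-N - 1).toNat : ℤ) : ℝ) = -N - 1 := by rw [this]; push_cast; ring
    rw [Int.cast_natCast] at h
    rw [h]; ring

theorem simplexPoly_eval_neg (k : ℕ) (x : ℝ) :
    (simplexPoly k).eval (-x - (k + 1)) = (-1) ^ k * (simplexPoly k).eval x := by
  rw [simplexPoly_eval, simplexPoly_eval, ← Finset.prod_range_reflect, mul_left_comm]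
  congr 1
  have hc : ((-1 : ℝ) ^ k) = ∏ _j ∈ Finset.range k, (-1 : ℝ) := by simp
  rw [hc, ← Finset.prod_mul_distrib]
  refine Finset.prod_congr rfl fun j hj => ?_
  rw [Finset.mem_range] at hj
  have : ((k - 1 - j : ℕ) : ℝ) = k - 1 - j := by
    rw [Nat.cast_sub (by omega), Nat.cast_sub (by omega)]; simp
  rw [this]; ring

/-- Integer points of the lattice spanned by the coordinates in `s` with sum `N` all of
whose coordinates in `s` satisfy `Q`. -/
def coordSumSet {ι : Type*} (s : Finset ι) (Q : ℤ → Prop) (N : ℤ) : Set (ι → ℤ) :=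
  {n | (∀ i ∉ s, n i = 0) ∧ (∀ i ∈ s, Q (n i)) ∧ ∑ i ∈ s, n i = N}

theorem coordSumSet_nonneg {ι : Type*} [DecidableEq ι] (s : Finset ι) (k : ℕ)
    (hs : s.card = k + 1) (N : ℤ) (hN : -(k : ℤ) ≤ N) :
    Finite (coordSumSet s (0 ≤ ·) N) ∧
      (Nat.card (coordSumSet s (0 ≤ ·) N) : ℝ) = (simplexPoly k).eval (N : ℝ) := by
  rcases lt_or_ge N 0 with h | h
  · have : IsEmpty (coordSumSet s (0 ≤ ·) N) := by
      refine ⟨fun ⟨n, h₁, h₂, h₃⟩ => ?_⟩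
      have := Finset.sum_nonneg h₂
      omega
    refine ⟨inferInstance, ?_⟩
    rw [simplexPoly_eval_of_neg k N h hN, Nat.card_of_isEmpty, Nat.cast_zero]
  · lift N to ℕ using h
    let e : s.piAntidiag N ≃ coordSumSet s (0 ≤ ·) (N : ℤ) :=
      { toFun := fun f => ⟨fun i => (f.1 i : ℤ), by
          have hf := Finset.mem_piAntidiag.1 f.2
          refine ⟨fun i hi => ?_, fun i _ => by simp, by
            simpa using congrArg (Nat.cast : ℕ → ℤ) hf.1⟩
          by_contra h'
          exact hi (hf.2 i (by simpa using h'))⟩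
        invFun := fun n => ⟨fun i => (n.1 i).toNat, by
          obtain ⟨n, h₁, h₂, h₃⟩ := n
          refine Finset.mem_piAntidiag.2 ⟨?_, fun i hi => ?_⟩
          · zify
            rw [← h₃]
            exact Finset.sum_congr rfl fun i hi => Int.toNat_of_nonneg (h₂ i hi)
          · by_contra h'
            exact hi (by simp [h₁ i h'])⟩
        left_inv := fun f => by ext; simp
        right_inv := fun n => by
          obtain ⟨n, h₁, h₂, h₃⟩ := n
          ext i
          by_cases hi : i ∈ s
          · simpa using h₂ i hi
          · simp [h₁ i hi] }
    refine ⟨Finite.of_equiv _ e, ?_⟩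
    rw [← Nat.card_congr e, Int.cast_natCast, simplexPoly_eval_natCast]
    rw [Nat.card_eq_fintype_card, Fintype.card_coe, card_piAntidiag_nat k s N hs]

theorem coordSumSet_neg {ι : Type*} [DecidableEq ι] (s : Finset ι) (k : ℕ)
    (hs : s.card = k + 1) (N : ℤ) (hN : N < 0) :
    Finite (coordSumSet s (· ≤ -1) N) ∧
      (Nat.card (coordSumSet s (· ≤ -1) N) : ℝ) = (-1) ^ k * (simplexPoly k).eval (N : ℝ) := by
  have key : ∀ (Q Q' : ℤ → Prop) (M M' : ℤ), (∀ x, Q x → Q' (-1 - x)) → M + M' = -(k + 1) →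
      ∀ n ∈ coordSumSet s Q M, (fun i => if i ∈ s then -1 - n i else 0) ∈ coordSumSet s Q' M' := by
    rintro Q Q' M M' hQ hM n ⟨h₁, h₂, h₃⟩
    refine ⟨fun i hi => by simp [hi], fun i hi => by simpa [hi] using hQ _ (h₂ i hi), ?_⟩
    rw [Finset.sum_congr rfl (g := fun i => -1 - n i) fun i hi => by simp [hi],
      Finset.sum_sub_distrib, h₃]
    simp [hs]; linarith
  let e : coordSumSet s (0 ≤ ·) (-N - (k + 1)) ≃ coordSumSet s (· ≤ -1) N :=
    { toFun := fun n => ⟨_, key _ _ _ N (fun x hx => by simpa using hx) (by ring) n.1 n.2⟩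
      invFun := fun n => ⟨_, key _ _ N (-N - (k + 1)) (fun x hx => by linarith) (by ring) n.1 n.2⟩
      left_inv := by
        rintro ⟨n, h₁, h₂, h₃⟩
        ext i
        by_cases hi : i ∈ s <;> simp [hi, h₁]
      right_inv := by
        rintro ⟨n, h₁, h₂, h₃⟩
        ext i
        by_cases hi : i ∈ s <;> simp [hi, h₁] }
  obtain ⟨hf, hc⟩ := coordSumSet_nonneg s k hs (-N - (k + 1)) (by omega)
  refine ⟨Finite.of_equiv _ e, ?_⟩
  rw [← Nat.card_congr e, hc, ← simplexPoly_eval_neg]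
  push_cast; rfl

section FaceCounting

variable {d : ℕ} {ι : Type} [Fintype ι]

/-- The homogenized barycentric coordinates: the linear functional on `ℝ^d × ℝ` which at
`(t • x, t)` takes the value `t` times the barycentric coordinate of `x`. -/
def homCoord (b : AffineBasis ι ℝ (Fin d → ℝ)) (i : ι) : (Fin d → ℝ) × ℝ →ₗ[ℝ] ℝ :=
  (b.coord i).linear.coprod (LinearMap.toSpanSingleton ℝ ℝ (b.coord i 0))

omit [Fintype ι] in
theorem homCoord_apply (b : AffineBasis ι ℝ (Fin d → ℝ)) (i : ι) (x : Fin d → ℝ) (t : ℝ) :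
    homCoord b i (x, t) = (b.coord i).linear x + t * b.coord i 0 := by
  simp [homCoord]

omit [Fintype ι] in
theorem coord_linear (b : AffineBasis ι ℝ (Fin d → ℝ)) (i : ι) (x : Fin d → ℝ) :
    (b.coord i).linear x = b.coord i x - b.coord i 0 := by
  rw [AffineMap.decomp']; rfl

omit [Fintype ι] in
theorem homCoord_smul (b : AffineBasis ι ℝ (Fin d → ℝ)) (i : ι) (x : Fin d → ℝ) (t : ℝ) :
    homCoord b i (t • x, t) = t * b.coord i x := by
  rw [homCoord_apply, map_smul, coord_linear, smul_eq_mul]; ring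

theorem sum_homCoord (b : AffineBasis ι ℝ (Fin d → ℝ)) (z : (Fin d → ℝ) × ℝ) :
    ∑ i, homCoord b i z = z.2 := by
  obtain ⟨x, t⟩ := z
  simp_rw [homCoord_apply, coord_linear, Finset.sum_add_distrib, Finset.sum_sub_distrib,
    ← Finset.mul_sum, b.sum_coord_apply_eq_one]
  ring

theorem sum_homCoord_smul (b : AffineBasis ι ℝ (Fin d → ℝ)) (z : (Fin d → ℝ) × ℝ) :
    ∑ i, homCoord b i z • b i = z.1 := by
  obtain ⟨x, t⟩ := z
  simp_rw [homCoord_apply, coord_linear, add_smul, sub_smul, mul_smul, Finset.sum_add_distrib,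
    Finset.sum_sub_distrib, ← Finset.smul_sum, b.linear_combination_coord_eq_self]
  simp

/-- The homogenized barycentric coordinates of a lattice point. -/
def intCoord (b : AffineBasis ι ℝ (Fin d → ℝ)) (i : ι) (m : Fin d → ℤ) (t : ℤ) : ℝ :=
  homCoord b i (fun j => (m j : ℝ), (t : ℝ))

theorem sum_intCoord (b : AffineBasis ι ℝ (Fin d → ℝ)) (m : Fin d → ℤ) (t : ℤ) :
    ∑ i, intCoord b i m t = t := sum_homCoord b _

theorem intCoord_add_sum [DecidableEq ι] (b : AffineBasis ι ℝ (Fin d → ℝ)) (p : ℕ)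
    (w : ι → Fin d → ℤ) (hw : ∀ i j, (p : ℝ) * b i j = w i j) (m : Fin d → ℤ) (h : ℤ)
    (n : ι → ℤ) (i : ι) :
    intCoord b i (m + ∑ j, n j • w j) (h + p * ∑ j, n j) = intCoord b i m h + p * n i := by
  have : ((fun k => (((m + ∑ j, n j • w j) k : ℤ) : ℝ)), ((h + p * ∑ j, n j : ℤ) : ℝ)) =
      ((fun k => (m k : ℝ)), (h : ℝ)) + ∑ j, (n j : ℝ) • ((p : ℝ) • b j, (p : ℝ)) := by
    ext k
    · simp [Prod.fst_sum, hw]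
    · simp [Prod.snd_sum, Finset.mul_sum, mul_comm]
  rw [intCoord, this, map_add, map_sum]
  simp_rw [map_smul, homCoord_smul, b.coord_apply]
  simp [intCoord, mul_comm]

theorem finite_intCoord_le (b : AffineBasis ι ℝ (Fin d → ℝ)) (M : ℝ) :
    {z : (Fin d → ℤ) × ℤ | ∀ i, |intCoord b i z.1 z.2| ≤ M}.Finite := by
  let B : Fin d → ℤ := fun j => ⌈∑ i, M * |b i j|⌉
  let R : ℤ := ⌈∑ _i : ι, M⌉
  refine ((Set.finite_Icc (-B) B).prod (Set.finite_Icc (-R) R)).subset ?_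
  rintro ⟨m, t⟩ hz
  have h₂ : |t| ≤ R := by
    have h : |(t : ℝ)| ≤ ∑ _i : ι, M := by
      rw [← sum_intCoord b m t]
      exact (Finset.abs_sum_le_sum_abs _ _).trans (Finset.sum_le_sum fun i _ => hz i)
    have := h.trans (Int.le_ceil _)
    exact_mod_cast this
  have h₁ : ∀ j, |m j| ≤ B j := fun j => by
    have h : |(m j : ℝ)| ≤ ∑ i, M * |b i j| := by
      have := congrFun (sum_homCoord_smul b (fun j => (m j : ℝ), (t : ℝ))) j
      simp only [Finset.sum_apply, Pi.smul_apply, smul_eq_mul] at this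
      rw [← this]
      refine (Finset.abs_sum_le_sum_abs _ _).trans (Finset.sum_le_sum fun i _ => ?_)
      rw [abs_mul]
      exact mul_le_mul_of_nonneg_right (hz i) (abs_nonneg _)
    have := h.trans (Int.le_ceil _)
    exact_mod_cast this
  exact ⟨⟨fun j => (abs_le.1 (h₁ j)).1, fun j => (abs_le.1 (h₁ j)).2⟩, abs_le.1 h₂⟩

/-- Lattice points at height `t` whose homogenized coordinates vanish on `W` and satisfy `Q`
off `W`. -/
def faceSet (b : AffineBasis ι ℝ (Fin d → ℝ)) (W : Finset ι) (Q : ℝ → Prop) (t : ℤ) :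
    Set (Fin d → ℤ) :=
  {m | (∀ i ∈ W, intCoord b i m t = 0) ∧ ∀ i ∉ W, Q (intCoord b i m t)}

theorem finite_faceSet_pos (b : AffineBasis ι ℝ (Fin d → ℝ)) (W : Finset ι) (t : ℤ) :
    (faceSet b W (0 < ·) t).Finite := by
  have h := (finite_intCoord_le b t).preimage
    (f := fun m : Fin d → ℤ => (m, t)) (fun _ _ _ _ h => (Prod.ext_iff.1 h).1)
  refine h.subset fun m hm => ?_
  have hn : ∀ i, 0 ≤ intCoord b i m t := fun i => by
    by_cases hi : i ∈ W
    · exact (hm.1 i hi).ge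
    · exact (hm.2 i hi).le
  intro i
  rw [abs_of_nonneg (hn i)]
  exact (Finset.single_le_sum (fun i _ => hn i) (Finset.mem_univ i)).trans_eq (sum_intCoord b m t)

theorem finite_faceSet_nonpos (b : AffineBasis ι ℝ (Fin d → ℝ)) (W : Finset ι) (t : ℤ) :
    (faceSet b W (· ≤ 0) t).Finite := by
  have h := (finite_intCoord_le b (-t)).preimage
    (f := fun m : Fin d → ℤ => (m, t)) (fun _ _ _ _ h => (Prod.ext_iff.1 h).1)
  refine h.subset fun m hm => ?_
  have hn : ∀ i, 0 ≤ -intCoord b i m t := fun i => by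
    by_cases hi : i ∈ W
    · simp [hm.1 i hi]
    · simpa using hm.2 i hi
  intro i
  rw [← abs_neg, abs_of_nonneg (hn i)]
  refine (Finset.single_le_sum (fun i _ => hn i) (Finset.mem_univ i)).trans_eq ?_
  rw [Finset.sum_neg_distrib, sum_intCoord]

theorem card_faceSet [DecidableEq ι] (b : AffineBasis ι ℝ (Fin d → ℝ)) (p : ℕ) (hp : 0 < p)
    (w : ι → Fin d → ℤ) (hw : ∀ i j, (p : ℝ) * b i j = w i j) (W : Finset ι)
    (box : Finset ((Fin d → ℤ) × ℤ)) (hbox : ∀ z, z ∈ box ↔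
      (∀ i ∈ W, intCoord b i z.1 z.2 = 0) ∧
      ∀ i ∉ W, 0 < intCoord b i z.1 z.2 ∧ intCoord b i z.1 z.2 ≤ p)
    (Q : ℝ → Prop) (Q' : ℤ → Prop)
    (hQ : ∀ (c : ℝ) (n : ℤ), 0 < c → c ≤ p → (Q (c + p * n) ↔ Q' n)) (t : ℤ)
    (hfin : ∀ z ∈ box, (z.2 : ZMod p) = t → Finite (coordSumSet Wᶜ Q' ((t - z.2) / p))) :
    Nat.card (faceSet b W Q t) =
      ∑ z ∈ box with (z.2 : ZMod p) = t, Nat.card (coordSumSet Wᶜ Q' ((t - z.2) / p)) := by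
  classical
  have hp' : (0 : ℝ) < p := by exact_mod_cast hp
  let box' := {z ∈ box | (z.2 : ZMod p) = t}
  have : ∀ z : box', Finite (coordSumSet Wᶜ Q' ((t - z.1.2) / p)) := fun z => by
    obtain ⟨h₁, h₂⟩ := Finset.mem_filter.1 z.2
    exact hfin z h₁ h₂
  rw [← Finset.sum_coe_sort box' fun z => Nat.card (coordSumSet Wᶜ Q' ((t - z.2) / p)),
    ← Nat.card_sigma]
  have hsum : ∀ (n : ι → ℤ), (∀ i ∉ Wᶜ, n i = 0) → ∑ i, n i = ∑ i ∈ Wᶜ, n i := fun n hn =>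
    (Finset.sum_subset (Finset.subset_univ _) fun i _ hi => hn i hi).symm
  have hheight : ∀ (z : box') (n : coordSumSet Wᶜ Q' ((t - z.1.2) / p)),
      z.1.2 + p * ∑ i, n.1 i = t := by
    rintro ⟨z, hz⟩ ⟨n, h₁, h₂, h₃⟩
    have hd := (ZMod.intCast_eq_intCast_iff_dvd_sub _ _ _).1 (Finset.mem_filter.1 hz).2
    rw [hsum n h₁, h₃, Int.mul_ediv_cancel' hd]; ring
  have hcoord : ∀ (z : box') (n : coordSumSet Wᶜ Q' ((t - z.1.2) / p)) (i : ι),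
      intCoord b i (z.1.1 + ∑ j, n.1 j • w j) t = intCoord b i z.1.1 z.1.2 + p * n.1 i := by
    intro z n i
    rw [← intCoord_add_sum b p w hw, hheight]
  symm
  refine Nat.card_eq_of_bijective
    (fun a : (Σ z : box', coordSumSet Wᶜ Q' ((t - z.1.2) / p)) =>
      (⟨a.1.1.1 + ∑ j, a.2.1 j • w j, ?_⟩ : faceSet b W Q t)) ⟨?_, ?_⟩
  · obtain ⟨z, n⟩ := a
    have hz := (hbox _).1 (Finset.mem_filter.1 z.2).1
    refine ⟨fun i hi => ?_, fun i hi => ?_⟩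
    · rw [hcoord, hz.1 i hi, n.2.1 i (by simpa using hi)]; simp
    · rw [hcoord, hQ _ _ (hz.2 i hi).1 (hz.2 i hi).2]
      exact n.2.2.1 i (by simpa using hi)
  · rintro ⟨z, n⟩ ⟨z', n'⟩ h
    have h : z.1.1 + ∑ j, n.1 j • w j = z'.1.1 + ∑ j, n'.1 j • w j := congrArg Subtype.val h
    have hz := (hbox _).1 (Finset.mem_filter.1 z.2).1
    have hz' := (hbox _).1 (Finset.mem_filter.1 z'.2).1
    have hn : n.1 = n'.1 := by
      ext i
      by_cases hi : i ∈ W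
      · rw [n.2.1 i (by simpa using hi), n'.2.1 i (by simpa using hi)]
      · have e := hcoord z n i
        rw [h, hcoord z' n' i] at e
        have h₁ := hz.2 i hi
        have h₂ := hz'.2 i hi
        have h₃ : ((n.1 i - n'.1 i : ℤ) : ℝ) < 1 := by
          push_cast
          by_contra! h'
          nlinarith
        have h₄ : (-1 : ℝ) < ((n.1 i - n'.1 i : ℤ) : ℝ) := by
          push_cast
          by_contra! h'
          nlinarith
        have h₅ : n.1 i - n'.1 i < 1 := by exact_mod_cast h₃
        have h₆ : -1 < n.1 i - n'.1 i := by exact_mod_cast h₄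
        omega
    have hzz : z = z' := by
      refine Subtype.ext (Prod.ext ?_ ?_)
      · rw [hn] at h
        exact add_right_cancel h
      · have h₁ := hheight z n
        rw [hn] at h₁
        exact add_right_cancel (h₁.trans (hheight z' n').symm)
    subst hzz
    exact congrArg _ (Subtype.ext hn)
  · rintro ⟨m, hm⟩
    let n : ι → ℤ := fun i => if i ∈ W then 0 else ⌈intCoord b i m t / p⌉ - 1
    have hn : ∀ i ∉ Wᶜ, n i = 0 := fun i hi => by simp [n, (by simpa using hi : i ∈ W)]
    let z : (Fin d → ℤ) × ℤ := (m - ∑ j, n j • w j, t - p * ∑ j, n j)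
    have hc : ∀ i, intCoord b i m t = intCoord b i z.1 z.2 + p * n i := fun i => by
      rw [← intCoord_add_sum b p w hw]; simp [z]
    have hb : ∀ i ∉ W, 0 < intCoord b i z.1 z.2 ∧ intCoord b i z.1 z.2 ≤ p := fun i hi => by
      have e : (n i : ℝ) = ⌈intCoord b i m t / p⌉ - 1 := by simp [n, hi]
      have h₁ := Int.le_ceil (intCoord b i m t / p)
      have h₂ := Int.ceil_lt_add_one (intCoord b i m t / p)
      rw [div_le_iff₀ hp'] at h₁
      rw [← sub_lt_iff_lt_add, lt_div_iff₀ hp', ← e] at h₂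
      have := hc i
      constructor <;> nlinarith
    have hz : z ∈ box' := by
      refine Finset.mem_filter.2 ⟨(hbox z).2 ⟨fun i hi => ?_, hb⟩, by simp [z]⟩
      have := hc i
      rw [hm.1 i hi, hn i (by simpa using hi)] at this
      simpa using this.symm
    refine ⟨⟨⟨z, hz⟩, ⟨n, hn, fun i hi => ?_, ?_⟩⟩, ?_⟩
    · have hi : i ∉ W := by simpa using hi
      rw [← hQ _ _ (hb i hi).1 (hb i hi).2, ← hc]
      exact hm.2 i hi
    · rw [← hsum n hn]
      simp only [z]
      rw [sub_sub_cancel, Int.mul_ediv_cancel_left _ (by exact_mod_cast hp.ne')]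
    · simp [z]

theorem exists_polynomial_card_faceSet [DecidableEq ι] (b : AffineBasis ι ℝ (Fin d → ℝ)) (p : ℕ)
    (hp : 0 < p) (hpb : ∀ i j, ∃ n : ℤ, (p : ℝ) * b i j = n) (W : Finset ι) :
    ∃ q : ZMod p → ℝ[X], ∀ t : ℤ, 0 < t →
      (Nat.card (faceSet b W (0 < ·) t) : ℝ) = (q t).eval (t : ℝ) ∧
      (q ((-t : ℤ) : ZMod p)).eval (((-t : ℤ) : ℝ)) =
        (-1) ^ (d + W.card) * (Nat.card (faceSet b W (· ≤ 0) (-t)) : ℝ) := by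
  have hp' : (0 : ℝ) < p := by exact_mod_cast hp
  have hpz : (0 : ℤ) < p := by exact_mod_cast hp
  by_cases hW : W = Finset.univ
  · have h0 : ∀ (Q : ℝ → Prop) (t : ℤ), t ≠ 0 → IsEmpty (faceSet b W Q t) := by
      rintro Q t ht
      refine ⟨fun ⟨m, hm, _⟩ => ht ?_⟩
      have := sum_intCoord b m t
      rw [Finset.sum_eq_zero fun i _ => hm i (by simp [hW])] at this
      exact_mod_cast this.symm
    refine ⟨0, fun t ht => ?_⟩
    have := h0 (0 < ·) t ht.ne'
    have := h0 (· ≤ 0) (-t) (by omega)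
    simp
  choose w hw using hpb
  obtain ⟨k, hk⟩ : ∃ k, Wᶜ.card = k + 1 := Nat.exists_eq_succ_of_ne_zero (by
    rwa [Finset.card_ne_zero, Finset.nonempty_iff_ne_empty, Ne, Finset.compl_eq_empty_iff])
  have hcard : d + W.card + 1 + (k + 1) = 2 * (d + 1) := by
    have := W.card_add_card_compl
    have h2 := b.card_eq_finrank_add_one
    rw [Module.finrank_fin_fun] at h2
    omega
  have hsign : ((-1 : ℝ)) ^ (d + W.card) = (-1) ^ k := by
    refine neg_one_pow_congr ?_
    rw [Nat.even_iff, Nat.even_iff]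
    omega
  have hfinbox : {z : (Fin d → ℤ) × ℤ | (∀ i ∈ W, intCoord b i z.1 z.2 = 0) ∧
      ∀ i ∉ W, 0 < intCoord b i z.1 z.2 ∧ intCoord b i z.1 z.2 ≤ p}.Finite := by
    refine (finite_intCoord_le b p).subset fun z hz i => ?_
    by_cases hi : i ∈ W
    · rw [hz.1 i hi, abs_zero]; exact hp'.le
    · rw [abs_of_pos (hz.2 i hi).1]; exact (hz.2 i hi).2
  let box := hfinbox.toFinset
  have hbox : ∀ z, z ∈ box ↔ (∀ i ∈ W, intCoord b i z.1 z.2 = 0) ∧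
      ∀ i ∉ W, 0 < intCoord b i z.1 z.2 ∧ intCoord b i z.1 z.2 ≤ p := fun z => by
    simp [box]
  have hheight : ∀ z ∈ box, 0 < z.2 ∧ z.2 ≤ (k + 1) * p := by
    intro z hz
    rw [hbox] at hz
    have h := sum_intCoord b z.1 z.2
    rw [← Finset.sum_add_sum_compl W, Finset.sum_eq_zero fun i hi => hz.1 i hi, zero_add] at h
    constructor
    · have : (0 : ℝ) < z.2 := by
        rw [← h]
        refine Finset.sum_pos (fun i hi => (hz.2 i (by simpa using hi)).1) ?_
        rw [← Finset.card_pos]; omega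
      exact_mod_cast this
    · have : (z.2 : ℝ) ≤ (k + 1) * p := by
        rw [← h]
        refine (Finset.sum_le_card_nsmul _ _ _ fun i hi => (hz.2 i (by simpa using hi)).2).trans ?_
        rw [hk]; simp
      exact_mod_cast this
  have heval : ∀ (z : (Fin d → ℤ) × ℤ) (t : ℤ), (z.2 : ZMod p) = t →
      ((simplexPoly k).comp (C ((p : ℝ)⁻¹) * (X - C (z.2 : ℝ)))).eval (t : ℝ) =
        (simplexPoly k).eval (((t - z.2) / p : ℤ) : ℝ) := by
    intro z t h
    have hd := (ZMod.intCast_eq_intCast_iff_dvd_sub _ _ _).1 h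
    rw [Int.cast_div hd (by exact_mod_cast hp.ne')]
    simp [div_eq_inv_mul]
  refine ⟨fun r => ∑ z ∈ box with (z.2 : ZMod p) = r,
    (simplexPoly k).comp (C ((p : ℝ)⁻¹) * (X - C (z.2 : ℝ))), fun t ht => ⟨?_, ?_⟩⟩
  · have hc := fun z (hz : z ∈ box) (h : (z.2 : ZMod p) = t) =>
      coordSumSet_nonneg Wᶜ k hk ((t - z.2) / p) (by
        have hh := hheight z hz
        obtain ⟨c, hc⟩ := (ZMod.intCast_eq_intCast_iff_dvd_sub _ _ _).1 h
        rw [hc, Int.mul_ediv_cancel_left _ hpz.ne']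
        have : p * -(k + 1 : ℤ) < p * c := by linarith
        have := lt_of_mul_lt_mul_left this hpz.le
        omega)
    rw [card_faceSet b p hp w hw W box hbox (0 < ·) (0 ≤ ·) ?_ t fun z hz h => (hc z hz h).1,
      eval_finsetSum, Nat.cast_sum]
    · refine Finset.sum_congr rfl fun z hz => ?_
      rw [Finset.mem_filter] at hz
      rw [heval z t hz.2, (hc z hz.1 hz.2).2]
    · intro c n h₁ h₂
      constructor
      · intro h
        by_contra! h'
        have : (n : ℝ) ≤ -1 := by exact_mod_cast (by omega : n ≤ -1)
        nlinarith
      · intro h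
        have : (0 : ℝ) ≤ n := by exact_mod_cast h
        positivity
  · have hc := fun z (hz : z ∈ box) => coordSumSet_neg Wᶜ k hk ((-t - z.2) / p) (by
      have := hheight z hz
      exact Int.ediv_neg_of_neg_of_pos (by omega) hpz)
    rw [card_faceSet b p hp w hw W box hbox (· ≤ 0) (· ≤ -1) ?_ (-t) fun z hz _ => (hc z hz).1,
      eval_finsetSum, Nat.cast_sum, hsign, Finset.mul_sum]
    · refine Finset.sum_congr rfl fun z hz => ?_
      rw [Finset.mem_filter] at hz
      rw [heval z _ hz.2, (hc z hz.1).2, ← mul_assoc, ← mul_pow]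
      simp
    · intro c n h₁ h₂
      constructor
      · intro h
        by_contra! h'
        have : (0 : ℝ) ≤ n := by exact_mod_cast (by omega : 0 ≤ n)
        nlinarith [mul_nonneg hp'.le this]
      · intro h
        have : (n : ℝ) ≤ -1 := by exact_mod_cast h
        nlinarith

end FaceCounting

theorem elemCone_of_fintype {d : ℕ} {κ : Type*} [Fintype κ] (a : κ → Fin d → ℝ) (s : κ → Bool) :
    ElemCone d (⋂ i, {x : Fin d → ℝ |
      if s i then (∑ k, a i k * x k) < 0 else (∑ k, a i k * x k) ≤ 0}) := by
  refine ⟨Fintype.card κ, a ∘ (Fintype.equivFin κ).symm, s ∘ (Fintype.equivFin κ).symm, ?_⟩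
  exact ((Fintype.equivFin κ).symm.surjective.iInter_comp _).symm

theorem linearMap_eq_sum_single {d : ℕ} (f : (Fin d → ℝ) →ₗ[ℝ] ℝ) (x : Fin d → ℝ) :
    f x = ∑ k, f (Pi.single k 1) * x k := by
  rw [f.pi_apply_eq_sum_univ]
  refine Finset.sum_congr rfl fun k _ => ?_
  rw [smul_eq_mul, mul_comm, show (fun j => if k = j then (1 : ℝ) else 0) = Pi.single k 1 by
    ext j; simp [Pi.single_apply, eq_comm]]

theorem elemCone_lt {d : ℕ} (f : (Fin d → ℝ) →ₗ[ℝ] ℝ) : ElemCone d {x | f x < 0} := by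
  convert elemCone_of_fintype (fun (_ : Unit) k => f (Pi.single k 1)) (fun _ => true) using 1
  ext x
  simp [linearMap_eq_sum_single f x]

theorem elemCone_le {d : ℕ} (f : (Fin d → ℝ) →ₗ[ℝ] ℝ) : ElemCone d {x | f x ≤ 0} := by
  convert elemCone_of_fintype (fun (_ : Unit) k => f (Pi.single k 1)) (fun _ => false) using 1
  ext x
  simp [linearMap_eq_sum_single f x]

theorem elemCone_univ (d : ℕ) : ElemCone d univ := by
  convert elemCone_le (0 : (Fin d → ℝ) →ₗ[ℝ] ℝ) using 1
  ext; simp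

theorem elemCone_empty (d : ℕ) : ElemCone d ∅ := by
  convert elemCone_lt (0 : (Fin d → ℝ) →ₗ[ℝ] ℝ) using 1
  ext; simp

theorem ElemCone.iInter {d : ℕ} {κ : Type*} [Fintype κ] {A : κ → Set (Fin d → ℝ)}
    (hA : ∀ i, ElemCone d (A i)) : ElemCone d (⋂ i, A i) := by
  choose n a s h using hA
  convert elemCone_of_fintype (κ := Σ i, Fin (n i)) (fun j => a j.1 j.2) (fun j => s j.1 j.2)
    using 1
  rw [Set.iInter_sigma]
  exact Set.iInter_congr h

theorem ElemCone.inter {d : ℕ} {A B : Set (Fin d → ℝ)} (hA : ElemCone d A) (hB : ElemCone d B) :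
    ElemCone d (A ∩ B) := by
  rw [Set.inter_eq_iInter]
  exact ElemCone.iInter (by rintro (_ | _) <;> assumption)

theorem ElemCone.biInter {d : ℕ} {κ : Type*} {A : κ → Set (Fin d → ℝ)}
    (hA : ∀ i, ElemCone d (A i)) (U : Finset κ) : ElemCone d (⋂ i ∈ U, A i) := by
  have : ⋂ i ∈ U, A i = ⋂ i : U, A i := by ext; simp
  rw [this]
  exact ElemCone.iInter fun i => hA i

theorem ElemCone.mem_coneLattice {d : ℕ} {A : Set (Fin d → ℝ)} (hA : ElemCone d A) :
    A ∈ ConeLattice d := ⟨1, fun _ => A, fun _ => hA, (Set.iUnion_const A).symm⟩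

theorem biUnion_mem_coneLattice {d : ℕ} {κ : Type*} {A : κ → Set (Fin d → ℝ)}
    (hA : ∀ i, ElemCone d (A i)) (s : Finset κ) : ⋃ i ∈ s, A i ∈ ConeLattice d := by
  refine ⟨s.card, fun i => A (s.equivFin.symm i), fun _ => hA _, ?_⟩
  rw [s.equivFin.symm.surjective.iUnion_comp (fun i : s => A i)]
  ext; simp

section Valuation

variable {d : ℕ} {v : Set (Fin d → ℝ) → ℝ} (hv0 : v ∅ = 0)
  (hval : ∀ A ∈ ConeLattice d, ∀ B ∈ ConeLattice d, v (A ∪ B) + v (A ∩ B) = v A + v B)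

include hv0 hval

theorem valuation_biUnion {κ : Type*} {A : κ → Set (Fin d → ℝ)}
    (hA : ∀ i, ElemCone d (A i)) (hd : Pairwise fun i j => Disjoint (A i) (A j)) (s : Finset κ) :
    v (⋃ i ∈ s, A i) = ∑ i ∈ s, v (A i) := by
  classical
  induction s using Finset.induction_on with
  | empty => simpa using hv0
  | insert a s ha ih =>
    have h := hval (A a) (hA a).mem_coneLattice _ (biUnion_mem_coneLattice hA s)
    have hdis : A a ∩ ⋃ i ∈ s, A i = ∅ := by
      rw [← Set.disjoint_iff_inter_eq_empty]
      simp only [Set.disjoint_iUnion_right]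
      exact fun i hi => hd (by rintro rfl; exact ha hi)
    rw [hdis, hv0, add_zero] at h
    rw [Finset.set_biUnion_insert, h, ih, Finset.sum_insert ha]

theorem valuation_inter_compl {C H : Set (Fin d → ℝ)} (hC : ElemCone d C) (hH : ElemCone d H)
    (hH' : ElemCone d Hᶜ) : v (C ∩ Hᶜ) = v C - v (C ∩ H) := by
  have h := hval _ (hC.inter hH).mem_coneLattice _ (hC.inter hH').mem_coneLattice
  rw [Set.inter_union_compl, show C ∩ H ∩ (C ∩ Hᶜ) = ∅ by ext; simp; tauto, hv0] at h
  linarith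

theorem valuation_inter_biInter_compl {κ : Type*} {H : κ → Set (Fin d → ℝ)}
    (hH : ∀ i, ElemCone d (H i)) (hH' : ∀ i, ElemCone d (H i)ᶜ) (W : Finset κ) :
    ∀ {C : Set (Fin d → ℝ)}, ElemCone d C → v (C ∩ ⋂ i ∈ W, (H i)ᶜ) =
      ∑ U ∈ W.powerset, (-1) ^ U.card * v (C ∩ ⋂ i ∈ U, H i) := by
  classical
  induction W using Finset.induction_on with
  | empty => intro C _; simp
  | insert a W ha ih =>
    intro C hC
    rw [Finset.set_biInter_insert, ← Set.inter_assoc, ih (hC.inter (hH' a)),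
      Finset.sum_powerset_insert ha, ← Finset.sum_add_distrib]
    refine Finset.sum_congr rfl fun U hU => ?_
    have haU : a ∉ U := fun h => ha (Finset.mem_powerset.1 hU h)
    rw [Finset.card_insert_of_notMem haU, Finset.set_biInter_insert, Set.inter_right_comm,
      valuation_inter_compl hv0 hval (hC.inter (ElemCone.biInter hH U)) (hH a) (hH' a),
      show C ∩ (H a ∩ ⋂ i ∈ U, H i) = C ∩ (⋂ i ∈ U, H i) ∩ H a by
        rw [Set.inter_comm (H a), Set.inter_assoc]]
    ring

end Valuation

theorem hasSum_indicator_one {α : Type*} {A : Set α} (hA : A.Finite) :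
    HasSum (A.indicator (1 : α → ℝ)) (Nat.card A) := by
  have h := hasSum_sum_of_ne_finset_zero (L := .unconditional α)
    (f := A.indicator (1 : α → ℝ)) (s := hA.toFinset)
    (fun x hx => Set.indicator_of_notMem (by simpa using hx) _)
  rw [Finset.sum_congr rfl (g := fun _ => (1 : ℝ)) fun x hx => by
    rw [Set.indicator_of_mem (by simpa using hx)]; rfl] at h
  rw [Nat.card_coe_set_eq, Set.ncard_eq_toFinset_card A hA]
  simpa using h

section Simplex

variable {d : ℕ} {ι : Type} [Fintype ι] (b : AffineBasis ι ℝ (Fin d → ℝ)) (q : Fin d → ℝ)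

/-- The tangent half space of the simplex along its `i`-th facet; it is closed if `q` lies on the
same side of the facet as the simplex, and open otherwise. -/
def sideCone (i : ι) : Set (Fin d → ℝ) :=
  {x | 0 < (b.coord i).linear x ∨ ((b.coord i).linear x = 0 ∧ 0 < b.coord i q)}

/-- The tangent cone at `m` of the half-open `t`-th dilate of the simplex, as seen from `q`. -/
def posCone (t : ℤ) (m : Fin d → ℤ) : Set (Fin d → ℝ) :=
  {x | ∀ i, 0 < intCoord b i m t ∨ (intCoord b i m t = 0 ∧ x ∈ sideCone b q i)}

/-- The tangent cone at `m` of the `t`-th dilate (with `t` negative) of the complementary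
half-open simplex. -/
def negCone (t : ℤ) (m : Fin d → ℤ) : Set (Fin d → ℝ) :=
  {x | ∀ i, intCoord b i m t < 0 ∨ (intCoord b i m t = 0 ∧ x ∉ sideCone b q i)}

omit [Fintype ι] in
theorem elemCone_sideCone (i : ι) : ElemCone d (sideCone b q i) := by
  by_cases h : 0 < b.coord i q
  · convert elemCone_le (-(b.coord i).linear) using 1
    ext x
    simp [sideCone, h, le_iff_lt_or_eq, eq_comm]
  · convert elemCone_lt (-(b.coord i).linear) using 1
    ext x
    simp [sideCone, h]

omit [Fintype ι] in
theorem elemCone_compl_sideCone (i : ι) : ElemCone d (sideCone b q i)ᶜ := by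
  by_cases h : 0 < b.coord i q
  · convert elemCone_lt (b.coord i).linear using 1
    ext x
    simp only [sideCone, Set.mem_compl_iff, Set.mem_ofPred_eq, h, and_true]
    grind
  · convert elemCone_le (b.coord i).linear using 1
    ext x
    simp [sideCone, h]

theorem elemCone_posCone (t : ℤ) (m : Fin d → ℤ) : ElemCone d (posCone b q t m) := by
  rw [posCone, Set.ofPred_forall]
  refine ElemCone.iInter fun i => ?_
  by_cases h₁ : 0 < intCoord b i m t
  · simpa [h₁] using elemCone_univ d
  by_cases h₂ : intCoord b i m t = 0
  · simpa [h₂] using elemCone_sideCone b q i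
  · simpa [h₁, h₂] using elemCone_empty d

theorem elemCone_negCone (t : ℤ) (m : Fin d → ℤ) : ElemCone d (negCone b q t m) := by
  rw [negCone, Set.ofPred_forall]
  refine ElemCone.iInter fun i => ?_
  by_cases h₁ : intCoord b i m t < 0
  · simpa [h₁] using elemCone_univ d
  by_cases h₂ : intCoord b i m t = 0
  · simpa [h₂] using! elemCone_compl_sideCone b q i
  · simpa [h₁, h₂] using elemCone_empty d

variable {v : Set (Fin d → ℝ) → ℝ} (hv0 : v ∅ = 0)
  (hval : ∀ A ∈ ConeLattice d, ∀ B ∈ ConeLattice d, v (A ∪ B) + v (A ∩ B) = v A + v B)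

include hv0

theorem valuation_posCone (t : ℤ) (m : Fin d → ℤ) :
    v (posCone b q t m) = ∑ W : Finset ι, v (⋂ i ∈ W, sideCone b q i) *
      (faceSet b W (0 < ·) t).indicator 1 m := by
  classical
  by_cases h : ∀ i, 0 ≤ intCoord b i m t
  · let Z : Finset ι := {i | intCoord b i m t = 0}
    have hm : ∀ W : Finset ι, m ∈ faceSet b W (0 < ·) t ↔ W = Z := by
      intro W
      constructor
      · rintro ⟨h₁, h₂⟩
        ext i
        by_cases hi : i ∈ W
        · simp [hi, Z, h₁ i hi]
        · simp [hi, Z, (h₂ i hi).ne']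
      · rintro rfl
        exact ⟨fun i hi => by simpa [Z] using hi,
          fun i hi => lt_of_le_of_ne (h i) (Ne.symm (by simpa [Z] using hi))⟩
    have hZ : posCone b q t m = ⋂ i ∈ Z, sideCone b q i := by
      ext x
      simp only [posCone, Set.mem_ofPred_eq, Set.mem_iInter, Z, Finset.mem_filter,
        Finset.mem_univ, true_and]
      refine forall_congr' fun i => ?_
      rcases (h i).lt_or_eq with h' | h'
      · simp [h', h'.ne']
      · simp [← h']
    rw [Finset.sum_eq_single Z, Set.indicator_of_mem ((hm Z).2 rfl), hZ]
    · simp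
    · intro W _ hW
      rw [Set.indicator_of_notMem (by rwa [hm]), mul_zero]
    · simp
  · have he : posCone b q t m = ∅ := by
      push Not at h
      obtain ⟨i, hi⟩ := h
      refine Set.eq_empty_of_forall_notMem fun x hx => ?_
      rcases hx i with h' | h'
      · linarith
      · linarith [h'.1]
    rw [he, hv0, Finset.sum_eq_zero]
    intro W _
    rw [Set.indicator_of_notMem, mul_zero]
    rintro ⟨h₁, h₂⟩
    refine h fun i => ?_
    by_cases hi : i ∈ W
    · exact (h₁ i hi).ge
    · exact (h₂ i hi).le

include hval

theorem valuation_negCone (t : ℤ) (m : Fin d → ℤ) :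
    v (negCone b q t m) = ∑ W : Finset ι, (-1) ^ W.card * v (⋂ i ∈ W, sideCone b q i) *
      (faceSet b W (· ≤ 0) t).indicator 1 m := by
  classical
  by_cases h : ∀ i, intCoord b i m t ≤ 0
  · let Z : Finset ι := {i | intCoord b i m t = 0}
    have hm : ∀ W : Finset ι, m ∈ faceSet b W (· ≤ 0) t ↔ W ⊆ Z := by
      intro W
      constructor
      · rintro ⟨h₁, h₂⟩ i hi
        simp [Z, h₁ i hi]
      · exact fun hW => ⟨fun i hi => by simpa [Z] using hW hi, fun i _ => h i⟩
    have hZ : negCone b q t m = univ ∩ ⋂ i ∈ Z, (sideCone b q i)ᶜ := by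
      ext x
      simp only [negCone, Set.mem_ofPred_eq, Set.mem_iInter, Z, Finset.mem_filter,
        Finset.mem_univ, true_and, Set.univ_inter, Set.mem_compl_iff]
      refine forall_congr' fun i => ?_
      rcases (h i).lt_or_eq with h' | h'
      · simp [h', h'.ne]
      · simp [h']
    rw [hZ, valuation_inter_biInter_compl hv0 hval (elemCone_sideCone b q)
      (elemCone_compl_sideCone b q) Z (elemCone_univ d),
      ← Finset.sum_subset (Finset.subset_univ Z.powerset)]
    · refine Finset.sum_congr rfl fun W hW => ?_
      rw [Set.indicator_of_mem ((hm W).2 (Finset.mem_powerset.1 hW))]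
      simp
    · intro W _ hW
      rw [Set.indicator_of_notMem (by rwa [hm, ← Finset.mem_powerset]), mul_zero]
  · have he : negCone b q t m = ∅ := by
      push Not at h
      obtain ⟨i, hi⟩ := h
      refine Set.eq_empty_of_forall_notMem fun x hx => ?_
      rcases hx i with h' | h'
      · linarith
      · linarith [h'.1]
    rw [he, hv0, Finset.sum_eq_zero]
    intro W _
    rw [Set.indicator_of_notMem, mul_zero]
    rintro ⟨h₁, h₂⟩
    refine h fun i => ?_
    by_cases hi : i ∈ W
    · exact (h₁ i hi).le
    · exact h₂ i hi

theorem simplex_reciprocity [DecidableEq ι] (p : ℕ) (hp : 0 < p)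
    (hpb : ∀ i j, ∃ n : ℤ, (p : ℝ) * b i j = n) :
    ∃ Q : ZMod p → ℝ[X], ∀ t : ℤ, 0 < t →
      HasSum (fun m => v (posCone b q t m)) ((Q t).eval (t : ℝ)) ∧
      HasSum (fun m => v (negCone b q (-t) m))
        ((-1) ^ d * (Q ((-t : ℤ) : ZMod p)).eval ((-t : ℤ) : ℝ)) := by
  choose Q hQ using exists_polynomial_card_faceSet b p hp hpb
  refine ⟨fun r => ∑ W : Finset ι, C (v (⋂ i ∈ W, sideCone b q i)) * Q W r,
    fun t ht => ⟨?_, ?_⟩⟩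
  · simp_rw [valuation_posCone b q hv0, eval_finsetSum, eval_mul, eval_C]
    refine hasSum_sum fun W _ => ?_
    rw [← (hQ W t ht).1]
    exact (hasSum_indicator_one (finite_faceSet_pos b W t)).mul_left _
  · simp_rw [valuation_negCone b q hv0 hval, eval_finsetSum, eval_mul, eval_C, Finset.mul_sum]
    refine hasSum_sum fun W _ => ?_
    rw [(hQ W t ht).2]
    have h : ((-1 : ℝ) ^ d) * (-1) ^ d = 1 := by rw [← mul_pow]; simp
    have e : (-1 : ℝ) ^ d * (v (⋂ i ∈ W, sideCone b q i) * ((-1) ^ (d + W.card) *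
        (Nat.card (faceSet b W (· ≤ 0) (-t)) : ℝ))) =
        (-1) ^ W.card * v (⋂ i ∈ W, sideCone b q i) *
          (Nat.card (faceSet b W (· ≤ 0) (-t)) : ℝ) := by
      rw [pow_add]
      linear_combination (v (⋂ i ∈ W, sideCone b q i) * (-1) ^ W.card *
        (Nat.card (faceSet b W (· ≤ 0) (-t)) : ℝ)) * h
    rw [e]
    exact (hasSum_indicator_one (finite_faceSet_nonpos b W (-t))).mul_left _

end Simplex

section AffineLemmas

variable {E : Type*} [AddCommGroup E] [Module ℝ E]

theorem affineIndependent_coe_insert {s : Set E} (hs : AffineIndependent ℝ ((↑) : s → E)) {w : E}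
    (hw : w ∉ affineSpan ℝ s) : AffineIndependent ℝ ((↑) : ↥(insert w s) → E) := by
  have hmem : ∀ y : ↥(insert w s), y ≠ ⟨w, mem_insert w s⟩ → (y : E) ∈ s := fun y hy =>
    y.2.resolve_left fun h => hy (Subtype.ext h)
  refine AffineIndependent.affineIndependent_of_notMem_span (i := ⟨w, mem_insert w s⟩) ?_ ?_
  · exact hs.comp_embedding ⟨fun y : {y : ↥(insert w s) // y ≠ ⟨w, mem_insert w s⟩} =>
      (⟨y.1.1, hmem y.1 y.2⟩ : s), fun y z h => by simpa [Subtype.ext_iff] using h⟩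
  · refine fun h => hw (affineSpan_mono ℝ ?_ h)
    rintro _ ⟨y, hy, rfl⟩
    exact hmem y hy

theorem affineMap_sum_smul (f : E →ᵃ[ℝ] ℝ) {κ : Type*} (s : Finset κ) (μ : κ → ℝ) (x : κ → E)
    (hμ : ∑ v ∈ s, μ v = 1) : f (∑ v ∈ s, μ v • x v) = ∑ v ∈ s, μ v * f (x v) := by
  have h : ∀ y, f y = f.linear y + f 0 := fun y => by rw [f.decomp']; simp
  simp_rw [h (∑ v ∈ s, μ v • x v), map_sum, map_smul, h (x _), mul_add, Finset.sum_add_distrib,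
    ← Finset.sum_mul, hμ, one_mul, smul_eq_mul]

theorem AffineBasis.sum_coord_smul_apply {ι : Type*} [Fintype ι] (b : AffineBasis ι ℝ E)
    (f : E →ᵃ[ℝ] ℝ) (y : E) : f y = ∑ i, b.coord i y * f (b i) := by
  conv_lhs => rw [← b.linear_combination_coord_eq_self y]
  exact affineMap_sum_smul f _ _ _ (b.sum_coord_apply_eq_one y)

/-- The affine function interpolating the values `ω` on an affine basis. -/
def AffineBasis.interpolate {ι : Type*} [Fintype ι] (b : AffineBasis ι ℝ E) (ω : E → ℝ) :
    E →ᵃ[ℝ] ℝ := ∑ i, ω (b i) • b.coord i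

theorem AffineBasis.interpolate_apply {ι : Type*} [Fintype ι] (b : AffineBasis ι ℝ E) (ω : E → ℝ)
    (y : E) : b.interpolate ω y = ∑ i, b.coord i y * ω (b i) := by
  have h : ∀ s : Finset ι, (∑ i ∈ s, ω (b i) • b.coord i) y = ∑ i ∈ s, b.coord i y * ω (b i) := by
    classical
    intro s
    induction s using Finset.induction_on with
    | empty => simp
    | insert a s ha ih =>
      rw [Finset.sum_insert ha, Finset.sum_insert ha, ← ih]
      simp [mul_comm]
  exact h _

theorem AffineBasis.interpolate_self {ι : Type*} [Fintype ι] (b : AffineBasis ι ℝ E) (ω : E → ℝ)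
    (i : ι) : b.interpolate ω (b i) = ω (b i) := by
  classical
  rw [b.interpolate_apply, Finset.sum_eq_single i]
  · simp
  · intro j _ hj
    simp [b.coord_apply_ne hj]
  · simp

end AffineLemmas

section Triangulation

variable {E : Type*} [AddCommGroup E] [Module ℝ E]

/-- The affine bases with elements in the finite set `V`. -/
def VertexBasis (V : Finset E) : Type _ :=
  {B : Finset E // B ⊆ V ∧ AffineIndependent ℝ ((↑) : B → E) ∧ affineSpan ℝ (B : Set E) = ⊤}

instance (V : Finset E) : Finite (VertexBasis V) := by
  classical
  refine Finite.of_injective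
    (fun B : VertexBasis V => (⟨B.1, Finset.mem_powerset.2 B.2.1⟩ : V.powerset))
    fun B B' h => Subtype.ext (by simpa using h)

variable {V : Finset E}

/-- The affine basis underlying a `VertexBasis`. -/
def VertexBasis.basis (B : VertexBasis V) : AffineBasis B.1 ℝ E :=
  ⟨(↑), B.2.2.1, by simpa using B.2.2.2⟩

@[simp] theorem VertexBasis.basis_apply (B : VertexBasis V) (i : B.1) : B.basis i = i := rfl

theorem VertexBasis.coord_coe (B : VertexBasis V) (i j : B.1) [Decidable (i = j)] :
    B.basis.coord i (j : E) = if i = j then 1 else 0 := by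
  classical
  rw [← B.basis_apply j, B.basis.coord_apply]
  congr

theorem VertexBasis.interpolate_of_mem (B : VertexBasis V) (ω : E → ℝ) {v : E} (hv : v ∈ B.1) :
    B.basis.interpolate ω v = ω v :=
  B.basis.interpolate_self ω ⟨v, hv⟩

theorem exists_vertexBasis_superset (hV : affineSpan ℝ (V : Set E) = ⊤) {t : Finset E}
    (ht : t ⊆ V) (hai : AffineIndependent ℝ ((↑) : t → E)) : ∃ B : VertexBasis V, t ⊆ B.1 := by
  classical
  let S : Finset (Finset E) :=
    {B ∈ V.powerset | t ⊆ B ∧ AffineIndependent ℝ ((↑) : B → E)}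
  obtain ⟨B, hB, hmax⟩ := S.exists_max_image Finset.card ⟨t, by simp [S, ht, hai]⟩
  simp only [S, Finset.mem_filter, Finset.mem_powerset] at hB hmax
  refine ⟨⟨B, hB.1, hB.2.2, ?_⟩, hB.2.1⟩
  rw [eq_top_iff, ← hV, affineSpan_le]
  intro w hw
  by_contra hwB
  have hwB' : w ∉ B := fun h => hwB (subset_affineSpan ℝ _ h)
  have hins := affineIndependent_coe_insert (s := (B : Set E)) hB.2.2 hwB
  rw [← Finset.coe_insert] at hins
  have := hmax (insert w B) ⟨Finset.insert_subset hw hB.1,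
    hB.2.1.trans (Finset.subset_insert _ _), hins⟩
  rw [Finset.card_insert_of_notMem hwB'] at this
  omega

/-- A weight is generic if no point of `V` outside a basis lies on the affine function
interpolating the weight on that basis. -/
def GenericWeight (V : Finset E) (ω : E → ℝ) : Prop :=
  ∀ B : VertexBasis V, ∀ w ∈ V, w ∉ B.1 → B.basis.interpolate ω w ≠ ω w

theorem exists_genericWeight (V : Finset E) : ∃ ω, GenericWeight V ω := by
  classical
  let F : {x : VertexBasis V × V // x.2.1 ∉ x.1.1} → Module.Dual ℝ (E → ℝ) := fun x =>
    ∑ i, x.1.1.basis.coord i x.1.2.1 • LinearMap.proj (i : E) - LinearMap.proj x.1.2.1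
  have hF : ∀ x ω, F x ω = x.1.1.basis.interpolate ω x.1.2.1 - ω x.1.2.1 := fun x ω => by
    simp [F, AffineBasis.interpolate_apply]
  obtain ⟨ω, hω⟩ := Module.Dual.exists_forall_ne_zero_of_forall_exists F (by
    rintro ⟨⟨B, w⟩, hw⟩
    refine ⟨Pi.single w.1 1, ?_⟩
    rw [hF, AffineBasis.interpolate_apply, Finset.sum_eq_zero]
    · simp
    · rintro i -
      have : (i : E) ≠ w.1 := fun h => hw (h ▸ i.2)
      simp [this])
  refine ⟨ω, fun B w hw hwB h => hω ⟨⟨B, w, hw⟩, hwB⟩ ?_⟩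
  rw [hF, h, sub_self]

/-- The basis `B` spans a cell of the regular triangulation defined by the weight `ω`. -/
def VertexBasis.IsLower (B : VertexBasis V) (ω : E → ℝ) : Prop :=
  ∀ w ∈ V, w ∉ B.1 → B.basis.interpolate ω w < ω w

/-- A point is generic if it lies on no facet hyperplane of a simplex with vertices in `V`. -/
def GenericPoint (V : Finset E) (y : E) : Prop :=
  ∀ (B : VertexBasis V) (i : B.1), B.basis.coord i y ≠ 0

theorem VertexBasis.IsLower.subset {ω : E → ℝ} {B B' : VertexBasis V} (hB : B.IsLower ω) {y : E}
    (hy' : ∀ i, 0 < B'.basis.coord i y)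
    (hle : B'.basis.interpolate ω y ≤ B.basis.interpolate ω y) : B'.1 ⊆ B.1 := by
  intro w hw
  by_contra hwB
  refine absurd hle (not_le.2 ?_)
  rw [B'.basis.sum_coord_smul_apply (B.basis.interpolate ω), B'.basis.interpolate_apply]
  refine Finset.sum_lt_sum (fun i _ => ?_) ⟨⟨w, hw⟩, Finset.mem_univ _, ?_⟩
  · refine mul_le_mul_of_nonneg_left ?_ (hy' i).le
    by_cases hi : (i : E) ∈ B.1
    · exact (B.basis.interpolate_self ω ⟨i, hi⟩).le
    · exact (hB _ (B'.2.1 i.2) hi).le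
  · exact mul_lt_mul_of_pos_left (hB _ (B'.2.1 hw) hwB) (hy' _)

theorem VertexBasis.IsLower.eq {ω : E → ℝ} {B B' : VertexBasis V} (hB : B.IsLower ω)
    (hB' : B'.IsLower ω) {y : E} (hy : ∀ i, 0 < B.basis.coord i y)
    (hy' : ∀ i, 0 < B'.basis.coord i y) : B = B' := by
  rcases le_total (B'.basis.interpolate ω y) (B.basis.interpolate ω y) with h | h
  · have hs := hB.subset hy' h
    refine Subtype.ext (Finset.Subset.antisymm (hB'.subset hy ?_) hs)
    rw [B'.basis.sum_coord_smul_apply (B.basis.interpolate ω), B'.basis.interpolate_apply]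
    refine Finset.sum_le_sum fun i _ => ?_
    rw [B'.basis_apply, B.interpolate_of_mem ω (hs i.2)]
  · have hs := hB'.subset hy h
    refine Subtype.ext (Finset.Subset.antisymm hs (hB.subset hy' ?_))
    rw [B.basis.sum_coord_smul_apply (B'.basis.interpolate ω), B.basis.interpolate_apply]
    refine Finset.sum_le_sum fun i _ => ?_
    rw [B.basis_apply, B'.interpolate_of_mem ω (hs i.2)]

theorem exists_vertexBasis_of_sum (hV : affineSpan ℝ (V : Set E) = ⊤) (ω : E → ℝ) {t : Finset E}
    (ht : t ⊆ V) (hai : AffineIndependent ℝ ((↑) : t → E)) {μ : E → ℝ} (hμ : ∀ v ∈ t, 0 ≤ μ v)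
    (hμ1 : ∑ v ∈ t, μ v = 1) (hy : GenericPoint V (∑ v ∈ t, μ v • v)) :
    ∃ B : VertexBasis V, (∀ i, 0 < B.basis.coord i (∑ v ∈ t, μ v • v)) ∧
      B.basis.interpolate ω (∑ v ∈ t, μ v • v) = ∑ v ∈ t, μ v * ω v := by
  classical
  obtain ⟨B, hB⟩ := exists_vertexBasis_superset hV ht hai
  refine ⟨B, fun i => lt_of_le_of_ne ?_ (hy B i).symm, ?_⟩
  · rw [affineMap_sum_smul _ _ _ _ hμ1]
    refine Finset.sum_nonneg fun v hv => mul_nonneg (hμ v hv) ?_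
    rw [B.coord_coe i ⟨v, hB hv⟩]
    split_ifs <;> simp
  · rw [affineMap_sum_smul _ _ _ _ hμ1]
    exact Finset.sum_congr rfl fun v hv => by rw [B.interpolate_of_mem ω (hB hv)]

theorem sum_insert_erase_smul {κ M : Type*} [DecidableEq κ] [AddCommGroup M] [Module ℝ M]
    {s : Finset κ} {i w : κ} (hw : w ∉ s) {μ : κ → ℝ} {ε : ℝ} {a c : s → ℝ}
    (hμ : ∀ j : s, μ j = a j - ε * c j) (hi : μ i = 0) (hμw : μ w = ε) (f : κ → M) :
    ∑ v ∈ insert w (s.erase i), μ v • f v =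
      ∑ j : s, a j • f j + ε • (f w - ∑ j : s, c j • f j) := by
  have h0 : ∑ v ∈ s.erase i, μ v • f v = ∑ j : s, μ j • f j := by
    rw [Finset.sum_erase _ (by rw [hi, zero_smul]), ← Finset.sum_coe_sort]
  rw [Finset.sum_insert fun h => hw (Finset.mem_of_mem_erase h), h0, hμw]
  simp_rw [hμ, sub_smul, Finset.sum_sub_distrib, mul_smul, ← Finset.smul_sum]
  module

theorem exists_vertexBasis_interpolate_lt (hV : affineSpan ℝ (V : Set E) = ⊤) {ω : E → ℝ}
    {B : VertexBasis V} {y w : E} (hy : GenericPoint V y) (hB : ∀ i, 0 < B.basis.coord i y)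
    (hw : w ∈ V) (hwB : w ∉ B.1) (hlt : ω w < B.basis.interpolate ω w) :
    ∃ B' : VertexBasis V, (∀ i, 0 < B'.basis.coord i y) ∧
      B'.basis.interpolate ω y < B.basis.interpolate ω y := by
  classical
  have hc1 := B.basis.sum_coord_apply_eq_one w
  obtain ⟨i, hi, hmin⟩ := Finset.exists_min_image
    (Finset.univ.filter fun i => 0 < B.basis.coord i w)
    (fun i => B.basis.coord i y / B.basis.coord i w) (by
      by_contra h
      rw [Finset.not_nonempty_iff_eq_empty, Finset.filter_eq_empty_iff] at h
      have := Finset.sum_nonpos fun i (hi : i ∈ Finset.univ) => not_lt.1 (h hi)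
      linarith)
  simp only [Finset.mem_filter, Finset.mem_univ, true_and] at hi hmin
  set ε := B.basis.coord i y / B.basis.coord i w with hε
  have hε0 : 0 < ε := div_pos (hB i) hi
  have hεi : B.basis.coord i y - ε * B.basis.coord i w = 0 := by
    rw [hε, div_mul_cancel₀ _ hi.ne', sub_self]
  let μ : E → ℝ := fun v => if h : v ∈ B.1 then
    B.basis.coord ⟨v, h⟩ y - ε * B.basis.coord ⟨v, h⟩ w else ε
  have hμ : ∀ j : B.1, μ j = B.basis.coord j y - ε * B.basis.coord j w := fun j => by simp [μ]
  have hμw : μ w = ε := by simp [μ, hwB]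
  have hμi : μ i = 0 := by rw [hμ, hεi]
  have hy_eq : ∑ v ∈ insert w (B.1.erase i), μ v • v = y := by
    rw [sum_insert_erase_smul hwB hμ hμi hμw fun v => v]
    have h1 := B.basis.linear_combination_coord_eq_self y
    have h2 := B.basis.linear_combination_coord_eq_self w
    simp only [VertexBasis.basis_apply] at h1 h2
    rw [h1, h2, sub_self, smul_zero, add_zero]
  have hai : AffineIndependent ℝ ((↑) : ↥(insert w (B.1.erase i)) → E) := by
    have h1 : AffineIndependent ℝ ((↑) : ↥((B.1.erase i : Finset E) : Set E) → E) :=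
      AffineIndependent.mono (t := (B.1 : Set E)) B.2.2.1 (by simp)
    have h2 : w ∉ affineSpan ℝ ((B.1.erase i : Finset E) : Set E) := by
      intro h
      have := AffineMap.eqOn_affineSpan (f := B.basis.coord i) (g := AffineMap.const ℝ E 0)
        (s := ((B.1.erase i : Finset E) : Set E)) (fun v hv => by
          have hv' := Finset.mem_erase.1 (Finset.mem_coe.1 hv)
          have hne : i ≠ ⟨v, hv'.2⟩ := fun h => hv'.1 (by rw [h])
          simpa [hne] using B.coord_coe i ⟨v, hv'.2⟩) h
      simp only [AffineMap.const_apply] at this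
      linarith
    have h3 := affineIndependent_coe_insert h1 h2
    rwa [← Finset.coe_insert] at h3
  obtain ⟨B', hpos, hval⟩ := exists_vertexBasis_of_sum hV ω
    (Finset.insert_subset hw ((Finset.erase_subset _ _).trans B.2.1)) hai (μ := μ) (by
      intro v hv
      rcases Finset.mem_insert.1 hv with rfl | hv
      · exact hμw.symm ▸ hε0.le
      · have hvB := Finset.mem_of_mem_erase hv
        rw [hμ ⟨v, hvB⟩, sub_nonneg]
        rcases lt_or_ge 0 (B.basis.coord ⟨v, hvB⟩ w) with h | h
        · exact (le_div_iff₀ h).1 (hmin _ h)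
        · exact (mul_nonpos_of_nonneg_of_nonpos hε0.le h).trans (hB _).le)
    (by
      have := sum_insert_erase_smul hwB hμ hμi hμw fun _ => (1 : ℝ)
      simp only [smul_eq_mul, mul_one] at this
      rw [this, B.basis.sum_coord_apply_eq_one, hc1]
      ring) (by rwa [hy_eq])
  rw [hy_eq] at hpos hval
  refine ⟨B', hpos, ?_⟩
  have := sum_insert_erase_smul hwB hμ hμi hμw ω
  simp only [smul_eq_mul] at this
  rw [hval, this, B.basis.interpolate_apply]
  rw [B.basis.interpolate_apply] at hlt
  simp only [VertexBasis.basis_apply] at hlt ⊢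
  nlinarith

theorem exists_isLower (hV : affineSpan ℝ (V : Set E) = ⊤) {ω : E → ℝ} (hω : GenericWeight V ω)
    {y : E} (hy : GenericPoint V y) (hyV : y ∈ convexHull ℝ (V : Set E)) :
    ∃ B : VertexBasis V, B.IsLower ω ∧ ∀ i, 0 < B.basis.coord i y := by
  classical
  let S : Set (VertexBasis V) := {B | ∀ i, 0 < B.basis.coord i y}
  have hS : S.Nonempty := by
    rw [convexHull_eq_union] at hyV
    simp only [Set.mem_iUnion] at hyV
    obtain ⟨t, ht, hai, hyt⟩ := hyV
    obtain ⟨μ, hμ, hμ1, rfl⟩ := Finset.mem_convexHull'.1 hyt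
    obtain ⟨B, hB, -⟩ := exists_vertexBasis_of_sum hV ω (by exact_mod_cast ht) hai hμ hμ1 hy
    exact ⟨B, hB⟩
  obtain ⟨B, hB, hmin⟩ := S.exists_min_image (fun B => B.basis.interpolate ω y) S.toFinite hS
  refine ⟨B, fun w hw hwB => lt_of_le_of_ne (not_lt.1 fun hlt => ?_) (hω B w hw hwB), hB⟩
  obtain ⟨B', hB', h⟩ := exists_vertexBasis_interpolate_lt hV hy hB hw hwB hlt
  exact absurd (hmin B' hB') (not_le.2 h)

theorem VertexBasis.mem_convexHull (B : VertexBasis V) {y : E} (hy : ∀ i, 0 ≤ B.basis.coord i y) :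
    y ∈ convexHull ℝ (V : Set E) := by
  have h : y ∈ convexHull ℝ (range B.basis) := by
    rw [AffineBasis.convexHull_eq_nonneg_coord]
    exact hy
  refine convexHull_mono ?_ h
  rintro _ ⟨i, rfl⟩
  exact B.2.1 i.2

end Triangulation

section TangentCones

open Filter Topology

theorem eventually_pos_add_mul_s9 (a b : ℝ) :
    ∀ᶠ ε in 𝓝[>] (0 : ℝ), (0 < a + ε * b ↔ 0 < a ∨ (a = 0 ∧ 0 < b)) ∧
      (a + ε * b = 0 ↔ a = 0 ∧ b = 0) := by
  have hc : Tendsto (fun ε : ℝ => a + ε * b) (𝓝[>] 0) (𝓝 a) := by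
    have : ContinuousAt (fun ε : ℝ => a + ε * b) 0 := by fun_prop
    simpa [ContinuousAt] using! this.mono_left nhdsWithin_le_nhds
  rcases lt_trichotomy a 0 with h | h | h
  · filter_upwards [hc.eventually_lt_const h] with ε hε
    simp [hε.ne, hε.not_gt, h.ne, h.not_gt]
  · filter_upwards [self_mem_nhdsWithin] with ε hε
    have hε' : 0 < ε := hε
    simp [h, hε', hε'.ne']
  · filter_upwards [hc.eventually_const_lt h] with ε hε
    simp [hε, hε.ne', h, h.ne']

section HalfOpen

variable {E : Type*} [NormedAddCommGroup E] [NormedSpace ℝ E] {V : Finset E}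

theorem VertexBasis.exists_linear_coord_ne_zero [Nontrivial E] (B : VertexBasis V) (i : B.1) :
    ∃ x, (B.basis.coord i).linear x ≠ 0 := by
  have : Nontrivial B.1 := by
    by_contra h
    rw [not_nontrivial_iff_subsingleton] at h
    exact not_subsingleton E (AffineSubspace.subsingleton_of_subsingleton_span_eq_top
      (Set.subsingleton_coe (B.1 : Set E) |>.1 h) B.2.2.2)
  obtain ⟨j, hj⟩ := exists_ne i
  refine ⟨(i : E) -ᵥ (j : E), ?_⟩
  classical
  rw [AffineMap.linearMap_vsub, B.coord_coe i i, B.coord_coe i j]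
  simp [hj.symm]

theorem exists_genericPoint [Nontrivial E] [FiniteDimensional ℝ E] {U : Set E} (hU : IsOpen U)
    (hne : U.Nonempty) : ∃ q ∈ U, GenericPoint V q := by
  obtain ⟨q₀, hq₀⟩ := hne
  obtain ⟨u, hu⟩ := Module.Dual.exists_forall_ne_zero_of_forall_exists
    (fun x : Σ B : VertexBasis V, B.1 => (x.1.basis.coord x.2).linear)
    fun x => x.1.exists_linear_coord_ne_zero x.2
  have h1 : ∀ᶠ ε in 𝓝[>] (0 : ℝ), q₀ + ε • u ∈ U := by
    have : ContinuousAt (fun ε : ℝ => q₀ + ε • u) 0 := by fun_prop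
    exact nhdsWithin_le_nhds (this.preimage_mem_nhds (hU.mem_nhds (by simpa using! hq₀)))
  have h2 : ∀ᶠ ε in 𝓝[>] (0 : ℝ), ∀ x : Σ B : VertexBasis V, B.1,
      x.1.basis.coord x.2 (q₀ + ε • u) ≠ 0 := by
    refine eventually_all.2 fun x => ?_
    filter_upwards [eventually_pos_add_mul_s9 (x.1.basis.coord x.2 q₀)
      ((x.1.basis.coord x.2).linear u)] with ε hε
    rw [add_comm, ← vadd_eq_add, AffineMap.map_vadd, vadd_eq_add, add_comm, map_smul, smul_eq_mul]
    exact fun h => hu x (hε.2.1 h).2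
  obtain ⟨ε, h1, h2⟩ := (h1.and h2).exists
  exact ⟨_, h1, fun B i => h2 ⟨B, i⟩⟩

/-- The half-open simplex of `B` that keeps only those facets whose hyperplane has `q` on the side
of the simplex (if `σ` is positive), respectively on the opposite side (if `σ` is negative). -/
def VertexBasis.halfOpen (B : VertexBasis V) (q : E) (σ : ℝ) : Set E :=
  {z | ∀ i, 0 < B.basis.coord i z ∨ (B.basis.coord i z = 0 ∧ 0 < σ * B.basis.coord i q)}

theorem eventually_lineMap_halfOpen {q : E} (hq : GenericPoint V q) {σ : ℝ} (hσ : σ ≠ 0) (z : E) :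
    ∀ᶠ δ in 𝓝[>] (0 : ℝ), GenericPoint V (AffineMap.lineMap z q (σ * δ)) ∧
      ∀ B : VertexBasis V, (∀ i, 0 < B.basis.coord i (AffineMap.lineMap z q (σ * δ))) ↔
        z ∈ B.halfOpen q σ := by
  have h : ∀ᶠ δ in 𝓝[>] (0 : ℝ), ∀ x : Σ B : VertexBasis V, B.1,
      x.1.basis.coord x.2 (AffineMap.lineMap z q (σ * δ)) ≠ 0 ∧
      (0 < x.1.basis.coord x.2 (AffineMap.lineMap z q (σ * δ)) ↔
        0 < x.1.basis.coord x.2 z ∨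
          (x.1.basis.coord x.2 z = 0 ∧ 0 < σ * x.1.basis.coord x.2 q)) := by
    refine eventually_all.2 fun ⟨B, i⟩ => ?_
    set a := B.basis.coord i z
    set c := B.basis.coord i q with hc
    filter_upwards [eventually_pos_add_mul_s9 a (σ * (c - a))] with δ hδ
    have e : B.basis.coord i (AffineMap.lineMap z q (σ * δ)) = a + δ * (σ * (c - a)) := by
      rw [AffineMap.apply_lineMap, AffineMap.lineMap_apply_ring']
      ring
    rw [e]
    refine ⟨fun h0 => ?_, ?_⟩
    · obtain ⟨h1, h2⟩ := hδ.2.1 h0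
      rw [h1, sub_zero] at h2
      exact hq B i ((mul_eq_zero.1 h2).resolve_left hσ)
    · rw [hδ.1]
      refine or_congr_right (and_congr_right fun h1 => ?_)
      rw [h1, sub_zero]
  filter_upwards [h] with δ hδ
  exact ⟨fun B i => (hδ ⟨B, i⟩).1, fun B => forall_congr' fun i => (hδ ⟨B, i⟩).2⟩

theorem VertexBasis.IsLower.eq_of_mem_halfOpen {ω : E → ℝ} {B B' : VertexBasis V}
    (hB : B.IsLower ω) (hB' : B'.IsLower ω) {q : E} (hq : GenericPoint V q) {σ : ℝ} (hσ : σ ≠ 0)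
    {z : E} (hz : z ∈ B.halfOpen q σ) (hz' : z ∈ B'.halfOpen q σ) : B = B' := by
  obtain ⟨δ, -, h⟩ := (eventually_lineMap_halfOpen hq hσ z).exists
  exact hB.eq hB' ((h B).2 hz) ((h B').2 hz')

theorem mem_convexHull_iff_exists_halfOpen (hV : affineSpan ℝ (V : Set E) = ⊤) {ω : E → ℝ}
    (hω : GenericWeight V ω) {q : E} (hq : GenericPoint V q) (hqV : q ∈ convexHull ℝ (V : Set E))
    {z : E} : z ∈ convexHull ℝ (V : Set E) ↔
      ∃ B : VertexBasis V, B.IsLower ω ∧ z ∈ B.halfOpen q 1 := by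
  constructor
  · intro hz
    obtain ⟨δ, ⟨hgen, h⟩, hδ⟩ := ((eventually_lineMap_halfOpen hq one_ne_zero z).and
      (Ioo_mem_nhdsGT zero_lt_one)).exists
    obtain ⟨B, hB, hpos⟩ := exists_isLower hV hω hgen
      ((convex_convexHull ℝ _).lineMap_mem hz hqV ⟨by linarith [hδ.1], by linarith [hδ.2]⟩)
    exact ⟨B, hB, (h B).1 hpos⟩
  · rintro ⟨B, -, hz⟩
    exact B.mem_convexHull fun i => (hz i).elim le_of_lt fun h => h.1.ge

theorem mem_interior_convexHull_iff_exists_halfOpen (hV : affineSpan ℝ (V : Set E) = ⊤)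
    {ω : E → ℝ} (hω : GenericWeight V ω) {q : E} (hq : GenericPoint V q)
    (hqV : q ∈ interior (convexHull ℝ (V : Set E))) {z : E} :
    z ∈ interior (convexHull ℝ (V : Set E)) ↔
      ∃ B : VertexBasis V, B.IsLower ω ∧ z ∈ B.halfOpen q (-1) := by
  have hev := eventually_lineMap_halfOpen hq (σ := -1) (by norm_num) z
  constructor
  · intro hz
    have hint : ∀ᶠ δ in 𝓝[>] (0 : ℝ),
        AffineMap.lineMap z q (-1 * δ) ∈ interior (convexHull ℝ (V : Set E)) := by
      have : ContinuousAt (fun δ : ℝ => AffineMap.lineMap z q (-1 * δ)) 0 := by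
        simp only [AffineMap.lineMap_apply_module']
        fun_prop
      exact nhdsWithin_le_nhds
        (this.preimage_mem_nhds (isOpen_interior.mem_nhds (by simpa using! hz)))
    obtain ⟨δ, ⟨hgen, h⟩, hδ⟩ := (hev.and hint).exists
    obtain ⟨B, hB, hpos⟩ := exists_isLower hV hω hgen (interior_subset hδ)
    exact ⟨B, hB, (h B).1 hpos⟩
  · rintro ⟨B, -, hz⟩
    obtain ⟨δ, ⟨-, h⟩, hδ⟩ := (hev.and self_mem_nhdsWithin).exists
    have hδ' : 0 < δ := hδ
    have hy := B.mem_convexHull fun i => ((h B).2 hz i).le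
    have := (convex_convexHull ℝ (V : Set E)).combo_interior_self_mem_interior hqV hy
      (a := δ / (1 + δ)) (b := 1 / (1 + δ)) (by positivity) (by positivity) (by field_simp; ring)
    convert this using 1
    rw [AffineMap.lineMap_apply_module']
    match_scalars <;> field_simp <;> ring

end HalfOpen

section Tangent

variable {d : ℕ}

theorem mem_tangentCone_iff {A : Set (Fin d → ℝ)} {m x : Fin d → ℝ} :
    x ∈ TangentCone d A m ↔ ∀ᶠ ε in 𝓝[>] (0 : ℝ), m + ε • x ∈ A := by
  rw [Filter.Eventually, mem_nhdsGT_iff_exists_Ioc_subset]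
  simp [TangentCone, subset_def]

variable {V : Finset (Fin d → ℝ)} (B : VertexBasis V) {q : Fin d → ℝ} {t : ℤ} (m : Fin d → ℤ)
  (x : Fin d → ℝ)

theorem VertexBasis.mul_coord_inv_smul (ht : t ≠ 0) (ε : ℝ) (i : B.1) :
    (t : ℝ) * B.basis.coord i ((t : ℝ)⁻¹ • ((fun j => (m j : ℝ)) + ε • x)) =
      intCoord B.basis i m t + ε * (B.basis.coord i).linear x := by
  rw [← homCoord_smul, smul_inv_smul₀ (by exact_mod_cast ht), intCoord, homCoord_apply,
    homCoord_apply, map_add, map_smul, smul_eq_mul]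
  ring

theorem eventually_mem_halfOpen_pos (ht : 0 < t) :
    ∀ᶠ ε in 𝓝[>] (0 : ℝ), (t : ℝ)⁻¹ • ((fun j => (m j : ℝ)) + ε • x) ∈ B.halfOpen q 1 ↔
      x ∈ posCone B.basis q t m := by
  have h := eventually_all.2 fun i : B.1 =>
    eventually_pos_add_mul_s9 (intCoord B.basis i m t) ((B.basis.coord i).linear x)
  filter_upwards [h] with ε hε
  refine forall_congr' fun i => ?_
  have ht' : (0 : ℝ) < t := by exact_mod_cast ht
  have e := B.mul_coord_inv_smul m x ht.ne' ε i
  set c := B.basis.coord i ((t : ℝ)⁻¹ • ((fun j => (m j : ℝ)) + ε • x))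
  have h1 : 0 < (t : ℝ) * c ↔ 0 < c := mul_pos_iff_of_pos_left ht'
  have h2 : (t : ℝ) * c = 0 ↔ c = 0 := mul_eq_zero_iff_left ht'.ne'
  rw [e, (hε i).1] at h1
  rw [e, (hε i).2] at h2
  rw [← h1, ← h2, one_mul, sideCone, Set.mem_ofPred_eq]
  tauto

theorem eventually_mem_halfOpen_neg (hq : GenericPoint V q) (ht : t < 0) :
    ∀ᶠ ε in 𝓝[>] (0 : ℝ), (t : ℝ)⁻¹ • ((fun j => (m j : ℝ)) + ε • x) ∈ B.halfOpen q (-1) ↔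
      x ∈ negCone B.basis q t m := by
  have h := eventually_all.2 fun i : B.1 =>
    eventually_pos_add_mul_s9 (-intCoord B.basis i m t) (-(B.basis.coord i).linear x)
  filter_upwards [h] with ε hε
  refine forall_congr' fun i => ?_
  have ht' : (t : ℝ) < 0 := by exact_mod_cast ht
  have e := B.mul_coord_inv_smul m x ht.ne ε i
  set c := B.basis.coord i ((t : ℝ)⁻¹ • ((fun j => (m j : ℝ)) + ε • x))
  have e' : -(t : ℝ) * c = -intCoord B.basis i m t + ε * -(B.basis.coord i).linear x := by
    rw [neg_mul, e]
    ring
  have h1 : 0 < -(t : ℝ) * c ↔ 0 < c := mul_pos_iff_of_pos_left (neg_pos.2 ht')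
  have h2 : -(t : ℝ) * c = 0 ↔ c = 0 := mul_eq_zero_iff_left (neg_pos.2 ht').ne'
  rw [e', (hε i).1] at h1
  rw [e', (hε i).2] at h2
  rw [← h1, ← h2, sideCone, Set.mem_ofPred_eq]
  have := hq B i
  grind

theorem valuation_tangentCone {v : Set (Fin d → ℝ) → ℝ} (hv0 : v ∅ = 0)
    (hval : ∀ A ∈ ConeLattice d, ∀ B ∈ ConeLattice d, v (A ∪ B) + v (A ∩ B) = v A + v B)
    {κ : Type*} [Fintype κ] {A : Set (Fin d → ℝ)} {m : Fin d → ℝ} {S C : κ → Set (Fin d → ℝ)}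
    {s : ℝ} (hA : ∀ y, y ∈ A ↔ ∃ k, s⁻¹ • y ∈ S k)
    (hS : ∀ z k l, z ∈ S k → z ∈ S l → k = l)
    (hC : ∀ k, ElemCone d (C k))
    (hSC : ∀ k x, ∀ᶠ ε in 𝓝[>] (0 : ℝ), s⁻¹ • (m + ε • x) ∈ S k ↔ x ∈ C k) :
    v (TangentCone d A m) = ∑ k, v (C k) := by
  have hT : TangentCone d A m = ⋃ k ∈ Finset.univ, C k := by
    ext x
    rw [mem_tangentCone_iff]
    have h : ∀ᶠ ε in 𝓝[>] (0 : ℝ), m + ε • x ∈ A ↔ ∃ k, x ∈ C k := by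
      filter_upwards [eventually_all.2 fun k => hSC k x] with ε hε
      rw [hA]
      exact exists_congr hε
    rw [eventually_congr h]
    simp
  rw [hT]
  refine valuation_biUnion hv0 hval hC (fun k l hkl => ?_) _
  refine Set.disjoint_left.2 fun x hk hl => ?_
  obtain ⟨ε, h1, h2⟩ := ((hSC k x).and (hSC l x)).exists
  exact hkl (hS _ k l (h1.2 hk) (h2.2 hl))

end Tangent

end TangentCones

theorem resMod_val_cast (p : ℕ) (hp : 0 < p) (t : ℤ) :
    (((resMod p hp t).val : ℕ) : ZMod p) = (t : ZMod p) := by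
  have h : 0 ≤ t % (p : ℤ) := Int.emod_nonneg t (by exact_mod_cast hp.ne')
  rw [← Int.cast_natCast, resMod, Int.toNat_of_nonneg h, ZMod.intCast_mod]

/-- **Valuation reciprocity.**  For a rational `d`-polytope `P` with denominator `p`
and a valuation `v` on the lattice generated by elementary cones, the quasi-polynomial
`V_P(t) = Σ_{m ∈ ℤ^d} v(K_{tP}(m))` evaluated at `-t` equals
`(-1)^d · V_{-P°}(t)`, where `V_{-P°}(t) = Σ_{m ∈ ℤ^d} v(K_{-tP°}(m))`. -/
theorem valuation_reciprocity
    (d : ℕ) (hd : 1 ≤ d)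
    (V : Finset (Fin d → ℝ)) (P : Set (Fin d → ℝ))
    -- `P` is the convex hull of the finite set `V` of rational points
    (hP : P = convexHull ℝ (V : Set (Fin d → ℝ)))
    (hrat : ∀ v ∈ V, ∀ i, ∃ q : ℚ, v i = (q : ℝ))
    -- `V` is exactly the vertex set of `P`
    (hvert : (V : Set (Fin d → ℝ)) = Set.extremePoints ℝ P)
    -- `P` is full-dimensional
    (hint : (interior P).Nonempty)
    -- `p` is the denominator of `P`
    (p : ℕ) (hp : 0 < p)
    (hpV : ∀ v ∈ V, ∀ i, ∃ n : ℤ, (p : ℝ) * v i = (n : ℝ))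
    (hpmin : ∀ q : ℕ, 0 < q → (∀ v ∈ V, ∀ i, ∃ n : ℤ, (q : ℝ) * v i = (n : ℝ)) → p ≤ q)
    -- `v` is a valuation on the lattice generated by elementary cones
    (v : Set (Fin d → ℝ) → ℝ)
    (hv0 : v ∅ = 0)
    (hval : ∀ A ∈ ConeLattice d, ∀ B ∈ ConeLattice d,
      v (A ∪ B) + v (A ∩ B) = v A + v B) :
    ∃ q : Fin p → Polynomial ℝ,
      ∀ t : ℕ, 1 ≤ t →
        (∑' m : Fin d → ℤ, v (TangentCone d ((t : ℝ) • P) (fun i => (m i : ℝ))))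
          = (q (resMod p hp (t : ℤ))).eval (t : ℝ) ∧
        (q (resMod p hp (-(t : ℤ)))).eval (-(t : ℝ))
          = (-1 : ℝ) ^ d *
            (∑' m : Fin d → ℤ,
              v (TangentCone d (-((t : ℝ) • interior P)) (fun i => (m i : ℝ)))) := by
  classical
  have : Nonempty (Fin d) := ⟨⟨0, hd⟩⟩
  subst hP
  have hV : affineSpan ℝ (V : Set (Fin d → ℝ)) = ⊤ :=
    interior_convexHull_nonempty_iff_affineSpan_eq_top.1 hint
  obtain ⟨ω, hω⟩ := exists_genericWeight V
  obtain ⟨q, hqV, hq⟩ := exists_genericPoint (V := V) isOpen_interior hint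
  let κ := {B : VertexBasis V // B.IsLower ω}
  let _ : Fintype κ := Fintype.ofFinite κ
  choose Q hQ using fun k : κ => simplex_reciprocity k.1.basis q hv0 hval p hp
    fun i => hpV _ (k.1.2.1 i.2)
  have hdisj : ∀ σ : ℝ, σ ≠ 0 → ∀ z (k l : κ), z ∈ k.1.halfOpen q σ → z ∈ l.1.halfOpen q σ →
      k = l := fun σ hσ z k l hk hl => Subtype.ext (k.2.eq_of_mem_halfOpen l.2 hq hσ hk hl)
  refine ⟨fun i => ∑ k, Q k (i.val : ZMod p), fun t ht => ?_⟩
  have ht' : (0 : ℤ) < t := by exact_mod_cast ht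
  have ht0 : (t : ℝ) ≠ 0 := by positivity
  simp only [resMod_val_cast, eval_finsetSum]
  constructor
  · have h : ∀ m : Fin d → ℤ, v (TangentCone d ((t : ℝ) • convexHull ℝ (V : Set (Fin d → ℝ)))
        fun i => (m i : ℝ)) = ∑ k : κ, v (posCone k.1.basis q t m) := fun m => by
      refine valuation_tangentCone hv0 hval (s := ((t : ℤ) : ℝ)) (fun y => ?_)
        (hdisj 1 one_ne_zero) (fun k => elemCone_posCone _ _ _ _)
        fun k x => eventually_mem_halfOpen_pos k.1 m x ht'
      rw [Int.cast_natCast, Set.mem_smul_set_iff_inv_smul_mem₀ ht0,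
        mem_convexHull_iff_exists_halfOpen hV hω hq (interior_subset hqV)]
      simp [κ]
    simp_rw [h]
    exact (hasSum_sum fun k _ => (hQ k t ht').1).tsum_eq
  · have h : ∀ m : Fin d → ℤ,
        v (TangentCone d (-((t : ℝ) • interior (convexHull ℝ (V : Set (Fin d → ℝ)))))
          fun i => (m i : ℝ)) = ∑ k : κ, v (negCone k.1.basis q (-t) m) := fun m => by
      refine valuation_tangentCone hv0 hval (s := ((-t : ℤ) : ℝ)) (fun y => ?_)
        (hdisj (-1) (by norm_num)) (fun k => elemCone_negCone _ _ _ _)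
        fun k x => eventually_mem_halfOpen_neg k.1 m x hq (by omega)
      rw [Set.mem_neg, Set.mem_smul_set_iff_inv_smul_mem₀ ht0, smul_neg, ← neg_smul, ← inv_neg,
        mem_interior_convexHull_iff_exists_halfOpen hV hω hq hqV]
      simp [κ]
    simp_rw [h]
    rw [(hasSum_sum fun k _ => (hQ k t ht').2).tsum_eq, Finset.mul_sum]
    refine Finset.sum_congr rfl fun k _ => ?_
    rw [← mul_assoc, ← mul_pow]
    simp

end
end
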